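/- Let G₁ be a planar graph with vertices v₁, v₂, v₃ all lying on a common face of some planar embedding of G₁, and let L' be a planar graph with terminals v₁, v₂, v₃ all lying on a common face of some planar embedding of L', where G₁ and L' are disjoint except for {v₁, v₂, v₃}. Then the union G₁ ∪ L' is planar. -/

import Mathlib

open Set

/-- A plane drawing of a graph with edge relation `E` and vertex set `S`:
vertices are mapped injectively to points of the plane, each edge to a simple arc
between the images of its endpoints, arcs intersect only at shared endpoints,
and no vertex lies on the interior of an arc. -/
structure PlaneDrawing {V : Type} (E : V → V → Prop) (S : Set V) where
  pos : V → ℝ × ℝ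
  posInj : S.InjOn pos
  edge_in : ∀ u w, E u w → u ∈ S ∧ w ∈ S
  arc : ∀ u w, E u w → Set (ℝ × ℝ)
  arc_isArc : ∀ u w (h : E u w), ∃ γ : Path (pos u) (pos w),
    Function.Injective γ ∧ Set.range γ = arc u w h
  arc_inter : ∀ u w u' w' (h : E u w) (h' : E u' w'), (u, w) ≠ (u', w') →
    arc u w h ∩ arc u' w' h' ⊆ ({pos u, pos w} ∩ {pos u', pos w'} : Set (ℝ × ℝ))
  vertex_arc : ∀ z ∈ S, ∀ u w (h : E u w), pos z ∈ arc u w h → z = u ∨ z = w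

/-- The subset of the plane occupied by the drawing. -/
def drawingSet {V : Type} {E : V → V → Prop} {S : Set V} (D : PlaneDrawing E S) :
    Set (ℝ × ℝ) :=
  (⋃ (u : V) (w : V) (h : E u w), D.arc u w h) ∪ D.pos '' S

/-- All vertices of `T` lie on a common face of the drawing `D` (a face being a
connected component of the complement of the drawing). -/
def OnCommonFace {V : Type} {E : V → V → Prop} {S : Set V} (D : PlaneDrawing E S)
    (T : Set V) : Prop :=
  ∃ x : ℝ × ℝ, x ∈ (drawingSet D)ᶜ ∧
    ∀ v ∈ T, D.pos v ∈ closure (connectedComponentIn (drawingSet D)ᶜ x)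

namespace BK

/-! ### Flat connections on the square lattice -/

section Flat
variable {A : Type*} [Group A]

/-- row products -/
def rowp (U : ℤ → ℤ → A) (a j : ℤ) : ℕ → A
  | 0 => 1
  | n + 1 => rowp U a j n * U (a + n) j

lemma rowp_tel (U R : ℤ → ℤ → A) (a j : ℤ) (n : ℕ)
    (h : ∀ k : ℕ, k < n → U (a + k) j * R (a + k) j = R (a + k - 1) j * U (a + k) (j - 1)) :
    rowp U a j n * R (a + n - 1) j = R (a - 1) j * rowp U a (j - 1) n := by
  induction n with
  | zero => simp [rowp]
  | succ n ih =>
    have h1 := ih (fun k hk => h k (by omega))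
    have h2 := h n (by omega)
    have e : a + ((n + 1 : ℕ) : ℤ) - 1 = a + n := by push_cast; ring
    simp only [rowp]
    rw [e, mul_assoc, h2, ← mul_assoc, h1, mul_assoc]

lemma rowp_add (U : ℤ → ℤ → A) (a j : ℤ) (m n : ℕ) :
    rowp U a j (m + n) = rowp U a j m * rowp U (a + m) j n := by
  induction n with
  | zero => simp [rowp]
  | succ n ih =>
    rw [← Nat.add_assoc]
    simp only [rowp, ih, mul_assoc]
    push_cast
    rw [add_assoc]

lemma flat_core (U R : ℤ → ℤ → A) (B : ℤ) (ri rj : ℤ)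
    (hU : ∀ i j, (B ≤ |i| ∨ B ≤ |j|) → U i j = 1)
    (hR : ∀ i j, (B ≤ |i| ∨ B ≤ |j|) → R i j = 1)
    (h : ∀ i j, (i, j) ≠ (ri, rj) → U i j * R i j = R (i - 1) j * U i (j - 1)) :
    U ri rj * R ri rj = R (ri - 1) rj * U ri (rj - 1) := by
  obtain ⟨m, hm⟩ : ∃ m : ℕ, B ≤ m ∧ |ri| ≤ m ∧ |rj| ≤ m :=
    ⟨(|B| + |ri| + |rj|).toNat, by
      have := abs_nonneg B; have := abs_nonneg ri; have := abs_nonneg rj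
      have := le_abs_self B
      omega⟩
  obtain ⟨hB, hri, hrj⟩ := hm
  have hri2 := abs_le.mp hri
  have hrj2 := abs_le.mp hrj
  set a : ℤ := -(m : ℤ) with ha
  set N : ℕ := 2 * m + 1 with hN
  have hRl : ∀ j, R (a - 1) j = 1 := fun j => hR _ _ (Or.inl (by
    rw [abs_of_nonpos (by omega)]; omega))
  have hRr : ∀ j, R (a + N - 1) j = 1 := fun j => hR _ _ (Or.inl (by
    rw [abs_of_nonneg (by omega)]; omega))
  have hrow : ∀ j, j ≠ rj → rowp U a j N = rowp U a (j - 1) N := by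
    intro j hj
    have := rowp_tel U R a j N (fun k _ => h _ _ (by intro e; exact hj (Prod.ext_iff.mp e).2))
    rwa [hRl, hRr, mul_one, one_mul] at this
  have hfar : ∀ j, (m : ℤ) ≤ |j| → rowp U a j N = 1 := by
    intro j hj
    have : ∀ n, rowp U a j n = 1 := by
      intro n
      induction n with
      | zero => rfl
      | succ n ih => simp [rowp, ih, hU _ j (Or.inr (hB.trans hj))]
    exact this N
  have hlow : ∀ n : ℕ, ∀ j, j < rj → j = -(m : ℤ) - 1 + n → rowp U a j N = 1 := by
    intro n
    induction n with
    | zero => intro j hj e; apply hfar; rw [abs_of_nonpos (by omega)]; omega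
    | succ n ih =>
      intro j hj e
      rw [hrow j (by omega)]
      exact ih _ (by omega) (by push_cast at e; omega)
  have hhigh : ∀ n : ℕ, ∀ j, rj ≤ j → j = (m : ℤ) + 1 - n → rowp U a j N = 1 := by
    intro n
    induction n with
    | zero => intro j hj e; apply hfar; rw [abs_of_nonneg (by omega)]; omega
    | succ n ih =>
      intro j hj e
      have := hrow (j + 1) (by omega)
      rw [add_sub_cancel_right] at this
      rw [← this]
      exact ih _ (by omega) (by push_cast at e; omega)
  have e1 : rowp U a rj N = 1 := hhigh ((m : ℤ) + 1 - rj).toNat rj le_rfl (by omega)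
  have e2 : rowp U a (rj - 1) N = 1 := hlow (rj + m).toNat (rj - 1) (by omega) (by omega)
  obtain ⟨p, hp⟩ : ∃ p : ℕ, (p : ℤ) = ri - a := ⟨(ri - a).toNat, by omega⟩
  obtain ⟨q, hq⟩ : ∃ q : ℕ, N = p + (1 + q) := ⟨N - p - 1, by omega⟩
  have t1 := rowp_tel U R a rj p (fun k hk => h _ _ (by
    intro e; have := (Prod.ext_iff.mp e).1; simp only at this; omega))
  have t2 := rowp_tel U R (ri + 1) rj q (fun k hk => h _ _ (by
    intro e; have := (Prod.ext_iff.mp e).1; simp only at this; omega))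
  have s1 : ∀ j, rowp U a j N = rowp U a j p * (U ri j * rowp U (ri + 1) j q) := by
    intro j
    rw [hq, rowp_add, rowp_add]
    have : a + (p : ℤ) = ri := by omega
    rw [this]
    simp [rowp]
  rw [s1] at e1 e2
  have g1 : a + (p : ℤ) - 1 = ri - 1 := by omega
  have g2 : ri + 1 + (q : ℤ) - 1 = a + N - 1 := by omega
  have g3 : ri + 1 - 1 = ri := by omega
  rw [g1, hRl, one_mul] at t1
  rw [g2, g3, hRr, mul_one] at t2
  rw [t2] at e1
  rw [← t1] at e2
  have e3 := e1.trans e2.symm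
  have e4 : rowp U a rj p * (U ri rj * R ri rj) * rowp U (ri + 1) (rj - 1) q =
      rowp U a rj p * (R (ri - 1) rj * U ri (rj - 1)) * rowp U (ri + 1) (rj - 1) q := by
    simpa only [mul_assoc] using e3
  exact mul_left_cancel (mul_right_cancel e4)

end Flat

abbrev P := ℤ × ℤ

def stp (k : ZMod 4) : P :=
  if k = 0 then (0, 1) else if k = 1 then (1, 0) else if k = 2 then (0, -1) else (-1, 0)

lemma stp_add_two (k : ZMod 4) : stp (k + 2) = - stp k := by
  revert k; decide

lemma zm4 (k : ZMod 4) : k + 2 + 2 = k := by revert k; decide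

lemma add_stp_stp (z : P) (k : ZMod 4) : z + stp k + stp (k + 2) = z := by
  rw [stp_add_two]; abel

/-- clockwise holonomy around a lattice point starting from direction `k` -/
lemma flat_lemma {A : Type*} [Group A] (lab : P → ZMod 4 → A) (B : ℤ) (r : P)
    (anti : ∀ z k, lab (z + stp k) (k + 2) = (lab z k)⁻¹)
    (hB : ∀ z k, (B ≤ |z.1| ∨ B ≤ |z.2|) → lab z k = 1)
    (h : ∀ z, z ≠ r → lab z 0 * lab z 1 * lab z 2 * lab z 3 = 1) :
    lab r 0 * lab r 1 * lab r 2 * lab r 3 = 1 := by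
  have key : ∀ i j, (lab (i, j) 0 * lab (i, j) 1 * lab (i, j) 2 * lab (i, j) 3 = 1) ↔
      (lab (i, j) 0 * lab (i, j) 1 = lab (i - 1, j) 1 * lab (i, j - 1) 0) := by
    intro i j
    have a1 : lab (i, j) 2 = (lab (i, j - 1) 0)⁻¹ := by
      have := anti (i, j - 1) 0
      simpa [stp] using this
    have a2 : lab (i, j) 3 = (lab (i - 1, j) 1)⁻¹ := by
      have := anti (i - 1, j) 1
      rw [show (1 : ZMod 4) + 2 = 3 from by decide] at this
      rw [← this]
      congr 1
      rw [show stp 1 = (1, 0) from by decide]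
      simp
    rw [a1, a2, mul_inv_eq_one, mul_inv_eq_iff_eq_mul]
  obtain ⟨ri, rj⟩ := r
  rw [key]
  exact flat_core (fun i j => lab (i, j) 0) (fun i j => lab (i, j) 1) B ri rj
    (fun i j hh => hB _ _ hh) (fun i j hh => hB _ _ hh)
    (fun i j hij => (key i j).1 (h _ hij))

lemma flat_rot {A : Type*} [Group A] (l : ZMod 4 → A) (k : ZMod 4) :
    l k * l (k + 1) * l (k + 2) * l (k + 3) = 1 ↔ l 0 * l 1 * l 2 * l 3 = 1 := by
  have rot : ∀ a b c d : A, a * b * c * d = 1 → b * c * d * a = 1 := by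
    intro a b c d h
    have : b * c * d = a⁻¹ := by
      rw [eq_inv_iff_mul_eq_one]
      have : a * (b * c * d) = 1 := by simpa only [mul_assoc] using h
      exact mul_eq_one_comm.mp this
    rw [this]; simp
  have h4 : k = 0 ∨ k = 1 ∨ k = 2 ∨ k = 3 := by revert k; decide
  have q : (1 : ZMod 4) + 1 = 2 ∧ (1 : ZMod 4) + 2 = 3 ∧ (1 : ZMod 4) + 3 = 0 ∧
    (2 : ZMod 4) + 1 = 3 ∧ (2 : ZMod 4) + 2 = 0 ∧ (2 : ZMod 4) + 3 = 1 ∧ (3 : ZMod 4) + 1 = 0 ∧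
    (3 : ZMod 4) + 2 = 1 ∧ (3 : ZMod 4) + 3 = 2 := by decide
  obtain ⟨q1, q2, q3, q4, q5, q6, q7, q8, q9⟩ := q
  rcases h4 with rfl | rfl | rfl | rfl
  · simp
  · rw [q1, q2, q3]
    exact ⟨fun h => rot _ _ _ _ (rot _ _ _ _ (rot _ _ _ _ h)), rot _ _ _ _⟩
  · rw [q4, q5, q6]
    exact ⟨fun h => rot _ _ _ _ (rot _ _ _ _ h), fun h => rot _ _ _ _ (rot _ _ _ _ h)⟩
  · rw [q7, q8, q9]
    exact ⟨rot _ _ _ _, fun h => rot _ _ _ _ (rot _ _ _ _ (rot _ _ _ _ h))⟩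

end BK

namespace BK

/-! ### Lists of items -/

inductive Itm (V D : Type)
  | v (x : V)
  | d (x : D)

noncomputable instance (V D : Type) : DecidableEq (Itm V D) := Classical.decEq _


/-- a list all of whose near arcs are nested properly -/
inductive Good {V D : Type} (own : D → V) : Option V → List (Itm V D) → Prop
  | nil (v) : Good own v []
  | dart (d) : Good own (some (own d)) [Itm.d d]
  | app (v a b) : Good own v a → Good own v b → Good own v (a ++ b)
  | child (v w t) : Good own (some w) t → Good own v (Itm.v w :: t)

section GoodFacts
variable {V D : Type} (own : D → V)

lemma good_facts {v : Option V} {L : List (Itm V D)} (h : Good own v L) (hn : L.Nodup)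
    (hv : ∀ u, v = some u → Itm.v u ∉ L) :
    (∀ c, Itm.d c ∈ L → v = some (own c) ∨
      (Itm.v (own c) ∈ L ∧ L.idxOf (Itm.v (own c)) < L.idxOf (Itm.d c))) ∧
    (∀ b c e, Itm.v b ∈ L → Itm.d c ∈ L → Itm.d e ∈ L → own e = b →
      L.idxOf (Itm.v b) < L.idxOf (Itm.d c) → L.idxOf (Itm.d c) < L.idxOf (Itm.d e) →
      own c = b ∨ (Itm.v (own c) ∈ L ∧ L.idxOf (Itm.v b) < L.idxOf (Itm.v (own c)))) := by
  induction h with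
  | nil v => simp
  | dart d => simp
  | app v a b ha hb iha ihb =>
    have hd := List.nodup_append'.mp hn
    obtain ⟨na, nb, dis⟩ := hd
    obtain ⟨a1, a2⟩ := iha na (fun u hu hm => hv u hu (List.mem_append_left _ hm))
    obtain ⟨b1, b2⟩ := ihb nb (fun u hu hm => hv u hu (List.mem_append_right _ hm))
    have hdis : ∀ x, x ∈ a → x ∉ b := fun x h1 h2 => dis h1 h2
    have ia : ∀ x, x ∈ a → (a ++ b).idxOf x = a.idxOf x := fun x hx =>
      List.idxOf_append_of_mem hx
    have ib : ∀ x, x ∈ b → (a ++ b).idxOf x = a.length + b.idxOf x := fun x hx =>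
      List.idxOf_append_of_notMem (fun h => hdis x h hx)
    have la : ∀ x, x ∈ a → a.idxOf x < a.length := fun x hx => List.idxOf_lt_length_iff.mpr hx
    constructor
    · intro c hc
      rcases List.mem_append.mp hc with hc | hc
      · rcases a1 c hc with h | ⟨h, h'⟩
        · exact Or.inl h
        · right; refine ⟨List.mem_append_left _ h, ?_⟩; rw [ia _ h, ia _ hc]; exact h'
      · rcases b1 c hc with h | ⟨h, h'⟩
        · exact Or.inl h
        · right; refine ⟨List.mem_append_right _ h, ?_⟩; rw [ib _ h, ib _ hc]; omega
    · intro x c e hx hc he hoe h1 h2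
      rcases List.mem_append.mp hx with hx' | hx'
      · rcases List.mem_append.mp he with he' | he'
        · have hc' : Itm.d c ∈ a := by
            rcases List.mem_append.mp hc with hc' | hc'
            · exact hc'
            · rw [ib _ hc', ia _ he'] at h2; have := la _ he'; omega
          rw [ia _ hx', ia _ hc'] at h1
          rw [ia _ hc', ia _ he'] at h2
          rcases a2 x c e hx' hc' he' hoe h1 h2 with h | ⟨h, h'⟩
          · exact Or.inl h
          · right; refine ⟨List.mem_append_left _ h, ?_⟩; rw [ia _ h, ia _ hx']; exact h'
        · exfalso
          rcases b1 e he' with h | ⟨h, h'⟩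
          · exact hv _ h (by rw [hoe]; exact hx)
          · rw [hoe] at h; exact hdis _ hx' h
      · have hc' : Itm.d c ∈ b := by
          rcases List.mem_append.mp hc with hc' | hc'
          · rw [ia _ hc', ib _ hx'] at h1; have := la _ hc'; omega
          · exact hc'
        have he' : Itm.d e ∈ b := by
          rcases List.mem_append.mp he with he' | he'
          · rw [ia _ he', ib _ hc'] at h2; have := la _ he'; omega
          · exact he'
        rw [ib _ hx', ib _ hc'] at h1
        rw [ib _ hc', ib _ he'] at h2
        rcases b2 x c e hx' hc' he' hoe (by omega) (by omega) with h | ⟨h, h'⟩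
        · exact Or.inl h
        · right; refine ⟨List.mem_append_right _ h, ?_⟩; rw [ib _ h, ib _ hx']; omega
  | child v w t ht ih =>
    obtain ⟨hw, nt⟩ := List.nodup_cons.mp hn
    obtain ⟨t1, t2⟩ := ih nt (fun u hu hm => by cases hu; exact hw hm)
    have i0 : (Itm.v w :: t : List (Itm V D)).idxOf (Itm.v w) = 0 := by simp
    have it : ∀ x, x ∈ t → (Itm.v w :: t : List (Itm V D)).idxOf x = t.idxOf x + 1 := by
      intro x hx
      exact List.idxOf_cons_ne _ (fun h => hw (by rw [h]; exact hx))
    have md : ∀ c, Itm.d c ∈ (Itm.v w :: t : List (Itm V D)) → Itm.d c ∈ t := by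
      intro c hc; simpa using hc
    constructor
    · intro c hc
      replace hc := md c hc
      right
      rcases t1 c hc with h | ⟨h, h'⟩
      · cases h
        refine ⟨by simp, ?_⟩
        rw [i0, it _ hc]; omega
      · refine ⟨List.mem_cons_of_mem _ h, ?_⟩
        rw [it _ h, it _ hc]; omega
    · intro x c e hx hc he hoe h1 h2
      replace hc := md c hc
      replace he := md e he
      rw [it _ hc] at h1
      rw [it _ hc, it _ he] at h2
      rcases List.mem_cons.mp hx with hx | hx
      · cases hx
        rcases t1 c hc with h | ⟨h, h'⟩
        · left; exact (Option.some.inj h).symm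
        · right; refine ⟨List.mem_cons_of_mem _ h, ?_⟩
          rw [it _ h, i0]; omega
      · rw [it _ hx] at h1
        rcases t2 x c e hx hc he hoe (by omega) (by omega) with h | ⟨h, h'⟩
        · exact Or.inl h
        · right; refine ⟨List.mem_cons_of_mem _ h, ?_⟩; rw [it _ h, it _ hx]; omega

end GoodFacts

section Lists

lemma sublist_of_idx {I : Type} [DecidableEq I] (L S : List I) (hs : S.Pairwise (fun x y => L.idxOf x < L.idxOf y))
    (hm : ∀ x ∈ S, x ∈ L) : List.Sublist S L := by
  induction L generalizing S with
  | nil =>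
    cases S with
    | nil => simp
    | cons a S => exact absurd (hm a (by simp)) (by simp)
  | cons a L ih =>
    cases S with
    | nil => simp
    | cons s S =>
      obtain ⟨h1, h2⟩ := List.pairwise_cons.mp hs
      have hne : ∀ x ∈ S, x ≠ a := by
        rintro x hx rfl
        have := h1 x hx
        simp at this
      have shift : ∀ x, x ≠ a → (a :: L).idxOf x = L.idxOf x + 1 := fun x hx =>
        List.idxOf_cons_ne _ (Ne.symm hx)
      have hS : S.Pairwise (fun x y => L.idxOf x < L.idxOf y) := by
        refine h2.imp_of_mem ?_
        intro x y hx hy h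
        rw [shift _ (hne x hx), shift _ (hne y hy)] at h
        omega
      have hmS : ∀ x ∈ S, x ∈ L := fun x hx => by
        have := hm x (List.mem_cons_of_mem _ hx)
        rcases List.mem_cons.mp this with h | h
        · exact absurd h (hne x hx)
        · exact h
      by_cases hsa : s = a
      · subst hsa
        exact (ih S hS hmS).cons_cons s
      · refine List.Sublist.cons _ (ih (s :: S) ?_ ?_)
        · refine List.pairwise_cons.mpr ⟨?_, hS⟩
          intro x hx
          have := h1 x hx
          rw [shift _ hsa, shift _ (hne x hx)] at this
          omega
        · intro x hx
          rcases List.mem_cons.mp hx with rfl | hx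
          · have := hm x (List.mem_cons_self)
            rcases List.mem_cons.mp this with h | h
            · exact absurd h hsa
            · exact h
          · exact hmS x hx

lemma prod_of_sublist {I : Type} {A : Type*} [Group A] (lb : I → A) (L S : List I) (hs : List.Sublist S L)
    (hn : L.Nodup) (h1 : ∀ x ∈ L, x ∉ S → lb x = 1) :
    (L.map lb).prod = (S.map lb).prod := by
  induction hs with
  | slnil => rfl
  | @cons S L a hs ih =>
    obtain ⟨ha, hn⟩ := List.nodup_cons.mp hn
    have : a ∉ S := fun h => ha (hs.subset h)
    rw [List.map_cons, List.prod_cons, h1 a (by simp) this, one_mul]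
    exact ih hn (fun x hx hxS => h1 x (List.mem_cons_of_mem _ hx) hxS)
  | @cons_cons S L a hs ih =>
    obtain ⟨ha, hn⟩ := List.nodup_cons.mp hn
    rw [List.map_cons, List.prod_cons, List.map_cons, List.prod_cons, ih hn]
    intro x hx hxS
    refine h1 x (List.mem_cons_of_mem _ hx) ?_
    intro h
    rcases List.mem_cons.mp h with rfl | h
    · exact ha hx
    · exact hxS h

end Lists

/-! ### Lattice forests -/

abbrev fl {E : Type} (d : E × Bool) : E × Bool := (d.1, !d.2)

lemma fl_fl {E : Type} (d : E × Bool) : fl (fl d) = d := by simp [fl]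

structure LF (V E : Type) where
  blob : P → Option V
  ent : V → P
  par : P → Option (ZMod 4)
  rank : P → ℕ
  bd : ℕ
  pt : E × Bool → P
  dr : E × Bool → ZMod 4
  own : E × Bool → V
  cmp : V → V
  box : ℤ
  hbox : ∀ z, (box ≤ |z.1| ∨ box ≤ |z.2|) → blob z = none
  rank_le : ∀ z, rank z ≤ bd
  blob_ent : ∀ v, blob (ent v) = some v
  par_rank : ∀ z k, par z = some k → rank (z + stp k) < rank z
  par_blob : ∀ z k, par z = some k → ∃ v w, blob z = some v ∧ blob (z + stp k) = some w ∧
    cmp v = cmp w ∧ (v = w ↔ ent v ≠ z)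
  par_none : ∀ z v, blob z = some v → par z = none → ent v = z ∧ cmp v = v
  pt_inj : Function.Injective pt
  blob_pt : ∀ d, blob (pt d) = some (own d)
  pt_fl : ∀ d, pt (fl d) = pt d + stp (dr d)
  dr_fl : ∀ d, dr (fl d) = dr d + 2
  own_fl : ∀ d, own (fl d) ≠ own d
  cmp_fl : ∀ d, cmp (own (fl d)) = cmp (own d)

namespace LF
variable {V E : Type} (F : LF V E)

open Classical in
noncomputable def vx (z : P) : List (Itm V (E × Bool)) :=
  if h : ∃ v, F.ent v = z then [Itm.v h.choose] else []

open Classical in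
noncomputable def dt (z : P) (k : ZMod 4) : List (Itm V (E × Bool)) :=
  if h : ∃ d, F.pt d = z ∧ F.dr d = k then [Itm.d h.choose] else []

lemma ent_inj : Function.Injective F.ent := by
  intro v w h
  have h1 := F.blob_ent v
  rw [h, F.blob_ent w] at h1
  exact (Option.some.inj h1).symm

lemma vx_ent (v : V) : F.vx (F.ent v) = [Itm.v v] := by
  unfold vx
  have h : ∃ w, F.ent w = F.ent v := ⟨v, rfl⟩
  rw [dif_pos h, F.ent_inj h.choose_spec]

lemma vx_none (z : P) (h : ∀ v, F.ent v ≠ z) : F.vx z = [] := by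
  unfold vx
  rw [dif_neg]; rintro ⟨v, hv⟩; exact h v hv

lemma dt_pt (d : E × Bool) : F.dt (F.pt d) (F.dr d) = [Itm.d d] := by
  unfold dt
  have h : ∃ e, F.pt e = F.pt d ∧ F.dr e = F.dr d := ⟨d, rfl, rfl⟩
  rw [dif_pos h, F.pt_inj h.choose_spec.1]

lemma dt_none (z : P) (k : ZMod 4) (h : ∀ d, F.pt d = z → F.dr d ≠ k) : F.dt z k = [] := by
  unfold dt
  rw [dif_neg]; rintro ⟨d, h1, h2⟩; exact h d h1 h2

lemma child_rank (z : P) (k : ZMod 4) (h : F.par (z + stp k) = some (k + 2)) :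
    F.rank z < F.rank (z + stp k) := by
  have := F.par_rank _ _ h
  rwa [add_stp_stp] at this

def k0 (z : P) : ZMod 4 := (F.par z).getD 0

open Classical in
noncomputable def tree (z : P) : List (Itm V (E × Bool)) :=
  F.vx z ++ [F.k0 z, F.k0 z + 1, F.k0 z + 2, F.k0 z + 3].flatMap (fun k =>
    F.dt z k ++ if h : F.par (z + stp k) = some (k + 2) then tree (z + stp k) else [])
termination_by F.bd - F.rank z
decreasing_by
  have h1 := F.child_rank z k h
  have h2 := F.rank_le (z + stp k)
  omega

open Classical in
noncomputable def blk (z : P) (k : ZMod 4) : List (Itm V (E × Bool)) :=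
  F.dt z k ++ if F.par (z + stp k) = some (k + 2) then F.tree (z + stp k) else []

lemma tree_eq (z : P) : F.tree z =
    F.vx z ++ (F.blk z (F.k0 z) ++ (F.blk z (F.k0 z + 1) ++ (F.blk z (F.k0 z + 2) ++
      F.blk z (F.k0 z + 3)))) := by
  rw [tree]
  simp [blk]

/-- induction along the forest, from the leaves -/
lemma tree_ind (p : P → Prop)
    (h : ∀ z, (∀ k, F.par (z + stp k) = some (k + 2) → p (z + stp k)) → p z) (z : P) : p z := by
  have : ∀ n z, F.bd - F.rank z ≤ n → p z := by
    intro n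
    induction n with
    | zero =>
      intro z hz
      refine h z (fun k hk => ?_)
      have h1 := F.child_rank z k hk
      have h2 := F.rank_le (z + stp k)
      omega
    | succ n ih =>
      intro z hz
      refine h z (fun k hk => ih _ ?_)
      have h1 := F.child_rank z k hk
      have h2 := F.rank_le (z + stp k)
      omega
  exact this _ z le_rfl

end LF
end BK

namespace BK
namespace LF
variable {V E : Type} (F : LF V E)

def up (y z : P) : Prop := ∃ k, F.par y = some k ∧ z = y + stp k

def home : Itm V (E × Bool) → P
  | Itm.v v => F.ent v
  | Itm.d d => F.pt d

def ownI : Itm V (E × Bool) → V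
  | Itm.v v => v
  | Itm.d d => F.own d

abbrev anc (y z : P) : Prop := Relation.ReflTransGen F.up y z

lemma up_rank {y z : P} (h : F.up y z) : F.rank z < F.rank y := by
  obtain ⟨k, hk, rfl⟩ := h
  exact F.par_rank _ _ hk

lemma anc_rank {y z : P} (h : F.anc y z) : F.rank z ≤ F.rank y := by
  induction h with
  | refl => exact le_rfl
  | tail _ h ih => exact (F.up_rank h).le.trans ih

lemma up_unique : Relator.RightUnique F.up := by
  rintro a b c ⟨k, hk, rfl⟩ ⟨l, hl, rfl⟩
  rw [hk] at hl
  cases hl; rfl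

lemma anc_sib {h y y' z : P} (h1 : F.anc h y) (h2 : F.anc h y') (u1 : F.up y z) (u2 : F.up y' z) :
    y = y' := by
  have key : ∀ a b, F.anc a b → F.up a z → F.up b z → a = b := by
    intro a b hab ha hb
    rcases Relation.ReflTransGen.cases_head hab with h | ⟨c, hc, hcb⟩
    · exact h
    · have : c = z := F.up_unique hc ha
      subst this
      have h1 := F.anc_rank hcb
      have h2 := F.up_rank hb
      omega
  rcases Relation.ReflTransGen.total_of_right_unique F.up_unique h1 h2 with h | h
  · exact key _ _ h u1 u2
  · exact (key _ _ h u2 u1).symm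

lemma stp_inj : Function.Injective stp := by decide

lemma dir_cases (k l : ZMod 4) : l = k ∨ l = k + 1 ∨ l = k + 2 ∨ l = k + 3 := by
  revert k l; decide

lemma mem_vx (i : Itm V (E × Bool)) (z : P) : i ∈ F.vx z ↔ ∃ v, i = Itm.v v ∧ F.ent v = z := by
  by_cases h : ∃ v, F.ent v = z
  · obtain ⟨v, rfl⟩ := h
    rw [vx_ent, List.mem_singleton]
    constructor
    · rintro rfl; exact ⟨v, rfl, rfl⟩
    · rintro ⟨w, rfl, h⟩; rw [F.ent_inj h]
  · rw [vx_none _ _ (fun v hv => h ⟨v, hv⟩)]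
    simp only [List.not_mem_nil, false_iff]
    rintro ⟨v, _, hv⟩; exact h ⟨v, hv⟩

lemma mem_dt (i : Itm V (E × Bool)) (z : P) (k : ZMod 4) :
    i ∈ F.dt z k ↔ ∃ d, i = Itm.d d ∧ F.pt d = z ∧ F.dr d = k := by
  by_cases h : ∃ d, F.pt d = z ∧ F.dr d = k
  · obtain ⟨d, rfl, rfl⟩ := h
    rw [dt_pt, List.mem_singleton]
    constructor
    · rintro rfl; exact ⟨d, rfl, rfl, rfl⟩
    · rintro ⟨w, rfl, h, _⟩; rw [F.pt_inj h]
  · rw [dt_none _ _ _ (fun v hv hk => h ⟨v, hv, hk⟩)]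
    simp only [List.not_mem_nil, false_iff]
    rintro ⟨v, _, hv⟩; exact h ⟨v, hv⟩

lemma mem_blk (i : Itm V (E × Bool)) (z : P) (k : ZMod 4) :
    i ∈ F.blk z k ↔ i ∈ F.dt z k ∨ (F.par (z + stp k) = some (k + 2) ∧ i ∈ F.tree (z + stp k)) := by
  unfold blk
  rw [List.mem_append]
  split_ifs with h <;> simp [h]

lemma mem_tree' (i : Itm V (E × Bool)) (z : P) :
    i ∈ F.tree z ↔ i ∈ F.vx z ∨ ∃ k, i ∈ F.blk z k := by
  rw [tree_eq]
  simp only [List.mem_append]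
  constructor
  · rintro (h | h | h | h | h)
    · exact Or.inl h
    all_goals exact Or.inr ⟨_, h⟩
  · rintro (h | ⟨k, h⟩)
    · exact Or.inl h
    · rcases dir_cases (F.k0 z) k with rfl | rfl | rfl | rfl
      · exact Or.inr (Or.inl h)
      · exact Or.inr (Or.inr (Or.inl h))
      · exact Or.inr (Or.inr (Or.inr (Or.inl h)))
      · exact Or.inr (Or.inr (Or.inr (Or.inr h)))

lemma child_up (z : P) (k : ZMod 4) (h : F.par (z + stp k) = some (k + 2)) :
    F.up (z + stp k) z := ⟨k + 2, h, (add_stp_stp z k).symm⟩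

lemma up_child {y z : P} (h : F.up y z) : ∃ k, y = z + stp k ∧ F.par (z + stp k) = some (k + 2) := by
  obtain ⟨k, hk, rfl⟩ := h
  exact ⟨k + 2, (add_stp_stp y k).symm, by rw [add_stp_stp, zm4]; exact hk⟩

lemma mem_tree (i : Itm V (E × Bool)) (z : P) : i ∈ F.tree z ↔ F.anc (F.home i) z := by
  constructor
  · revert z
    refine F.tree_ind _ ?_
    intro z ih hi
    rcases (F.mem_tree' i z).mp hi with h | ⟨k, h⟩
    · obtain ⟨v, rfl, rfl⟩ := (F.mem_vx i z).mp h
      exact Relation.ReflTransGen.refl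
    · rcases (F.mem_blk i z k).mp h with h | ⟨h, h'⟩
      · obtain ⟨d, rfl, rfl, _⟩ := (F.mem_dt i z k).mp h
        exact Relation.ReflTransGen.refl
      · exact (ih k h h').tail (F.child_up z k h)
  · intro h
    induction h with
    | refl =>
      rw [mem_tree']
      cases i with
      | v v => left; rw [mem_vx]; exact ⟨v, rfl, rfl⟩
      | d d => right; refine ⟨F.dr d, ?_⟩; rw [mem_blk, mem_dt]; exact Or.inl ⟨d, rfl, rfl, rfl⟩
    | tail _ h ih =>
      obtain ⟨k, rfl, hk⟩ := F.up_child h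
      rw [mem_tree']
      right; refine ⟨k, ?_⟩
      rw [mem_blk]
      exact Or.inr ⟨hk, ih⟩

lemma not_mem_child {i : Itm V (E × Bool)} {z : P} {k : ZMod 4} (hi : F.home i = z)
    (h : F.par (z + stp k) = some (k + 2)) : i ∉ F.tree (z + stp k) := by
  rw [mem_tree, hi]
  intro h'
  have h1 := F.anc_rank h'
  have h2 := F.child_rank z k h
  omega

lemma blk_disj {z : P} {k k' : ZMod 4} {i : Itm V (E × Bool)} (h1 : i ∈ F.blk z k)
    (h2 : i ∈ F.blk z k') : k = k' := by
  rcases (F.mem_blk i z k).mp h1 with a | ⟨a, a'⟩ <;> rcases (F.mem_blk i z k').mp h2 with b | ⟨b, b'⟩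
  · obtain ⟨d, rfl, _, rfl⟩ := (F.mem_dt i z k).mp a
    obtain ⟨d', h, _, rfl⟩ := (F.mem_dt _ z k').mp b
    cases h; rfl
  · obtain ⟨d, rfl, h, rfl⟩ := (F.mem_dt i z k).mp a
    exact absurd b' (F.not_mem_child h b)
  · obtain ⟨d, rfl, h, rfl⟩ := (F.mem_dt i z k').mp b
    exact absurd a' (F.not_mem_child h a)
  · have := F.anc_sib ((F.mem_tree _ _).mp a') ((F.mem_tree _ _).mp b') (F.child_up z k a)
      (F.child_up z k' b)
    exact stp_inj (add_left_cancel this)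

lemma dir_ne (k : ZMod 4) : k ≠ k + 1 ∧ k ≠ k + 2 ∧ k ≠ k + 3 ∧ k + 1 ≠ k + 2 ∧ k + 1 ≠ k + 3 ∧
    k + 2 ≠ k + 3 := by revert k; decide

lemma nodup_tree (z : P) : (F.tree z).Nodup := by
  revert z
  refine F.tree_ind _ ?_
  intro z ih
  have nb : ∀ k, (F.blk z k).Nodup := by
    intro k
    unfold blk
    have hdt : (F.dt z k).Nodup := by unfold dt; split_ifs <;> simp
    split_ifs with h
    · refine List.nodup_append'.mpr ⟨hdt, ih k h, ?_⟩
      intro i h1 h2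
      obtain ⟨d, rfl, hd, rfl⟩ := (F.mem_dt i z k).mp h1
      exact F.not_mem_child (i := Itm.d d) hd h h2
    · simpa using hdt
  have dj : ∀ k k', k ≠ k' → (F.blk z k).Disjoint (F.blk z k') := by
    intro k k' hk i h1 h2
    exact hk (F.blk_disj h1 h2)
  obtain ⟨n1, n2, n3, n4, n5, n6⟩ := dir_ne (F.k0 z)
  have vb : ∀ k, (F.vx z).Disjoint (F.blk z k) := by
    intro k i h1 h2
    obtain ⟨v, rfl, hv⟩ := (F.mem_vx i z).mp h1
    rcases (F.mem_blk _ z k).mp h2 with a | ⟨a, a'⟩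
    · obtain ⟨d, h, _⟩ := (F.mem_dt _ z k).mp a
      cases h
    · exact F.not_mem_child (i := Itm.v v) hv a a'
  rw [tree_eq]
  have hvx : (F.vx z).Nodup := by unfold vx; split_ifs <;> simp
  simp only [List.nodup_append', List.disjoint_append_right]
  exact ⟨hvx, ⟨nb _, ⟨nb _, ⟨nb _, nb _, dj _ _ n6⟩, dj _ _ n4, dj _ _ n5⟩, dj _ _ n1, dj _ _ n2,
    dj _ _ n3⟩, vb _, vb _, vb _, vb _⟩

lemma good_tree (z : P) : ∀ v, F.blob z = some v →
    (F.ent v = z → ∃ L, F.tree z = Itm.v v :: L ∧ Good F.own (some v) L) ∧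
    (F.ent v ≠ z → Good F.own (some v) (F.tree z)) := by
  revert z
  refine F.tree_ind _ ?_
  intro z ih v hv
  have gb : ∀ k, Good F.own (some v) (F.blk z k) := by
    intro k
    unfold blk
    refine Good.app _ _ _ ?_ ?_
    · by_cases h : ∃ d, F.pt d = z ∧ F.dr d = k
      · obtain ⟨d, rfl, rfl⟩ := h
        rw [dt_pt]
        have := F.blob_pt d
        rw [hv] at this
        rw [this]
        exact Good.dart d
      · rw [dt_none _ _ _ (fun v hv hk => h ⟨v, hv, hk⟩)]
        exact Good.nil _
    · split_ifs with h
      · obtain ⟨v', w, hv', hw, _, hiff⟩ := F.par_blob _ _ h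
        rw [add_stp_stp, hv] at hw
        cases hw
        by_cases e : F.ent v' = z + stp k
        · obtain ⟨L, hL, gL⟩ := (ih k h v' hv').1 e
          rw [hL]
          exact Good.child _ _ _ gL
        · have : v' = v := hiff.mpr e
          subst this
          exact (ih k h v' hv').2 e
      · exact Good.nil _
  have g4 := Good.app _ _ _ (gb (F.k0 z)) (Good.app _ _ _ (gb (F.k0 z + 1))
    (Good.app _ _ _ (gb (F.k0 z + 2)) (gb (F.k0 z + 3))))
  constructor
  · intro e
    refine ⟨_, ?_, g4⟩
    rw [tree_eq]
    conv_lhs => rw [← e]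
    rw [vx_ent, e]; rfl
  · intro e
    rw [tree_eq, F.vx_none z]
    · exact g4
    · intro w hw
      have := F.blob_ent w
      rw [hw, hv] at this
      cases this
      exact e hw

/-! ### roots -/

lemma anc_blob {y z : P} (h : F.anc y z) : ∀ v w, F.blob y = some v → F.blob z = some w →
    F.cmp v = F.cmp w := by
  induction h with
  | refl => intro v w hv hw; rw [hv] at hw; cases hw; rfl
  | tail _ h ih =>
    intro v w hv hw
    obtain ⟨k, hk, rfl⟩ := h
    obtain ⟨a, b, ha, hb, hc, _⟩ := F.par_blob _ _ hk
    rw [hw] at hb; cases hb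
    rw [ih v a hv ha, hc]

lemma exists_root (z : P) (v : V) (hv : F.blob z = some v) :
    F.par (F.ent (F.cmp v)) = none ∧ F.anc z (F.ent (F.cmp v)) := by
  have : ∀ n z, F.rank z ≤ n → ∀ v, F.blob z = some v →
    F.par (F.ent (F.cmp v)) = none ∧ F.anc z (F.ent (F.cmp v)) := by
    intro n
    induction n with
    | zero =>
      intro z hz v hv
      cases hp : F.par z with
      | none =>
        obtain ⟨h1, h2⟩ := F.par_none z v hv hp
        rw [h2, h1]; exact ⟨hp, .refl⟩
      | some k => have := F.par_rank _ _ hp; omega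
    | succ n ih =>
      intro z hz v hv
      cases hp : F.par z with
      | none =>
        obtain ⟨h1, h2⟩ := F.par_none z v hv hp
        rw [h2, h1]; exact ⟨hp, .refl⟩
      | some k =>
        obtain ⟨a, b, ha, hb, hc, _⟩ := F.par_blob _ _ hp
        rw [hv] at ha; cases ha
        have h1 := F.par_rank _ _ hp
        obtain ⟨h2, h3⟩ := ih (z + stp k) (by omega) b hb
        rw [hc]
        exact ⟨h2, Relation.ReflTransGen.head ⟨k, hp, rfl⟩ h3⟩
  exact this _ z le_rfl v hv

lemma blob_home (i : Itm V (E × Bool)) : F.blob (F.home i) = some (F.ownI i) := by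
  cases i with
  | v v => exact F.blob_ent v
  | d d => exact F.blob_pt d

lemma mem_root (v : V) (hv : F.par (F.ent v) = none) (i : Itm V (E × Bool)) :
    i ∈ F.tree (F.ent v) ↔ F.cmp (F.ownI i) = v := by
  have hc := (F.par_none _ v (F.blob_ent v) hv).2
  rw [mem_tree]
  constructor
  · intro h
    rw [F.anc_blob h _ _ (F.blob_home i) (F.blob_ent v), hc]
  · intro h
    have := (F.exists_root _ _ (F.blob_home i)).2
    rwa [h] at this

/-! ### labels -/

def treeD (d : E × Bool) : Prop := F.par (F.pt d) = some (F.dr d) ∨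
  F.par (F.pt (fl d)) = some (F.dr (fl d))

lemma treeD_fl (d : E × Bool) : F.treeD (fl d) ↔ F.treeD d := by
  unfold treeD; rw [fl_fl]; exact or_comm

section lab
variable {A : Type} [Group A] (g : E → A)

open Classical in
noncomputable def lb : Itm V (E × Bool) → A
  | Itm.v _ => 1
  | Itm.d d => if F.treeD d then 1 else g d.1

noncomputable def W (L : List (Itm V (E × Bool))) : A := (L.map (F.lb g)).prod

lemma W_app (a b : List (Itm V (E × Bool))) : F.W g (a ++ b) = F.W g a * F.W g b := by
  simp [W]

lemma W_vx (z : P) : F.W g (F.vx z) = 1 := by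
  unfold vx W
  split_ifs <;> simp [lb]

lemma W_dt_tree (z : P) (k : ZMod 4) (h : F.par z = some k ∨ F.par (z + stp k) = some (k + 2)) :
    F.W g (F.dt z k) = 1 := by
  by_cases hd : ∃ d, F.pt d = z ∧ F.dr d = k
  · obtain ⟨d, rfl, rfl⟩ := hd
    have : F.treeD d := by
      unfold treeD
      rw [F.pt_fl, F.dr_fl]; exact h
    rw [dt_pt]
    simp [W, lb, this]
  · rw [dt_none _ _ _ (fun v hv hk => hd ⟨v, hv, hk⟩)]
    simp [W]

open Classical in
noncomputable def lab (z : P) (k : ZMod 4) : A :=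
  if F.par z = some k then (F.W g (F.tree z))⁻¹ else F.W g (F.blk z k)

lemma W_blk_child (z : P) (k : ZMod 4) (h : F.par (z + stp k) = some (k + 2)) :
    F.W g (F.blk z k) = F.W g (F.tree (z + stp k)) := by
  unfold blk
  rw [if_pos h, W_app, W_dt_tree _ _ _ _ (Or.inr h), one_mul]

lemma W_blk_not (z : P) (k : ZMod 4) (h : F.par (z + stp k) ≠ some (k + 2)) :
    F.W g (F.blk z k) = F.W g (F.dt z k) := by
  unfold blk
  rw [if_neg h, List.append_nil]

lemma not_both (z : P) (k : ZMod 4) (h : F.par z = some k) :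
    F.par (z + stp k) ≠ some (k + 2) := by
  intro h'
  have h1 := F.child_rank _ _ h'
  have h2 := F.par_rank _ _ h
  omega

lemma lab_anti (hg : ∀ e, g e * g e = 1) (z : P) (k : ZMod 4) :
    F.lab g (z + stp k) (k + 2) = (F.lab g z k)⁻¹ := by
  by_cases h1 : F.par z = some k
  · have h2 := F.not_both z k h1
    unfold lab
    rw [if_neg h2, if_pos h1, inv_inv, W_blk_child, add_stp_stp]
    rw [add_stp_stp, zm4]; exact h1
  · by_cases h2 : F.par (z + stp k) = some (k + 2)
    · unfold lab
      rw [if_pos h2, if_neg h1, W_blk_child _ _ _ _ h2]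
    · unfold lab
      rw [if_neg h2, if_neg h1, W_blk_not _ _ _ _ h2, W_blk_not]
      · by_cases hd : ∃ d, F.pt d = z ∧ F.dr d = k
        · obtain ⟨d, rfl, rfl⟩ := hd
          have nt : ¬ F.treeD d := by
            unfold treeD
            rw [F.pt_fl, F.dr_fl]; tauto
          have nt' : ¬ F.treeD (fl d) := by rwa [treeD_fl]
          rw [dt_pt, ← F.pt_fl, ← F.dr_fl, dt_pt]
          simp only [W, List.map_cons, List.map_nil, List.prod_cons, List.prod_nil, mul_one, lb,
            if_neg nt, if_neg nt']
          exact (eq_inv_of_mul_eq_one_left (hg _))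
        · rw [F.dt_none z k (fun v hv hk => hd ⟨v, hv, hk⟩), F.dt_none]
          · simp [W]
          · intro d hd1 hd2
            apply hd
            refine ⟨fl d, ?_, ?_⟩
            · rw [F.pt_fl, hd1, hd2, add_stp_stp]
            · rw [F.dr_fl, hd2, zm4]
      · rw [add_stp_stp, zm4]; exact h1

lemma W_tree (z : P) : F.W g (F.tree z) = F.W g (F.blk z (F.k0 z)) * F.W g (F.blk z (F.k0 z + 1)) *
    F.W g (F.blk z (F.k0 z + 2)) * F.W g (F.blk z (F.k0 z + 3)) := by
  rw [tree_eq]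
  simp only [W_app, W_vx, one_mul, mul_assoc]

lemma lab_flat (z : P) (h : F.par z = none → F.W g (F.tree z) = 1) :
    F.lab g z 0 * F.lab g z 1 * F.lab g z 2 * F.lab g z 3 = 1 := by
  rw [← flat_rot _ (F.k0 z)]
  cases hp : F.par z with
  | none =>
    rw [← h hp, W_tree]
    simp [lab, hp]
  | some k =>
    have hk : F.k0 z = k := by simp [k0, hp]
    have hW := F.W_tree g z
    rw [hk] at hW ⊢
    rw [F.W_blk_not g z k (F.not_both z k hp), F.W_dt_tree g z k (Or.inl hp), one_mul] at hW
    obtain ⟨n1, n2, n3, -⟩ := dir_ne k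
    have e1 : F.lab g z k = (F.W g (F.tree z))⁻¹ := by unfold lab; rw [if_pos hp]
    have e2 : ∀ l, k ≠ l → F.lab g z l = F.W g (F.blk z l) := by
      intro l hl; unfold lab; rw [if_neg]; rw [hp]; intro h; exact hl (Option.some.inj h)
    rw [e1, e2 _ n1, e2 _ n2, e2 _ n3, hW]
    group

lemma lab_root (z : P) (h : F.par z = none) :
    F.lab g z 0 * F.lab g z 1 * F.lab g z 2 * F.lab g z 3 = F.W g (F.tree z) := by
  have hk : F.k0 z = 0 := by simp [k0, h]
  rw [W_tree, hk]
  simp [lab, h]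

lemma lab_out (z : P) (k : ZMod 4) (h : F.blob z = none) : F.lab g z k = 1 := by
  have hp : F.par z = none := by
    cases hp : F.par z with
    | none => rfl
    | some k => obtain ⟨v, w, hv, _⟩ := F.par_blob _ _ hp; rw [h] at hv; cases hv
  unfold lab
  rw [if_neg (by rw [hp]; simp), W_blk_not, dt_none]
  · simp [W]
  · intro d hd; have := F.blob_pt d; rw [hd, h] at this; cases this
  · intro h'
    obtain ⟨v, w, _, hw, _⟩ := F.par_blob _ _ h'
    rw [add_stp_stp, h] at hw; cases hw

lemma root_one (hg : ∀ e, g e * g e = 1) (r : P)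
    (h : ∀ v, F.par (F.ent v) = none → F.ent v ≠ r → F.W g (F.tree (F.ent v)) = 1)
    (hr : F.par r = none) :
    F.W g (F.tree r) = 1 := by
  rw [← F.lab_root g r hr]
  refine flat_lemma (F.lab g) F.box r (F.lab_anti g hg) (fun z k hz => F.lab_out g z k (F.hbox z hz)) ?_
  intro z hz
  refine F.lab_flat g z ?_
  intro hp
  cases hb : F.blob z with
  | none =>
    rw [← F.lab_root g z hp]
    simp [F.lab_out g z _ hb]
  | some v =>
    have := (F.par_none z v hb hp).1
    rw [← this] at hp hz ⊢
    exact h v hp hz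

end lab
end LF
end BK

namespace BK

/-- the conclusion of the lattice argument: positions on a line such that
near arcs (owner to dart) and far arcs (dart to opposite dart) do not interlace -/
structure IsBook {V E : Type} (own : E × Bool → V) (f : Itm V (E × Bool) → ℕ) : Prop where
  inj : Function.Injective f
  lt : ∀ d, f (Itm.v (own d)) < f (Itm.d d)
  near : ∀ c e, f (Itm.v (own e)) < f (Itm.d c) → f (Itm.d c) < f (Itm.d e) →
    own c = own e ∨ f (Itm.v (own e)) < f (Itm.v (own c))
  far : ∀ c e, c.1 ≠ e.1 → ¬ (f (Itm.d c) < f (Itm.d e) ∧ f (Itm.d e) < f (Itm.d (fl c)) ∧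
    f (Itm.d (fl c)) < f (Itm.d (fl e)))

namespace LF
variable {V E : Type} (F : LF V E)

section two
variable {A : Type} [Group A]

lemma lb_fl (g : E → A) (d : E × Bool) : F.lb g (Itm.d (fl d)) = F.lb g (Itm.d d) := by
  classical
  simp only [lb]
  by_cases h : F.treeD d
  · rw [if_pos h, if_pos ((F.treeD_fl d).mpr h)]
  · rw [if_neg h, if_neg (fun h' => h ((F.treeD_fl d).mp h'))]

open Classical in
noncomputable def gl (e f : E) (s t : A) : E → A := fun x => if x = e then s else if x = f then t else 1

lemma lb_one (g : E → A) (d : E × Bool) (h : g d.1 = 1) : F.lb g (Itm.d d) = 1 := by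
  classical
  simp [lb, h]

lemma lb_sq (g : E → A) (hg : ∀ e, g e * g e = 1) (d : E × Bool) :
    F.lb g (Itm.d d) * F.lb g (Itm.d d) = 1 := by
  classical
  simp only [lb]
  split_ifs <;> simp [hg]

/-- a nodup list whose only relevant items are the two darts of one edge has product one -/
lemma W_pair (g : E → A) (hg : ∀ e, g e * g e = 1) (f : E) (L : List (Itm V (E × Bool)))
    (hn : L.Nodup) (hf : ∀ d, d.1 = f → Itm.d d ∈ L → Itm.d (fl d) ∈ L)
    (h1 : ∀ d, Itm.d d ∈ L → d.1 ≠ f → g d.1 = 1) : F.W g L = 1 := by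
  have h1' : ∀ i ∈ L, (∀ d, i = Itm.d d → d.1 ≠ f) → F.lb g i = 1 := by
    intro i hi hd
    cases i with
    | v v => simp [lb]
    | d d => exact F.lb_one g d (h1 d hi (hd d rfl))
  have key : ∀ d : E × Bool, d.1 = f → Itm.d d ∈ L → L.idxOf (Itm.d d) < L.idxOf (Itm.d (fl d)) →
      F.W g L = 1 := by
    intro d hd hm hlt
    have hS := sublist_of_idx L [Itm.d d, Itm.d (fl d)] (by simpa using hlt) (by
      intro x hx
      simp only [List.mem_cons, List.not_mem_nil, or_false] at hx
      rcases hx with rfl | rfl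
      · exact hm
      · exact hf d hd hm)
    unfold W
    rw [prod_of_sublist (F.lb g) L _ hS hn]
    · simp [F.lb_fl, F.lb_sq g hg]
    · intro i hi hiS
      apply h1' i hi
      rintro c rfl hc
      apply hiS
      obtain ⟨d1, d2⟩ := d
      obtain ⟨c1, c2⟩ := c
      simp only at hd hc
      subst hd hc
      cases c2 <;> cases d2 <;> simp [fl]
  by_cases hm : Itm.d (f, false) ∈ L
  · have hm' := hf _ rfl hm
    rcases lt_trichotomy (L.idxOf (Itm.d (f, false))) (L.idxOf (Itm.d (fl (f, false)))) with h | h | h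
    · exact key _ rfl hm h
    · have := (List.idxOf_inj hm).mp h
      simp [fl] at this
    · exact key (f, true) rfl hm' h
  · have hm' : Itm.d (f, true) ∉ L := fun h => hm (hf _ rfl h)
    unfold W
    apply List.prod_eq_one
    intro x hx
    obtain ⟨i, hi, rfl⟩ := List.mem_map.mp hx
    apply h1' i hi
    rintro ⟨c1, c2⟩ rfl hc
    simp only at hc
    subst hc
    cases c2
    · exact hm hi
    · exact hm' hi

lemma root_all (e f : E) (s t : A) (hs : s * s = 1) (ht : t * t = 1) (v : V)
    (hv : F.par (F.ent v) = none) : F.W (gl e f s t) (F.tree (F.ent v)) = 1 := by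
  have hg : ∀ x, gl e f s t x * gl e f s t x = 1 := by
    intro x; unfold gl; split_ifs <;> simp [hs, ht]
  have fm : ∀ u, F.par (F.ent u) = none → ∀ d, Itm.d d ∈ F.tree (F.ent u) →
      Itm.d (fl d) ∈ F.tree (F.ent u) := by
    intro u hu d h
    rw [F.mem_root u hu] at h ⊢
    rw [← h]
    exact F.cmp_fl d
  -- trees not containing e
  have other : ∀ u, F.par (F.ent u) = none → F.cmp (F.own (e, false)) ≠ u →
      F.W (gl e f s t) (F.tree (F.ent u)) = 1 := by
    intro u hu hne
    have hno : ∀ b, Itm.d (e, b) ∉ F.tree (F.ent u) := by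
      intro b hb
      have h1 : Itm.d (e, false) ∈ F.tree (F.ent u) := by
        cases b
        · exact hb
        · exact fm u hu _ hb
      exact hne ((F.mem_root u hu _).mp h1)
    refine F.W_pair _ hg f _ (F.nodup_tree _) (fun d _ h => fm u hu d h) ?_
    rintro ⟨d1, d2⟩ hd hne'
    have : d1 ≠ e := by rintro rfl; exact hno _ hd
    simp only at hne'
    simp [gl, this, hne']
  by_cases hv' : F.cmp (F.own (e, false)) = v
  · refine F.root_one _ hg _ ?_ hv
    intro u hu hne
    refine other u hu ?_
    rintro rfl
    exact hne (by rw [hv'])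
  · exact other v hv hv'

end two

lemma tree_sub {y z : P} (h : F.anc y z) : F.tree y <:+: F.tree z := by
  induction h with
  | refl => exact List.infix_rfl
  | @tail b c _ h ih =>
    obtain ⟨k, rfl, hk⟩ := F.up_child h
    refine ih.trans ?_
    have h1 : F.tree (c + stp k) <:+: F.blk c k := by
      unfold blk
      rw [if_pos hk]
      exact (List.suffix_append _ _).isInfix
    refine h1.trans ?_
    rw [F.tree_eq c]
    have pre : ∀ a b : List (Itm V (E × Bool)), a <:+: a ++ b := fun a b =>
      (List.prefix_append _ _).isInfix
    have suf : ∀ a b : List (Itm V (E × Bool)), b <:+: a ++ b := fun a b =>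
      (List.suffix_append _ _).isInfix
    rcases dir_cases (F.k0 c) k with e | e | e | e <;> rw [e]
    · exact (pre _ _).trans (suf _ _)
    · exact ((pre _ _).trans (suf _ _)).trans (suf _ _)
    · exact (((pre _ _).trans (suf _ _)).trans (suf _ _)).trans (suf _ _)
    · exact (((suf _ _).trans (suf _ _)).trans (suf _ _)).trans (suf _ _)

lemma triple_sub (d : E × Bool) (h : F.par (F.pt d) = some (F.dr d)) :
    [Itm.d (fl d), Itm.v (F.own d), Itm.d d] <:+: F.tree (F.pt (fl d)) := by
  have pp : F.pt d = F.pt (fl d) + stp (F.dr (fl d)) := by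
    have := F.pt_fl (fl d); rwa [fl_fl] at this
  have kk : F.dr d = F.dr (fl d) + 2 := by
    have := F.dr_fl (fl d); rwa [fl_fl] at this
  have hch : F.par (F.pt (fl d) + stp (F.dr (fl d))) = some (F.dr (fl d) + 2) := by
    rw [← pp, ← kk]; exact h
  have hent : F.ent (F.own d) = F.pt d := by
    obtain ⟨v, w, hv, hw, _, hiff⟩ := F.par_blob _ _ h
    rw [F.blob_pt] at hv; cases hv
    rw [← F.pt_fl, F.blob_pt] at hw; cases hw
    by_contra hne
    exact F.own_fl d (hiff.mpr hne).symm
  have h1 : [Itm.d (fl d), Itm.v (F.own d), Itm.d d] <:+: F.blk (F.pt (fl d)) (F.dr (fl d)) := by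
    unfold blk
    rw [if_pos hch, dt_pt, ← pp, tree_eq]
    have hk : F.k0 (F.pt d) = F.dr d := by simp [k0, h]
    have hvx : F.vx (F.pt d) = [Itm.v (F.own d)] := by rw [← hent, vx_ent]
    rw [hk, hvx]
    conv_rhs => rw [blk]
    rw [dt_pt]
    simp only [List.append_assoc, List.cons_append, List.nil_append]
    exact ⟨[], _, rfl⟩
  refine h1.trans ?_
  rw [F.tree_eq (F.pt (fl d))]
  have pre : ∀ a b : List (Itm V (E × Bool)), a <:+: a ++ b := fun a b =>
    (List.prefix_append _ _).isInfix
  have suf : ∀ a b : List (Itm V (E × Bool)), b <:+: a ++ b := fun a b =>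
    (List.suffix_append _ _).isInfix
  rcases dir_cases (F.k0 (F.pt (fl d))) (F.dr (fl d)) with e | e | e | e <;> rw [e]
  · exact (pre _ _).trans (suf _ _)
  · exact ((pre _ _).trans (suf _ _)).trans (suf _ _)
  · exact (((pre _ _).trans (suf _ _)).trans (suf _ _)).trans (suf _ _)
  · exact (((suf _ _).trans (suf _ _)).trans (suf _ _)).trans (suf _ _)

lemma idx_sub {I : Type} [DecidableEq I] (L : List I) (a b c : I) (h : [a, b, c] <:+: L)
    (hn : L.Nodup) : L.idxOf b = L.idxOf a + 1 ∧ L.idxOf c = L.idxOf a + 2 := by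
  obtain ⟨s, t, rfl⟩ := h
  simp only [List.append_assoc, List.cons_append, List.nil_append] at hn ⊢
  obtain ⟨h1, h2, h3⟩ := List.nodup_append'.mp hn
  have ha : a ∉ s := fun h => h3 h (by simp)
  have hb : b ∉ s := fun h => h3 h (by simp)
  have hc : c ∉ s := fun h => h3 h (by simp)
  simp only [List.nodup_cons, List.mem_cons, not_or] at h2
  rw [List.idxOf_append_of_notMem ha, List.idxOf_append_of_notMem hb,
    List.idxOf_append_of_notMem hc, List.idxOf_cons_self, List.idxOf_cons_ne _ h2.1.1,
    List.idxOf_cons_self, List.idxOf_cons_ne _ h2.1.2.1, List.idxOf_cons_ne _ h2.2.1.1,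
    List.idxOf_cons_self]
  omega

theorem book [Finite V] (x : V) (hx : F.par (F.ent x) = none) :
    ∃ f : Itm V (E × Bool) → ℕ, IsBook F.own f ∧ f (Itm.v x) = 0 ∧
      ∀ d, F.par (F.pt d) = some (F.dr d) →
        f (Itm.v (F.own d)) = f (Itm.d (fl d)) + 1 ∧ f (Itm.d d) = f (Itm.d (fl d)) + 2 := by
  classical
  have := Fintype.ofFinite V
  set Rs : List V := x :: (Finset.univ.filter (fun v => F.par (F.ent v) = none ∧ v ≠ x)).toList
    with hRs
  have hRm : ∀ v, v ∈ Rs ↔ F.par (F.ent v) = none := by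
    intro v
    simp only [hRs, List.mem_cons, Finset.mem_toList, Finset.mem_filter, Finset.mem_univ, true_and]
    constructor
    · rintro (rfl | h)
      · exact hx
      · exact h.1
    · intro h
      by_cases e : v = x
      · exact Or.inl e
      · exact Or.inr ⟨h, e⟩
  have hRn : Rs.Nodup := by
    simp [hRs, Finset.nodup_toList]
  set L : List (Itm V (E × Bool)) := Rs.flatMap (fun v => F.tree (F.ent v)) with hL
  have hLn : L.Nodup := by
    rw [hL, List.nodup_flatMap]
    refine ⟨fun v _ => F.nodup_tree _, ?_⟩
    refine List.Pairwise.imp_of_mem ?_ hRn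
    intro a b ha hb hab i h1 h2
    rw [F.mem_root _ ((hRm _).mp ha)] at h1
    rw [F.mem_root _ ((hRm _).mp hb)] at h2
    exact hab (h1.symm.trans h2)
  have hLc : ∀ i, i ∈ L := by
    intro i
    have hr := (F.exists_root _ _ (F.blob_home i)).1
    rw [hL, List.mem_flatMap]
    exact ⟨_, (hRm _).mpr hr, (F.mem_root _ hr i).mpr rfl⟩
  have hLg : Good F.own none L := by
    have : ∀ R : List V, (∀ v ∈ R, v ∈ Rs) → Good F.own none (R.flatMap (fun v => F.tree (F.ent v))) := by
      intro R
      induction R with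
      | nil => intro _; exact Good.nil _
      | cons a R ih =>
        intro h
        rw [List.flatMap_cons]
        refine Good.app _ _ _ ?_ (ih (fun v hv => h v (List.mem_cons_of_mem _ hv)))
        obtain ⟨T, hT, gT⟩ := (F.good_tree (F.ent a) a (F.blob_ent a)).1 rfl
        rw [hT]
        exact Good.child _ _ _ gT
    exact this Rs (fun v hv => hv)
  obtain ⟨gf1, gf2⟩ := good_facts F.own hLg hLn (by simp)
  set f : Itm V (E × Bool) → ℕ := fun i => L.idxOf i with hf
  have finj : Function.Injective f := fun i j h => (List.idxOf_inj (hLc i)).mp h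
  have trip : ∀ d, F.par (F.pt d) = some (F.dr d) →
        f (Itm.v (F.own d)) = f (Itm.d (fl d)) + 1 ∧ f (Itm.d d) = f (Itm.d (fl d)) + 2 := by
    intro d hd
    apply idx_sub L _ _ _ _ hLn
    refine (F.triple_sub d hd).trans ?_
    obtain ⟨hr, ha⟩ := F.exists_root _ _ (F.blob_pt (fl d))
    refine (F.tree_sub ha).trans ?_
    have hmem := (hRm _).mpr hr
    obtain ⟨s, t, hst⟩ := List.append_of_mem hmem
    rw [hL, hst, List.flatMap_append, List.flatMap_cons]
    exact ((List.prefix_append _ _).isInfix).trans (List.suffix_append _ _).isInfix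
  refine ⟨f, ⟨finj, ?_, ?_, ?_⟩, ?_, trip⟩
  · intro d
    rcases gf1 d (hLc _) with h | h
    · cases h
    · exact h.2
  · intro c e h1 h2
    rcases gf2 (F.own e) c e (hLc _) (hLc _) (hLc _) rfl h1 h2 with h | h
    · exact Or.inl h
    · exact Or.inr h.2
  · rintro c e hce ⟨h1, h2, h3⟩
    have vne : ∀ v d, f (Itm.v v) ≠ f (Itm.d d) := fun v d h => by cases finj h
    by_cases tc : F.treeD c
    · rcases tc with h | h
      · have := trip c h; omega
      · have := trip _ h; rw [fl_fl] at this
        have := vne (F.own (fl c)) e; omega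
    by_cases te : F.treeD e
    · rcases te with h | h
      · have := trip e h; omega
      · have := trip _ h; rw [fl_fl] at this
        have := vne (F.own (fl e)) (fl c); omega
    let s : Equiv.Perm (Fin 3) := Equiv.swap 0 1
    let t : Equiv.Perm (Fin 3) := Equiv.swap 1 2
    have hs : s * s = 1 := by decide
    have ht : t * t = 1 := by decide
    have hW : F.W (gl c.1 e.1 s t) L = 1 := by
      have : ∀ R : List V, (∀ v ∈ R, v ∈ Rs) →
          F.W (gl c.1 e.1 s t) (R.flatMap (fun v => F.tree (F.ent v))) = 1 := by
        intro R
        induction R with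
        | nil => intro _; simp [W]
        | cons a R ih =>
          intro h
          rw [List.flatMap_cons, W_app, ih (fun v hv => h v (List.mem_cons_of_mem _ hv)), mul_one]
          exact F.root_all _ _ s t hs ht a ((hRm a).mp (h a (by simp)))
      exact this Rs (fun v hv => hv)
    have hS := sublist_of_idx L [Itm.d c, Itm.d e, Itm.d (fl c), Itm.d (fl e)] (by
      simp only [hf] at h1 h2 h3
      simp only [List.pairwise_cons, List.mem_cons, List.not_mem_nil, or_false,
        forall_eq_or_imp, forall_eq, IsEmpty.forall_iff, implies_true, List.Pairwise.nil, and_true]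
      refine ⟨⟨?_, ?_, ?_⟩, ⟨?_, ?_⟩, ?_⟩ <;> omega) (fun x _ => hLc x)
    unfold W at hW
    rw [prod_of_sublist _ L _ hS hLn] at hW
    · have htc : ¬ F.treeD (fl c) := by rwa [treeD_fl]
      have hte : ¬ F.treeD (fl e) := by rwa [treeD_fl]
      simp only [List.map_cons, List.map_nil, List.prod_cons, List.prod_nil, mul_one, lb,
        if_neg tc, if_neg te, if_neg htc, if_neg hte, gl, if_true, if_neg (Ne.symm hce)] at hW
      revert hW
      decide
    · intro i _ hiS
      cases i with
      | v v => simp [lb]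
      | d d =>
        refine F.lb_one _ d ?_
        obtain ⟨c1, c2⟩ := c
        obtain ⟨e1, e2⟩ := e
        obtain ⟨d1, d2⟩ := d
        have n1 : d1 ≠ c1 := by
          rintro rfl; apply hiS
          cases d2 <;> cases c2 <;> simp [fl]
        have n2 : d1 ≠ e1 := by
          rintro rfl; apply hiS
          cases d2 <;> cases e2 <;> simp [fl]
        simp [gl, n1, n2]
  · obtain ⟨T, hT, gT⟩ := (F.good_tree (F.ent x) x (F.blob_ent x)).1 rfl
    simp only [hf, hL, hRs, List.flatMap_cons, hT]
    simp

end LF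
end BK

namespace BK

/-! ### breadth first search -/

def lev {X : Type} (R : X → X → Prop) (r : X) : ℕ → X → Prop
  | 0 => fun x => x = r
  | n + 1 => fun x => ∃ y, lev R r n y ∧ R y x

lemma bfs {X : Type} (R : X → X → Prop) (r : X) : ∃ dist : X → ℕ, dist r = 0 ∧
    (∀ x, Relation.ReflTransGen R r x → x ≠ r →
      ∃ y, R y x ∧ Relation.ReflTransGen R r y ∧ dist y < dist x) ∧
    (∀ x, R r x → dist x ≤ 1) ∧ (∀ x, Relation.ReflTransGen R r x → dist x = 0 → x = r) := by
  classical
  have lr : ∀ n x, lev R r n x → Relation.ReflTransGen R r x := by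
    intro n
    induction n with
    | zero => intro x h; rw [show x = r from h]
    | succ n ih => rintro x ⟨y, hy, h⟩; exact (ih y hy).tail h
  have rl : ∀ x, Relation.ReflTransGen R r x → ∃ n, lev R r n x := by
    intro x h
    induction h with
    | refl => exact ⟨0, rfl⟩
    | tail _ h ih => obtain ⟨n, hn⟩ := ih; exact ⟨n + 1, _, hn, h⟩
  refine ⟨fun x => sInf {n | lev R r n x}, ?_, ?_, ?_, ?_⟩
  · exact Nat.sInf_eq_zero.mpr (Or.inl rfl)
  · intro x hx hne
    have hm : lev R r (sInf {n | lev R r n x}) x := Nat.sInf_mem (rl x hx)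
    cases hn : sInf {n | lev R r n x} with
    | zero => rw [hn] at hm; exact absurd hm hne
    | succ n =>
      rw [hn] at hm
      obtain ⟨y, hy, h⟩ := hm
      refine ⟨y, h, lr _ _ hy, ?_⟩
      have : sInf {n | lev R r n y} ≤ n := Nat.sInf_le hy
      show sInf {n | lev R r n y} < sInf {n | lev R r n x}
      omega
  · intro x h
    exact Nat.sInf_le ⟨r, rfl, h⟩
  · intro x hx h
    have hm : lev R r (sInf {n | lev R r n x}) x := Nat.sInf_mem (rl x hx)
    rw [show sInf {n | lev R r n x} = 0 from h] at hm
    exact hm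

/-! ### lattice models -/

def ladj (B : Set P) (z w : P) : Prop := z ∈ B ∧ w ∈ B ∧ ∃ k, w = z + stp k

lemma ladj_symm {B : Set P} {z w : P} (h : ladj B z w) : ladj B w z := by
  obtain ⟨h1, h2, k, rfl⟩ := h
  exact ⟨h2, h1, k + 2, (add_stp_stp z k).symm⟩

abbrev lconn (B : Set P) (z w : P) : Prop := Relation.ReflTransGen (ladj B) z w

lemma lconn_symm {B : Set P} {z w : P} (h : lconn B z w) : lconn B w z := by
  induction h with
  | refl => exact .refl
  | tail _ h ih => exact Relation.ReflTransGen.head (ladj_symm h) ih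

lemma lconn_mono {B C : Set P} (hBC : B ⊆ C) {z w : P} (h : lconn B z w) : lconn C z w := by
  induction h with
  | refl => exact .refl
  | tail _ h ih => exact ih.tail ⟨hBC h.1, hBC h.2.1, h.2.2⟩

theorem lat_book {V E : Type} [Finite V] (own : E × Bool → V)
    (own_fl : ∀ d, own (fl d) ≠ own d) (blob : P → Option V) (hfin : {z | blob z ≠ none}.Finite)
    (hne : ∀ v, ∃ z, blob z = some v)
    (hconn : ∀ v z w, blob z = some v → blob w = some v → lconn {z | blob z = some v} z w)
    (pt : E × Bool → P) (dr : E × Bool → ZMod 4) (pt_inj : Function.Injective pt)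
    (blob_pt : ∀ d, blob (pt d) = some (own d)) (pt_fl : ∀ d, pt (fl d) = pt d + stp (dr d))
    (dr_fl : ∀ d, dr (fl d) = dr d + 2)
    (pd : V → Option (E × Bool)) (rk : V → ℕ) (cmp : V → V)
    (hpd : ∀ v d, pd v = some d → own d = v ∧ rk (own (fl d)) < rk v)
    (hcmp : ∀ d, cmp (own (fl d)) = cmp (own d)) (hcmp0 : ∀ v, pd v = none → cmp v = v)
    (x : V) (hx : pd x = none) :
    ∃ f : Itm V (E × Bool) → ℕ, IsBook own f ∧ f (Itm.v x) = 0 ∧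
      ∀ v d, pd v = some d → f (Itm.v v) = f (Itm.d (fl d)) + 1 ∧
        f (Itm.d d) = f (Itm.d (fl d)) + 2 := by
  classical
  have hent : ∀ v, ∃ z, blob z = some v ∧ ∀ d, pd v = some d → z = pt d := by
    intro v
    cases h : pd v with
    | none => obtain ⟨z, hz⟩ := hne v; exact ⟨z, hz, by simp⟩
    | some d =>
      refine ⟨pt d, ?_, ?_⟩
      · rw [blob_pt, (hpd v d h).1]
      · intro d' hd'; cases hd'; rfl
  choose ent ent1 ent2 using hent
  choose dist dist0 dist1 _ _ using fun v => bfs (ladj {z | blob z = some v}) (ent v)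
  have hpar : ∀ z, ∃ o : Option (ZMod 4), ∀ v, blob z = some v →
      (z = ent v → o = (pd v).map dr) ∧ (z ≠ ent v → ∃ k, o = some k ∧
        blob (z + stp k) = some v ∧ dist v (z + stp k) < dist v z) := by
    intro z
    cases hb : blob z with
    | none => exact ⟨none, by simp⟩
    | some v =>
      by_cases hz : z = ent v
      · refine ⟨(pd v).map dr, ?_⟩
        intro w hw; cases hw
        exact ⟨fun _ => rfl, fun h => absurd hz h⟩
      · obtain ⟨y, hy, _, hlt⟩ := dist1 v z (hconn v _ _ (ent1 v) hb) hz
        obtain ⟨h1, h2, k, rfl⟩ := ladj_symm hy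
        refine ⟨some k, ?_⟩
        intro w hw; cases hw
        exact ⟨fun h => absurd h hz, fun _ => ⟨k, rfl, h2, hlt⟩⟩
  choose par0 hpar0 using hpar
  set par : P → Option (ZMod 4) := fun z => if blob z = none then none else par0 z with hpardef
  have hpar1 : ∀ z v, blob z = some v → par z = par0 z := by
    intro z v h; simp [hpardef, h]
  obtain ⟨M, hM⟩ : ∃ M, ∀ z v, blob z = some v → dist v z < M := by
    have : ((fun z => (blob z).elim 0 (fun v => dist v z)) '' {z | blob z ≠ none}).Finite :=
      hfin.image _
    obtain ⟨M, hM⟩ := this.bddAbove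
    refine ⟨M + 1, fun z v h => ?_⟩
    have : (blob z).elim 0 (fun v => dist v z) ≤ M := hM ⟨z, by simp [h], rfl⟩
    rw [h] at this
    exact Nat.lt_succ_of_le this
  set rank : P → ℕ := fun z => (blob z).elim 0 (fun v => rk v * M + dist v z) with hrank
  have hrank1 : ∀ z v, blob z = some v → rank z = rk v * M + dist v z := by
    intro z v h; simp [hrank, h]
  obtain ⟨bd, hbd⟩ : ∃ bd, ∀ z, rank z ≤ bd := by
    obtain ⟨bd, hbd⟩ := (hfin.image rank).bddAbove
    refine ⟨bd, fun z => ?_⟩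
    by_cases h : blob z = none
    · simp [hrank, h]
    · exact hbd ⟨z, h, rfl⟩
  obtain ⟨box, hbox⟩ : ∃ box : ℤ, ∀ z, (box ≤ |z.1| ∨ box ≤ |z.2|) → blob z = none := by
    obtain ⟨B, hB⟩ := (hfin.image (fun z : P => |z.1| + |z.2|)).bddAbove
    refine ⟨B + 1, fun z hz => ?_⟩
    by_contra h
    have : |z.1| + |z.2| ≤ B := hB ⟨z, h, rfl⟩
    have := abs_nonneg z.1
    have := abs_nonneg z.2
    omega
  -- facts on the parent
  have hent_par : ∀ v, par (ent v) = (pd v).map dr := by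
    intro v
    rw [hpar1 _ v (ent1 v)]
    exact (hpar0 _ v (ent1 v)).1 rfl
  have hP : ∀ z k, par z = some k → rank (z + stp k) < rank z ∧ ∃ v w, blob z = some v ∧
      blob (z + stp k) = some w ∧ cmp v = cmp w ∧ (v = w ↔ ent v ≠ z) := by
    intro z k hk
    cases hb : blob z with
    | none => simp [hpardef, hb] at hk
    | some v =>
      by_cases hz : z = ent v
      · rw [hz, hent_par] at hk
        cases hp : pd v with
        | none => rw [hp] at hk; simp at hk
        | some d =>
          rw [hp] at hk
          simp only [Option.map_some, Option.some.injEq] at hk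
          have e := ent2 v d hp
          obtain ⟨o1, o2⟩ := hpd v d hp
          have hw : blob (z + stp k) = some (own (fl d)) := by
            rw [hz, e, ← hk, ← pt_fl, blob_pt]
          refine ⟨?_, v, own (fl d), rfl, hw, ?_, ?_⟩
          · rw [hrank1 _ _ hw, hrank1 _ _ hb]
            have := hM _ _ hw
            have : rk (own (fl d)) * M + M ≤ rk v * M := by
              rw [← Nat.succ_mul]
              exact Nat.mul_le_mul_right _ o2
            omega
          · rw [hcmp, o1]
          · constructor
            · intro h; exact absurd (o1.trans h).symm (own_fl d)
            · intro h; exact absurd hz.symm h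
      · obtain ⟨l, hl, h1, h2⟩ := (hpar0 z v hb).2 hz
        rw [hpar1 z v hb, hl] at hk
        cases hk
        refine ⟨?_, v, v, rfl, h1, rfl, ?_⟩
        · rw [hrank1 _ _ h1, hrank1 _ _ hb]; omega
        · simp [Ne.symm hz]
  let F : LF V E :=
    { blob := blob, ent := ent, par := par, rank := rank, bd := bd, pt := pt, dr := dr, own := own,
      cmp := cmp, box := box, hbox := hbox, rank_le := hbd, blob_ent := ent1,
      par_rank := fun z k h => (hP z k h).1
      par_blob := fun z k h => (hP z k h).2
      par_none := by
        intro z v hv hn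
        by_cases hz : z = ent v
        · refine ⟨hz.symm, hcmp0 v ?_⟩
          rw [hz, hent_par] at hn
          simpa using hn
        · obtain ⟨l, hl, _⟩ := (hpar0 z v hv).2 hz
          rw [hpar1 z v hv, hl] at hn
          cases hn
      pt_inj := pt_inj, blob_pt := blob_pt, pt_fl := pt_fl, dr_fl := dr_fl, own_fl := own_fl,
      cmp_fl := hcmp }
  obtain ⟨f, hf1, hf2, hf3⟩ := F.book x (by
    show par (ent x) = none
    rw [hent_par, hx]; rfl)
  refine ⟨f, hf1, hf2, ?_⟩
  intro v d hd
  have := hf3 d (by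
    show par (pt d) = some (dr d)
    rw [← ent2 v d hd, hent_par, hd]; rfl)
  rw [← (hpd v d hd).1]
  exact this

end BK

namespace BK
open Filter Topology

/-! ### from plane sets to the lattice -/

/-- lattice points whose distance to the scaled set is at most one -/
def rnd (N : ℝ) (A : Set (ℝ × ℝ)) : Set P :=
  {z | ∃ s ∈ A, |N * s.1 - z.1| ≤ 1 ∧ |N * s.2 - z.2| ≤ 1}

lemma rnd_mono (N : ℝ) {A B : Set (ℝ × ℝ)} (h : A ⊆ B) : rnd N A ⊆ rnd N B := by
  rintro z ⟨s, hs, h'⟩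
  exact ⟨s, h hs, h'⟩

lemma rnd_fin (N : ℝ) {A : Set (ℝ × ℝ)} (h : Bornology.IsBounded A) : (rnd N A).Finite := by
  obtain ⟨C, hC⟩ := h.exists_norm_le
  set m : ℤ := ⌈|N| * C⌉ + 1 with hm
  refine ((Set.finite_Icc (-m) m).prod (Set.finite_Icc (-m) m)).subset ?_
  rintro z ⟨s, hs, h1, h2⟩
  have hn := hC s hs
  have b1 : |s.1| ≤ C := (norm_fst_le s).trans hn
  have b2 : |s.2| ≤ C := (norm_snd_le s).trans hn
  have key : ∀ (t : ℝ) (y : ℤ), |t| ≤ C → |N * t - y| ≤ 1 → y ∈ Set.Icc (-m) m := by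
    intro t y ht hy
    have e1 : |N * t| ≤ |N| * C := by
      rw [abs_mul]; exact mul_le_mul_of_nonneg_left ht (abs_nonneg _)
    have e2 := Int.le_ceil (|N| * C)
    have e3 := abs_le.mp e1
    have e4 := abs_le.mp hy
    have f1 : (y : ℝ) ≤ (m : ℝ) := by rw [hm]; push_cast; linarith
    have f2 : -(m : ℝ) ≤ (y : ℝ) := by rw [hm]; push_cast; linarith
    exact ⟨by exact_mod_cast f2, by exact_mod_cast f1⟩
  exact ⟨key _ _ b1 h1, key _ _ b2 h2⟩

lemma lconn_h (B : Set P) (c : ℤ) (n : ℕ) : ∀ a b : ℤ, b = a + n →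
    (∀ t, a ≤ t → t ≤ b → (t, c) ∈ B) → lconn B (a, c) (b, c) := by
  induction n with
  | zero => intro a b h _; simp at h; subst h; exact .refl
  | succ n ih =>
    intro a b h hB
    refine (ih a (b - 1) (by push_cast at h; omega) (fun t h1 h2 => hB t h1 (by omega))).tail ?_
    push_cast at h
    refine ⟨hB _ (by omega) (by omega), hB _ (by omega) le_rfl, 1, ?_⟩
    rw [show stp 1 = (1, 0) from by decide]
    simp

lemma lconn_v (B : Set P) (c : ℤ) (n : ℕ) : ∀ a b : ℤ, b = a + n →
    (∀ t, a ≤ t → t ≤ b → (c, t) ∈ B) → lconn B (c, a) (c, b) := by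
  induction n with
  | zero => intro a b h _; simp at h; subst h; exact .refl
  | succ n ih =>
    intro a b h hB
    refine (ih a (b - 1) (by push_cast at h; omega) (fun t h1 h2 => hB t h1 (by omega))).tail ?_
    push_cast at h
    refine ⟨hB _ (by omega) (by omega), hB _ (by omega) le_rfl, 0, ?_⟩
    rw [show stp 0 = (0, 1) from by decide]
    simp

lemma cell_conn (B : Set P) (s : ℝ × ℝ)
    (hB : ∀ z : P, |s.1 - z.1| ≤ 1 → |s.2 - z.2| ≤ 1 → z ∈ B) (z w : P)
    (hz1 : |s.1 - z.1| ≤ 1) (hz2 : |s.2 - z.2| ≤ 1) (hw1 : |s.1 - w.1| ≤ 1)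
    (hw2 : |s.2 - w.2| ≤ 1) : lconn B z w := by
  have mid : ∀ (r : ℝ) (a b t : ℤ), |r - a| ≤ 1 → |r - b| ≤ 1 → a ≤ t → t ≤ b → |r - t| ≤ 1 := by
    intro r a b t h1 h2 h3 h4
    have h3' : (a : ℝ) ≤ t := by exact_mod_cast h3
    have h4' : (t : ℝ) ≤ b := by exact_mod_cast h4
    rw [abs_le] at *
    constructor <;> linarith
  obtain ⟨z1, z2⟩ := z
  obtain ⟨w1, w2⟩ := w
  simp only at *
  have s1 : lconn B (z1, z2) (w1, z2) := by
    rcases le_total z1 w1 with h | h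
    · exact lconn_h B z2 (w1 - z1).toNat z1 w1 (by omega)
        (fun t h1 h2 => hB _ (mid _ _ _ _ hz1 hw1 h1 h2) hz2)
    · exact lconn_symm (lconn_h B z2 (z1 - w1).toNat w1 z1 (by omega)
        (fun t h1 h2 => hB _ (mid _ _ _ _ hw1 hz1 h1 h2) hz2))
  have s2 : lconn B (w1, z2) (w1, w2) := by
    rcases le_total z2 w2 with h | h
    · exact lconn_v B w1 (w2 - z2).toNat z2 w2 (by omega)
        (fun t h1 h2 => hB _ hw1 (mid _ _ _ _ hz2 hw2 h1 h2))
    · exact lconn_symm (lconn_v B w1 (z2 - w2).toNat w2 z2 (by omega)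
        (fun t h1 h2 => hB _ hw1 (mid _ _ _ _ hw2 hz2 h1 h2)))
  exact s1.trans s2

lemma cell_ne (s : ℝ × ℝ) : ∃ z : P, |s.1 - z.1| ≤ 1 / 2 ∧ |s.2 - z.2| ≤ 1 / 2 :=
  ⟨(round s.1, round s.2), abs_sub_round _, abs_sub_round _⟩

lemma rnd_conn (N : ℝ) (hN : 0 < N) {A : Set (ℝ × ℝ)} (hA : IsPreconnected A) {z w : P}
    (hz : z ∈ rnd N A) (hw : w ∈ rnd N A) : lconn (rnd N A) z w := by
  obtain ⟨s, hs, hz1, hz2⟩ := hz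
  obtain ⟨t, ht, hw1, hw2⟩ := hw
  refine hA.induction₂ (fun s t => ∀ z w : P, |N * s.1 - z.1| ≤ 1 → |N * s.2 - z.2| ≤ 1 →
    |N * t.1 - w.1| ≤ 1 → |N * t.2 - w.2| ≤ 1 → lconn (rnd N A) z w) ?_ ?_ ?_ hs ht z w hz1 hz2 hw1 hw2
  · intro s hs
    have hball : Metric.ball s (1 / (2 * N)) ∈ 𝓝 s := Metric.ball_mem_nhds _ (by positivity)
    filter_upwards [mem_nhdsWithin_of_mem_nhds hball, self_mem_nhdsWithin] with t ht htA
    intro z w hz1 hz2 hw1 hw2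
    obtain ⟨y, hy1, hy2⟩ := cell_ne (N * s.1, N * s.2)
    simp only at hy1 hy2
    have near : ∀ a b : ℝ, |b - a| < 1 / (2 * N) → |N * b - N * a| ≤ 1 / 2 := by
      intro a b h
      rw [← mul_sub, abs_mul, abs_of_pos hN]
      have : N * |b - a| ≤ N * (1 / (2 * N)) := mul_le_mul_of_nonneg_left h.le hN.le
      rwa [show N * (1 / (2 * N)) = 1 / 2 by field_simp] at this
    rw [Metric.mem_ball, Prod.dist_eq, max_lt_iff, Real.dist_eq, Real.dist_eq] at ht
    have n1 := near _ _ ht.1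
    have n2 := near _ _ ht.2
    have c1 := cell_conn (rnd N A) (N * s.1, N * s.2) (fun z h1 h2 => ⟨s, hs, h1, h2⟩) z y hz1 hz2
      (by simp only; linarith) (by simp only; linarith)
    have c2 := cell_conn (rnd N A) (N * t.1, N * t.2) (fun z h1 h2 => ⟨t, htA, h1, h2⟩) y w
      (by simp only; have := abs_sub_le (N * t.1) (N * s.1) y.1; linarith)
      (by simp only; have := abs_sub_le (N * t.2) (N * s.2) y.2; linarith) hw1 hw2
    exact c1.trans c2
  · intro a b c _ _ _ h1 h2 z w hz1 hz2 hw1 hw2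
    obtain ⟨y, hy1, hy2⟩ := cell_ne (N * b.1, N * b.2)
    simp only at hy1 hy2
    exact (h1 z y hz1 hz2 (by linarith) (by linarith)).trans (h2 y w (by linarith) (by linarith) hw1 hw2)
  · intro a b _ _ h z w hz1 hz2 hw1 hw2
    exact lconn_symm (h w z hw1 hw2 hz1 hz2)

lemma rnd_ne (N : ℝ) {s : ℝ × ℝ} : ∃ z : P, ∀ A, s ∈ A → z ∈ rnd N A := by
  obtain ⟨z, h1, h2⟩ := cell_ne (N * s.1, N * s.2)
  simp only at h1 h2
  exact ⟨z, fun A hA => ⟨s, hA, by linarith, by linarith⟩⟩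

lemma rnd_disj {A B : Set (ℝ × ℝ)} (hA : IsCompact A) (hB : IsCompact B) (h : Disjoint A B) :
    ∀ᶠ N : ℝ in atTop, Disjoint (rnd N A) (rnd N B) := by
  obtain ⟨δ, hδ, hd⟩ : ∃ δ > 0, ∀ a ∈ A, ∀ b ∈ B, δ ≤ dist a b := by
    by_cases hne : (A ×ˢ B).Nonempty
    · obtain ⟨p, hp, hmin⟩ := (hA.prod hB).exists_isMinOn hne
        (continuous_dist.continuousOn (s := A ×ˢ B))
      refine ⟨dist p.1 p.2, dist_pos.mpr ?_, ?_⟩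
      · intro e
        exact (Set.disjoint_left.mp h) hp.1 (by rw [e]; exact hp.2)
      · intro a ha b hb
        exact hmin (Set.mk_mem_prod ha hb)
    · refine ⟨1, one_pos, fun a ha b hb => absurd ⟨(a, b), ha, hb⟩ hne⟩
  filter_upwards [eventually_gt_atTop (2 / δ)] with N hN
  rw [Set.disjoint_left]
  rintro z ⟨s, hs, h1, h2⟩ ⟨t, ht, h3, h4⟩
  have hN0 : 0 < N := lt_trans (by positivity) hN
  have hδN : 2 < N * δ := by rwa [div_lt_iff₀ hδ] at hN
  have := hd s hs t ht
  have hle : dist s t ≤ 2 / N := by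
    rw [Prod.dist_eq, max_le_iff, Real.dist_eq, Real.dist_eq, le_div_iff₀ hN0, le_div_iff₀ hN0]
    have key : ∀ (a b : ℝ) (c : ℤ), |N * a - c| ≤ 1 → |N * b - c| ≤ 1 → |a - b| * N ≤ 2 := by
      intro a b c h1 h2
      have : |a - b| * N = |N * a - N * b| := by rw [← mul_sub, abs_mul, abs_of_pos hN0, mul_comm]
      rw [this]
      rw [abs_le] at *
      constructor <;> linarith
    exact ⟨key _ _ _ h1 h3, key _ _ _ h2 h4⟩
  have : δ ≤ 2 / N := this.trans hle
  rw [le_div_iff₀ hN0] at this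
  linarith

lemma first_exit (R B : Set P) {p q : P} (h : lconn R p q) (hp : p ∉ B) (hq : q ∈ B) :
    ∃ z w, lconn (R \ B) p z ∧ z ∉ B ∧ w ∈ B ∧ ladj R z w := by
  induction h with
  | refl => exact absurd hq hp
  | @tail b c hb hbc ih =>
    by_cases hbB : b ∈ B
    · exact ih hbB
    · have : ∀ b, lconn R p b → b ∉ B → lconn (R \ B) p b ∨
          ∃ z w, lconn (R \ B) p z ∧ z ∉ B ∧ w ∈ B ∧ ladj R z w := by
        intro b hb
        induction hb with
        | refl => intro _; exact Or.inl .refl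
        | @tail x y _ hxy ih2 =>
          intro hy
          by_cases hx : x ∈ B
          · right
            -- an earlier exit exists
            have : ∀ x, lconn R p x → x ∈ B →
                ∃ z w, lconn (R \ B) p z ∧ z ∉ B ∧ w ∈ B ∧ ladj R z w := by
              intro x hx
              have gen : ∀ x, lconn R p x → (x ∉ B → lconn (R \ B) p x ∨
                  ∃ z w, lconn (R \ B) p z ∧ z ∉ B ∧ w ∈ B ∧ ladj R z w) ∧ (x ∈ B →
                  ∃ z w, lconn (R \ B) p z ∧ z ∉ B ∧ w ∈ B ∧ ladj R z w) := by
                intro x hx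
                induction hx with
                | refl => exact ⟨fun _ => Or.inl .refl, fun h => absurd h hp⟩
                | @tail u v _ huv ih3 =>
                  by_cases hu : u ∈ B
                  · have := ih3.2 hu
                    exact ⟨fun _ => Or.inr this, fun _ => this⟩
                  · rcases ih3.1 hu with h | h
                    · refine ⟨fun hv => Or.inl (h.tail ⟨⟨huv.1, hu⟩, ⟨huv.2.1, hv⟩, huv.2.2⟩),
                        fun hv => ⟨u, v, h, hu, hv, huv⟩⟩
                    · exact ⟨fun _ => Or.inr h, fun _ => h⟩
              exact (gen x hx).2
            exact this x ‹_› hx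
          · rcases ih2 hx with h | h
            · exact Or.inl (h.tail ⟨⟨hxy.1, hx⟩, ⟨hxy.2.1, hy⟩, hxy.2.2⟩)
            · exact Or.inr h
      rcases this b hb hbB with h | h
      · exact ⟨b, c, h, hbB, hq, hbc⟩
      · exact h

theorem topo_book {V E : Type} [Finite V] [Finite E] (own : E × Bool → V)
    (own_fl : ∀ d, own (fl d) ≠ own d) (S : V → Set (ℝ × ℝ)) (M : E → Set (ℝ × ℝ))
    (Sc : ∀ v, IsCompact (S v)) (Sp : ∀ v, IsPreconnected (S v)) (Sne : ∀ v, (S v).Nonempty)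
    (Sd : ∀ v w, v ≠ w → Disjoint (S v) (S w))
    (Mc : ∀ e, IsCompact (M e)) (Mp : ∀ e, IsPreconnected (M e))
    (Md : ∀ e f, e ≠ f → Disjoint (M e) (M f))
    (MS : ∀ e v, (∀ b, own (e, b) ≠ v) → Disjoint (M e) (S v))
    (Mm : ∀ d : E × Bool, (M d.1 ∩ S (own d)).Nonempty)
    (pd : V → Option (E × Bool)) (rk : V → ℕ) (cmp : V → V)
    (hpd : ∀ v d, pd v = some d → own d = v ∧ rk (own (fl d)) < rk v)
    (hcmp : ∀ d, cmp (own (fl d)) = cmp (own d)) (hcmp0 : ∀ v, pd v = none → cmp v = v)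
    (x : V) (hx : pd x = none) :
    ∃ f : Itm V (E × Bool) → ℕ, IsBook own f ∧ f (Itm.v x) = 0 ∧
      ∀ v d, pd v = some d → f (Itm.v v) = f (Itm.d (fl d)) + 1 ∧
        f (Itm.d d) = f (Itm.d (fl d)) + 2 := by
  classical
  obtain ⟨N, hN, hSd, hMd, hMS⟩ : ∃ N : ℝ, 0 < N ∧
      (∀ v w, v ≠ w → Disjoint (rnd N (S v)) (rnd N (S w))) ∧
      (∀ e f, e ≠ f → Disjoint (rnd N (M e)) (rnd N (M f))) ∧
      (∀ e v, (∀ b, own (e, b) ≠ v) → Disjoint (rnd N (M e)) (rnd N (S v))) := by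
    have h1 : ∀ᶠ N : ℝ in atTop, ∀ v w, v ≠ w → Disjoint (rnd N (S v)) (rnd N (S w)) := by
      refine eventually_all.mpr fun v => eventually_all.mpr fun w => ?_
      by_cases h : v = w
      · exact Eventually.of_forall fun _ h' => absurd h h'
      · filter_upwards [rnd_disj (Sc v) (Sc w) (Sd v w h)] with N hN _ using hN
    have h2 : ∀ᶠ N : ℝ in atTop, ∀ v w, v ≠ w → Disjoint (rnd N (M v)) (rnd N (M w)) := by
      refine eventually_all.mpr fun v => eventually_all.mpr fun w => ?_
      by_cases h : v = w
      · exact Eventually.of_forall fun _ h' => absurd h h'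
      · filter_upwards [rnd_disj (Mc v) (Mc w) (Md v w h)] with N hN _ using hN
    have h3 : ∀ᶠ N : ℝ in atTop, ∀ e v, (∀ b, own (e, b) ≠ v) →
        Disjoint (rnd N (M e)) (rnd N (S v)) := by
      refine eventually_all.mpr fun v => eventually_all.mpr fun w => ?_
      by_cases h : ∀ b, own (v, b) ≠ w
      · filter_upwards [rnd_disj (Mc v) (Sc w) (MS v w h)] with N hN _ using hN
      · exact Eventually.of_forall fun _ h' => absurd h' h
    obtain ⟨N, hN⟩ := (((eventually_gt_atTop (0 : ℝ)).and h1).and (h2.and h3)).exists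
    exact ⟨N, hN.1.1, hN.1.2, hN.2.1, hN.2.2⟩
  set RS : V → Set P := fun v => rnd N (S v) with hRS
  set RM : E → Set P := fun e => rnd N (M e) with hRM
  -- starting points and exits
  have hmeet : ∀ d : E × Bool, ∃ z, z ∈ RM d.1 ∧ z ∈ RS (own d) := by
    intro d
    obtain ⟨s, h1, h2⟩ := Mm d
    obtain ⟨z, hz⟩ := rnd_ne N (s := s)
    exact ⟨z, hz _ h1, hz _ h2⟩
  choose p0 p0M p0S using hmeet
  have hst : ∀ e : E, own (e, false) ≠ own (e, true) := fun e => own_fl (e, true)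
  have hex : ∀ e : E, ∃ z w, lconn (RM e \ RS (own (e, true))) (p0 (e, false)) z ∧
      z ∉ RS (own (e, true)) ∧ w ∈ RS (own (e, true)) ∧ ladj (RM e) z w := by
    intro e
    refine first_exit _ _ (rnd_conn N hN (Mp e) (p0M (e, false)) (p0M (e, true))) ?_ (p0S (e, true))
    exact fun h => Set.disjoint_left.mp (hSd _ _ (hst e)) (p0S (e, false)) h
  choose pz pw hz1 hz2 hw1 hzw using hex
  choose hzM hwM kk hkk using hzw
  set I : E → Set P := fun e => {z | lconn (RM e \ RS (own (e, true))) (p0 (e, false)) z} with hI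
  have hIsub : ∀ e, I e ⊆ RM e \ RS (own (e, true)) := by
    intro e z hz
    rcases Relation.ReflTransGen.cases_tail hz with h | ⟨y, _, h⟩
    · rw [h]
      exact ⟨p0M (e, false), fun h => Set.disjoint_left.mp (hSd _ _ (hst e)) (p0S (e, false)) h⟩
    · exact h.2.1
  set Bl : V → Set P := fun v => RS v ∪ ⋃ e, {z | own (e, false) = v ∧ z ∈ I e} with hBl
  have hBld : ∀ v w z, z ∈ Bl v → z ∈ Bl w → v = w := by
    have mix : ∀ v e z, z ∈ RS v → z ∈ I e → own (e, false) = v := by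
      intro v e z h1 h2
      by_contra hne
      obtain ⟨h3, h4⟩ := hIsub e h2
      refine Set.disjoint_left.mp (hMS e v ?_) h3 h1
      rintro (_ | _)
      · exact hne
      · rintro rfl; exact h4 h1
    intro v w z h1 h2
    simp only [hBl, Set.mem_union, Set.mem_iUnion, Set.mem_setOf_eq] at h1 h2
    rcases h1 with h1 | ⟨e, he, h1⟩ <;> rcases h2 with h2 | ⟨f, hf, h2⟩
    · by_contra h; exact Set.disjoint_left.mp (hSd v w h) h1 h2
    · rw [← hf, mix _ _ _ h1 h2]
    · rw [← he, mix _ _ _ h2 h1]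
    · by_cases hef : e = f
      · subst hef; rw [← he, hf]
      · exact absurd (hIsub f h2).1 (Set.disjoint_left.mp (hMd e f hef) (hIsub e h1).1)
  set blob : P → Option V := fun z => if h : ∃ v, z ∈ Bl v then some h.choose else none with hblob
  have blob_iff : ∀ z v, blob z = some v ↔ z ∈ Bl v := by
    intro z v
    simp only [hblob]
    constructor
    · intro h
      split_ifs at h with h'
      · have := h'.choose_spec
        rwa [Option.some.inj h] at this
    · intro h
      have h' : ∃ v, z ∈ Bl v := ⟨v, h⟩
      rw [dif_pos h', hBld _ _ z h'.choose_spec h]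
  have hfin : {z | blob z ≠ none}.Finite := by
    have hf1 : ((⋃ v, RS v) ∪ ⋃ e, RM e).Finite := by
      refine (Set.finite_iUnion fun v => ?_).union (Set.finite_iUnion fun e => ?_)
      · exact rnd_fin N (Sc v).isBounded
      · exact rnd_fin N (Mc e).isBounded
    refine hf1.subset ?_
    intro z hz
    obtain ⟨v, hv⟩ := Option.ne_none_iff_exists'.mp hz
    rcases (blob_iff z v).mp hv with h | h
    · exact Or.inl (Set.mem_iUnion.mpr ⟨v, h⟩)
    · obtain ⟨e, _, he⟩ := Set.mem_iUnion.mp h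
      exact Or.inr (Set.mem_iUnion.mpr ⟨e, (hIsub e he).1⟩)
  have hset : ∀ v, {z | blob z = some v} = Bl v := by
    intro v; ext z; exact blob_iff z v
  let pt : E × Bool → P := fun d => if d.2 then pw d.1 else pz d.1
  let dr : E × Bool → ZMod 4 := fun d => if d.2 then kk d.1 + 2 else kk d.1
  refine lat_book own own_fl blob hfin ?_ ?_ pt dr ?_ ?_ ?_ ?_ pd rk cmp hpd hcmp hcmp0 x hx
  · intro v
    obtain ⟨s, hs⟩ := Sne v
    obtain ⟨z, hz⟩ := rnd_ne N (s := s)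
    exact ⟨z, (blob_iff z v).mpr (Or.inl (hz _ hs))⟩
  · intro v z w hz hw
    rw [hset]
    rw [blob_iff] at hz hw
    have toS : ∀ z ∈ Bl v, ∃ y ∈ RS v, lconn (Bl v) y z := by
      intro z hz
      rcases hz with h | h
      · exact ⟨z, h, .refl⟩
      · obtain ⟨e, he, h⟩ := Set.mem_iUnion.mp h
        refine ⟨p0 (e, false), by rw [← he]; exact p0S (e, false), ?_⟩
        have : ∀ z, lconn (RM e \ RS (own (e, true))) (p0 (e, false)) z →
            lconn (Bl v) (p0 (e, false)) z := by
          intro z hz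
          induction hz with
          | refl => exact .refl
          | @tail b c hb hbc ih =>
            have hbI : b ∈ I e := hb
            have hcI : c ∈ I e := hb.tail hbc
            exact ih.tail ⟨Or.inr (Set.mem_iUnion.mpr ⟨e, he, hbI⟩),
              Or.inr (Set.mem_iUnion.mpr ⟨e, he, hcI⟩), hbc.2.2⟩
        exact this z h
    obtain ⟨y, hy, hyz⟩ := toS z hz
    obtain ⟨y', hy', hyw⟩ := toS w hw
    have : lconn (Bl v) y y' := lconn_mono Set.subset_union_left (rnd_conn N hN (Sp v) hy hy')
    exact (lconn_symm hyz).trans (this.trans hyw)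
  · rintro ⟨e, b⟩ ⟨f, c⟩ h
    have hM1 : ∀ d, pt d ∈ RM d.1 := by
      rintro ⟨e, _ | _⟩
      · exact hzM e
      · exact hwM e
    have hef : e = f := by
      by_contra hne
      have h1 := hM1 (e, b)
      rw [h] at h1
      exact Set.disjoint_left.mp (hMd e f hne) h1 (hM1 (f, c))
    subst hef
    have hne : pz e ≠ pw e := fun h => hz2 e (by rw [h]; exact hw1 e)
    cases b <;> cases c
    · rfl
    · exact absurd h hne
    · exact absurd h.symm hne
    · rfl
  · rintro ⟨e, _ | _⟩
    · exact (blob_iff _ _).mpr (Or.inr (Set.mem_iUnion.mpr ⟨e, rfl, hz1 e⟩))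
    · exact (blob_iff _ _).mpr (Or.inl (hw1 e))
  · rintro ⟨e, _ | _⟩
    · exact hkk e
    · show pz e = pw e + stp (kk e + 2)
      rw [hkk e, add_stp_stp]
  · rintro ⟨e, _ | _⟩
    · rfl
    · exact (zm4 (kk e)).symm

end BK

namespace BK

/-! ### spanning forests -/

section forest
variable {V E : Type} (own : E × Bool → V)

def dadj (u v : V) : Prop := ∃ d, own d = u ∧ own (fl d) = v

lemma dadj_symm {u v : V} (h : dadj own u v) : dadj own v u := by
  obtain ⟨d, h1, h2⟩ := h
  exact ⟨fl d, h2, by rw [fl_fl]; exact h1⟩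

def dreach (u v : V) : Prop := Relation.ReflTransGen (dadj own) u v

lemma dreach_symm {u v : V} (h : dreach own u v) : dreach own v u := by
  induction h with
  | refl => exact .refl
  | tail _ h ih => exact Relation.ReflTransGen.head (dadj_symm own h) ih

def dsetoid : Setoid V where
  r := dreach own
  iseqv := ⟨fun _ => .refl, fun h => dreach_symm own h, fun h h' => Relation.ReflTransGen.trans h h'⟩

open Classical in
noncomputable def drep (x v : V) : V :=
  if dreach own x v then x else (Quotient.mk (dsetoid own) v).out

lemma drep_reach (x v : V) : dreach own (drep own x v) v := by
  unfold drep
  split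
  · assumption
  · exact Quotient.exact (s := dsetoid own) (Quotient.out_eq _)

lemma drep_eq (x : V) {v w : V} (h : dreach own v w) : drep own x v = drep own x w := by
  unfold drep
  have : (Quotient.mk (dsetoid own) v) = Quotient.mk (dsetoid own) w := Quotient.sound h
  rw [this]
  have : dreach own x v ↔ dreach own x w :=
    ⟨fun k => k.trans h, fun k => k.trans (dreach_symm own h)⟩
  by_cases k : dreach own x v
  · rw [if_pos k, if_pos (this.mp k)]
  · rw [if_neg k, if_neg (fun h => k (this.mpr h))]

lemma forest (x : V) : ∃ (pd : V → Option (E × Bool)) (rk : V → ℕ) (cmp : V → V),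
    (∀ v d, pd v = some d → own d = v ∧ rk (own (fl d)) < rk v) ∧
    (∀ d, cmp (own (fl d)) = cmp (own d)) ∧ (∀ v, pd v = none → cmp v = v) ∧ pd x = none ∧
    ∀ d, own d = x → own (fl d) ≠ x → ∃ d', pd (own (fl d)) = some d' ∧ own (fl d') = x := by
  classical
  choose dist d0 d1 d2 d3 using fun r => bfs (dadj own) r
  have key : ∀ v, v ≠ drep own x v → ∃ d, own d = v ∧ dreach own (drep own x v) (own (fl d)) ∧
      dist (drep own x v) (own (fl d)) < dist (drep own x v) v := by
    intro v hv
    obtain ⟨y, ⟨d, h1, h2⟩, h3, h4⟩ := d1 (drep own x v) v (drep_reach own x v) hv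
    refine ⟨fl d, h2, ?_, ?_⟩
    · rw [fl_fl, h1]; exact h3
    · rw [fl_fl, h1]; exact h4
  have hx : drep own x x = x := by
    unfold drep
    rw [if_pos]; exact .refl
  choose pdd hp1 hp2 hp3 using key
  refine ⟨fun v => if h : v = drep own x v then none else some (pdd v h),
    fun v => dist (drep own x v) v, drep own x, ?_, ?_, ?_, ?_, ?_⟩
  · intro v d h
    by_cases hv : v = drep own x v
    · dsimp only at h; rw [dif_pos hv] at h; cases h
    · dsimp only at h; rw [dif_neg hv, Option.some.injEq] at h
      subst h
      refine ⟨hp1 v hv, ?_⟩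
      show dist (drep own x _) _ < _
      have : drep own x (own (fl (pdd v hv))) = drep own x v := by
        apply drep_eq
        exact dreach_symm own ((dreach_symm own (drep_reach own x v)).trans (hp2 v hv))
      rw [this]
      exact hp3 v hv
  · intro d
    apply drep_eq
    exact .single ⟨fl d, rfl, by rw [fl_fl]⟩
  · intro v h
    by_cases hv : v = drep own x v
    · exact hv.symm
    · dsimp only at h; rw [dif_neg hv] at h; cases h
  · exact dif_pos hx.symm
  · intro d hd hn
    have r : dreach own x (own (fl d)) := .single ⟨d, hd, rfl⟩
    have e : drep own x (own (fl d)) = x := by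
      unfold drep; rw [if_pos r]
    have hne : own (fl d) ≠ drep own x (own (fl d)) := by rw [e]; exact hn
    refine ⟨pdd (own (fl d)) hne, dif_neg hne, ?_⟩
    have h2 := hp2 _ hne
    have h3 := hp3 _ hne
    rw [e] at h2 h3
    have := d2 x _ ⟨d, hd, rfl⟩
    exact d3 x _ h2 (by omega)

end forest
end BK

namespace BK

/-! ### normalising one side -/

/-- two chords of a line interlace -/
def IL {α : Type*} [LinearOrder α] (p q r s : α) : Prop :=
  (min p q < min r s ∧ min r s < max p q ∧ max p q < max r s) ∨
  (min r s < min p q ∧ min p q < max r s ∧ max r s < max p q)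

/-- strict betweenness -/
def BT {α : Type*} [LinearOrder α] (p q r : α) : Prop := min p q < r ∧ r < max p q

section norm
variable {V E : Type} (own : E × Bool → V) (T : Fin 3 → V)

structure Pre (f : Itm V (E × Bool) → ℤ) : Prop where
  inj : Function.Injective f
  near : ∀ c e, own c ≠ own e → own c ∉ Set.range T → own e ∉ Set.range T →
    ¬ IL (f (.v (own c))) (f (.d c)) (f (.v (own e))) (f (.d e))
  nearT : ∀ c e, own c ∈ Set.range T → own e ∉ Set.range T →
    ¬ BT (f (.v (own e))) (f (.d e)) (f (.d c))
  far : ∀ c e : E × Bool, c.1 ≠ e.1 →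
    ¬ IL (f (.d c)) (f (.d (fl c))) (f (.d e)) (f (.d (fl e)))
  str : ∀ i e, ¬ BT (f (.v (own e))) (f (.d e)) (f (.v (T i)))

structure IsSide (g : Itm V (E × Bool) → ℤ) (lab : Itm V (E × Bool) → ℤ) : Prop
    extends Pre own T g where
  mono : ∀ x y, lab x < lab y → g x < g y
  labT : ∀ i, lab (.v (T i)) = (i : ℕ)
  labd : ∀ d, lab (.d d) = lab (.v (own d))
  labr : ∀ x, 0 ≤ lab x ∧ lab x ≤ 2

variable {own T}

lemma Pre.neg {f : Itm V (E × Bool) → ℤ} (h : Pre own T f) : Pre own T (fun x => - f x) where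
  inj := fun x y e => h.inj (neg_injective e)
  near := fun c e h1 h2 h3 => by
    have := h.near c e h1 h2 h3
    unfold IL at *
    omega
  nearT := fun c e h1 h2 => by
    have := h.nearT c e h1 h2
    unfold BT at *
    omega
  far := fun c e h1 => by
    have := h.far c e h1
    unfold IL at *
    omega
  str := fun i e => by
    have := h.str i e
    unfold BT at *
    omega

lemma IL_rot {p q r s p' q' r' s' N : ℤ} {P Q R S : Prop}
    (hp : (P ∧ p' = p + N) ∨ (¬ P ∧ p' = p)) (hq : (Q ∧ q' = q + N) ∨ (¬ Q ∧ q' = q))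
    (hr : (R ∧ r' = r + N) ∨ (¬ R ∧ r' = r)) (hs : (S ∧ s' = s + N) ∨ (¬ S ∧ s' = s))
    (h1 : |p| < N) (h2 : |q| < N) (h3 : |r| < N) (h4 : |s| < N)
    (hN : ∀ x ∈ [(p, P), (q, Q), (r, R), (s, S)], ∀ y ∈ [(p, P), (q, Q), (r, R), (s, S)],
      x.2 → ¬ y.2 → x.1 < y.1)
    (hN' : ∀ x ∈ [p, q, r, s], ∀ y ∈ [p, q, r, s], x < y + N)
    (h : ¬ IL p q r s) : ¬ IL p' q' r' s' := by
  simp only [List.mem_cons, List.not_mem_nil, or_false, forall_eq_or_imp, forall_eq] at hN hN'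
  unfold IL at *
  rcases hp with ⟨hp, rfl⟩ | ⟨hp, rfl⟩ <;> rcases hq with ⟨hq, rfl⟩ | ⟨hq, rfl⟩ <;>
    rcases hr with ⟨hr, rfl⟩ | ⟨hr, rfl⟩ <;> rcases hs with ⟨hs, rfl⟩ | ⟨hs, rfl⟩ <;>
    simp only [hp, hq, hr, hs, true_implies, false_implies, not_true_eq_false, not_false_eq_true,
      implies_true, true_and, and_true] at hN <;> omega

lemma Pre.rot [Finite V] [Finite E] {f : Itm V (E × Bool) → ℤ} (h : Pre own T f)
    (Q : Itm V (E × Bool) → Prop) (hQ : ∀ x y, Q x → ¬ Q y → f x < f y)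
    (hd : ∀ d, Q (.d d) ↔ Q (.v (own d))) :
    ∃ (g : Itm V (E × Bool) → ℤ), Pre own T g ∧
      (∀ x y, (Q x ↔ Q y) → (g x < g y ↔ f x < f y)) ∧ (∀ x y, ¬ Q x → Q y → g x < g y) := by
  classical
  have : Finite (Itm V (E × Bool)) := by
    refine Finite.of_injective (β := V ⊕ (E × Bool))
      (fun x => match x with | .v x => .inl x | .d x => .inr x) ?_
    rintro (x | x) (y | y) h <;> simp_all
  obtain ⟨M, hM⟩ : ∃ M : ℤ, ∀ x, |f x| < M := by
    have := (Set.finite_range (fun x => |f x|)).bddAbove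
    obtain ⟨M, hM⟩ := this
    exact ⟨M + 1, fun x => by have := hM ⟨x, rfl⟩; simp only at this; omega⟩
  have hM2 : ∀ x, - M < f x ∧ f x < M := fun x => abs_lt.mp (hM x)
  have hr : ∀ x, (Q x ∧ (if Q x then f x + 2 * M else f x) = f x + 2 * M) ∨
      (¬ Q x ∧ (if Q x then f x + 2 * M else f x) = f x) := by
    intro x; by_cases hx : Q x <;> simp [hx]
  have il : ∀ x y z w, ¬ IL (f x) (f y) (f z) (f w) →
      ¬ IL (if Q x then f x + 2 * M else f x) (if Q y then f y + 2 * M else f y)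
        (if Q z then f z + 2 * M else f z) (if Q w then f w + 2 * M else f w) := by
    intro x y z w
    have a := hM2 x
    have b := hM2 y
    have c := hM2 z
    have d := hM2 w
    have hb : ∀ x, |f x| < 2 * M := fun x => by
      have := hM x; have := abs_nonneg (f x); omega
    refine IL_rot (hr x) (hr y) (hr z) (hr w) (hb x) (hb y) (hb z) (hb w) ?_ ?_
    · simp only [List.mem_cons, List.not_mem_nil, or_false, forall_eq_or_imp, forall_eq]
      refine ⟨⟨?_, ?_, ?_, ?_⟩, ⟨?_, ?_, ?_, ?_⟩, ⟨?_, ?_, ?_, ?_⟩, ⟨?_, ?_, ?_, ?_⟩⟩ <;>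
        exact hQ _ _
    · simp only [List.mem_cons, List.not_mem_nil, or_false, forall_eq_or_imp, forall_eq]
      omega
  have bt : ∀ d y, ¬ BT (f (.v (own d))) (f (.d d)) (f y) →
      ¬ BT (if Q (.v (own d)) then f (.v (own d)) + 2 * M else f (.v (own d)))
       (if Q (.d d) then f (.d d) + 2 * M else f (.d d)) (if Q y then f y + 2 * M else f y) := by
    intro d y k
    have a := hM2 y
    have b := hM2 (.d d)
    have c := hM2 (.v (own d))
    have e := hd d
    unfold BT at *
    by_cases q1 : Q (.d d)
    · have q2 := e.mp q1
      by_cases q3 : Q y <;> simp only [q1, q2, q3, if_true, if_false] <;> omega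
    · have q2 : ¬ Q (.v (own d)) := fun k => q1 (e.mpr k)
      by_cases q3 : Q y <;> simp only [q1, q2, q3, if_true, if_false] <;> omega
  refine ⟨fun x => if Q x then f x + 2 * M else f x, ⟨?_, ?_, ?_, ?_, ?_⟩, ?_, ?_⟩
  · intro x y hxy
    have a := hM2 x
    have b := hM2 y
    rcases hr x with ⟨h1, e1⟩ | ⟨h1, e1⟩ <;> rcases hr y with ⟨h2, e2⟩ | ⟨h2, e2⟩ <;>
      simp only [h1, h2, if_true, if_false] at hxy <;> first | omega | (apply h.inj; omega)
  · intro c e h1 h2 h3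
    exact il _ _ _ _ (h.near c e h1 h2 h3)
  · intro c e h1 h2
    exact bt _ _ (h.nearT c e h1 h2)
  · intro c e h1
    exact il _ _ _ _ (h.far c e h1)
  · intro i e
    exact bt _ _ (h.str i e)
  · intro x y hq
    by_cases h1 : Q x
    · simp [h1, hq.mp h1]
    · have h2 : ¬ Q y := fun k => h1 (hq.mpr k)
      simp [h1, h2]
  · intro x y h1 h2
    have a := hM2 x
    have b := hM2 y
    simp only [h1, h2, if_true, if_false]
    omega

open Classical in
lemma Pre.norm [Finite V] [Finite E] {f : Itm V (E × Bool) → ℤ} (h : Pre own T f)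
    (hT : Function.Injective T) (hlt : ∀ d, f (.v (own d)) < f (.d d)) :
    ∃ g lab, IsSide own T g lab := by
  obtain ⟨g, hg, g1, g2⟩ := h.rot (fun x => f x < f (.v (T 0))) (fun x y h1 h2 => by omega) (by
    intro d
    have h1 := h.str 0 d
    have h2 := hlt d
    unfold BT at h1
    have := @h.inj (.v (own d)) (.v (T 0))
    have h4 := @h.inj (.d d) (.v (T 0))
    simp only [reduceCtorEq, imp_false] at h4
    constructor <;> omega)
  have gT : ∀ x, x ≠ .v (T 0) → g (.v (T 0)) < g x := by
    intro x hx
    by_cases hc : f x < f (.v (T 0))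
    · exact g2 _ _ (lt_irrefl _) hc
    · rw [g1]
      · have := fun k => hx (@h.inj x (.v (T 0)) k)
        have k2 : ¬ f x = f (.v (T 0)) := this
        omega
      · simp [hc]
  have glt : ∀ d, g (.v (own d)) < g (.d d) := by
    intro d
    rw [g1]
    · exact hlt d
    · have h1 := h.str 0 d
      have h2 := hlt d
      unfold BT at h1
      have h4 := @h.inj (.d d) (.v (T 0))
      simp only [reduceCtorEq, imp_false] at h4
      constructor <;> omega
  have n12 : g (.v (T 1)) ≠ g (.v (T 2)) := fun k => by
    have := hg.inj k
    simp only [Itm.v.injEq] at this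
    exact absurd (hT this) (by decide)
  have n1 := gT (.v (T 1)) (fun k => by
    simp only [Itm.v.injEq] at k; exact absurd (hT k) (by decide))
  have n2 := gT (.v (T 2)) (fun k => by
    simp only [Itm.v.injEq] at k; exact absurd (hT k) (by decide))
  have sd : ∀ i d, g (.d d) < g (.v (T i)) ↔ g (.v (own d)) < g (.v (T i)) := by
    intro i d
    have h1 := hg.str i d
    have h2 := glt d
    unfold BT at h1
    have h4 := @hg.inj (.d d) (.v (T i))
    simp only [reduceCtorEq, imp_false] at h4
    constructor <;> omega
  rcases lt_or_gt_of_ne n12 with hc | hc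
  · refine ⟨g, fun x => if g x < g (.v (T 1)) then 0 else if g x < g (.v (T 2)) then 1 else 2,
      { hg with mono := ?_, labT := ?_, labd := ?_, labr := ?_ }⟩
    · intro x y hxy
      split at hxy <;> split at hxy <;> (try split at hxy) <;> (try split at hxy) <;> omega
    · intro i
      fin_cases i <;> simp <;> omega
    · intro d
      simp only [sd]
    · intro x
      split <;> (try split) <;> omega
  · obtain ⟨k, hk, k1, k2⟩ := hg.neg.rot (fun x => ¬ g x < g (.v (T 2)))
      (fun x y h1 h2 => by omega) (fun d => by rw [sd])
    refine ⟨k, fun x => if g x < g (.v (T 2)) then 0 else if g x < g (.v (T 1)) then 2 else 1,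
      { hk with mono := ?_, labT := ?_, labd := ?_, labr := ?_ }⟩
    · intro x y hxy
      by_cases a : g x < g (.v (T 2)) <;> by_cases b : g y < g (.v (T 2))
      · simp [a, b] at hxy
      · exact k2 _ _ (by simpa using a) b
      · simp only [a, b, if_true, if_false] at hxy
        split at hxy <;> omega
      · rw [k1 _ _ (by simp [a, b])]
        simp only [a, b, if_false] at hxy
        split at hxy <;> split at hxy <;> omega
    · intro i
      fin_cases i <;> simp <;> omega
    · intro d
      simp only [sd]
    · intro x
      split <;> (try split) <;> omega

end norm
end BK

namespace BK
open Set

/-! ### from a drawing to one side -/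

def stubI (b : Bool) : Set ℝ := if b then Icc (2 / 3) 1 else Icc 0 (1 / 3)

def endt (b : Bool) : ℝ := if b then 1 else 0

lemma stubI_sub (b : Bool) : stubI b ⊆ Icc 0 1 := by
  cases b <;> intro x hx <;> simp only [stubI, if_true, if_false, Bool.false_eq_true, mem_Icc] at * <;>
    constructor <;> linarith

lemma endt_mem (b : Bool) : endt b ∈ Icc (0 : ℝ) 1 := by cases b <;> simp [endt]

lemma endt_stub (b : Bool) : endt b ∈ stubI b := by
  cases b <;> simp [endt, stubI] <;> norm_num

lemma endt_not_stub (b : Bool) : endt (!b) ∉ stubI b := by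
  cases b <;> simp [endt, stubI] <;> norm_num

section top
variable {V E : Type} (own : E × Bool → V) (p : V → ℝ × ℝ) (γ : E → ℝ → ℝ × ℝ)

structure Drawn : Prop where
  own_fl : ∀ d, own (fl d) ≠ own d
  pinj : Function.Injective p
  gc : ∀ e, Continuous (γ e)
  gi : ∀ e, InjOn (γ e) (Icc 0 1)
  ge : ∀ d : E × Bool, γ d.1 (endt d.2) = p (own d)
  gx : ∀ e e', e ≠ e' → ∀ s ∈ Icc (0 : ℝ) 1, ∀ t ∈ Icc (0 : ℝ) 1, γ e s = γ e' t → ∃ a, γ e s = p a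
  gv : ∀ e, ∀ s ∈ Icc (0 : ℝ) 1, ∀ a, γ e s = p a → ∃ b, a = own (e, b)

variable {own p γ}

lemma Drawn.stub_pt (h : Drawn own p γ) (d : E × Bool) {s : ℝ} (hs : s ∈ stubI d.2) {a : V}
    (e : γ d.1 s = p a) : a = own d := by
  obtain ⟨b, hb⟩ := h.gv d.1 s (stubI_sub _ hs) a e
  by_cases hbd : b = d.2
  · rw [hb, hbd]
  · exfalso
    have hb' : b = !d.2 := by cases b <;> cases hd : d.2 <;> simp_all
    have e2 := h.ge (d.1, b)
    rw [← hb, ← e] at e2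
    have := h.gi d.1 (endt_mem b) (stubI_sub _ hs) e2
    rw [← this, hb'] at hs
    exact endt_not_stub _ hs

lemma Drawn.mid_pt (h : Drawn own p γ) (e : E) {s : ℝ} (hs : s ∈ Icc (1 / 3 : ℝ) (2 / 3)) (a : V) :
    γ e s ≠ p a := by
  intro k
  have hs' : s ∈ Icc (0 : ℝ) 1 := ⟨by linarith [hs.1], by linarith [hs.2]⟩
  obtain ⟨b, hb⟩ := h.gv e s hs' a k
  have e2 := h.ge (e, b)
  rw [← hb, ← k] at e2
  have := h.gi e (endt_mem b) hs' e2
  rw [← this] at hs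
  cases b <;> simp [endt] at hs <;> norm_num at hs

variable (own p γ)

def starSet (v : V) : Set (ℝ × ℝ) :=
  {p v} ∪ ⋃ d : {d : E × Bool // own d = v}, γ d.1.1 '' stubI d.1.2

def midSet (e : E) : Set (ℝ × ℝ) := γ e '' Icc (1 / 3) (2 / 3)

variable {own p γ}

lemma Drawn.star_disj (h : Drawn own p γ) {v w : V} (hvw : v ≠ w) :
    Disjoint (starSet own p γ v) (starSet own p γ w) := by
  rw [Set.disjoint_left]
  rintro q (hq | hq) (hq' | hq')
  · rw [mem_singleton_iff] at hq hq'
    exact hvw (h.pinj (hq.symm.trans hq'))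
  · rw [mem_singleton_iff] at hq
    simp only [mem_iUnion] at hq'
    obtain ⟨⟨d, hd⟩, s, hs, rfl⟩ := hq'
    exact hvw ((h.stub_pt d hs hq).trans hd)
  · rw [mem_singleton_iff] at hq'
    simp only [mem_iUnion] at hq
    obtain ⟨⟨d, hd⟩, s, hs, rfl⟩ := hq
    exact hvw ((h.stub_pt d hs hq').trans hd).symm
  · simp only [mem_iUnion] at hq hq'
    obtain ⟨⟨d, hd⟩, s, hs, rfl⟩ := hq
    obtain ⟨⟨d', hd'⟩, s', hs', e⟩ := hq'
    simp only at hs hs' e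
    by_cases hdd : d.1 = d'.1
    · rw [hdd] at e
      have hs2 := h.gi d'.1 (stubI_sub _ hs') (stubI_sub _ hs) e
      subst hs2
      have : d.2 = d'.2 := by
        by_contra hc
        cases h1 : d.2 <;> cases h2 : d'.2 <;> rw [h1, h2] at hc <;> simp at hc <;>
          rw [h1] at hs <;> rw [h2] at hs' <;> simp [stubI] at hs hs' <;> linarith [hs.1, hs'.1, hs.2, hs'.2]
      exact hvw (by rw [← hd, ← hd', Prod.ext hdd this])
    · obtain ⟨a, ha⟩ := h.gx _ _ hdd s (stubI_sub _ hs) s' (stubI_sub _ hs') e.symm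
      have h1 := h.stub_pt d hs ha
      have h2 := h.stub_pt d' hs' (e.trans ha)
      exact hvw (by rw [← hd, ← hd', ← h1, ← h2])

lemma icc_mid : Icc (1 / 3 : ℝ) (2 / 3) ⊆ Icc 0 1 := Icc_subset_Icc (by norm_num) (by norm_num)

lemma Drawn.mid_disj (h : Drawn own p γ) {e f : E} (hef : e ≠ f) :
    Disjoint (midSet γ e) (midSet γ f) := by
  rw [Set.disjoint_left]
  rintro q ⟨s, hs, rfl⟩ ⟨t, ht, k⟩
  obtain ⟨a, ha⟩ := h.gx _ _ hef s (icc_mid hs) t (icc_mid ht) k.symm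
  exact h.mid_pt e hs a ha

lemma Drawn.mid_star (h : Drawn own p γ) {e : E} {v : V} (hev : ∀ b, own (e, b) ≠ v) :
    Disjoint (midSet γ e) (starSet own p γ v) := by
  rw [Set.disjoint_left]
  rintro q ⟨s, hs, rfl⟩ (hq | hq)
  · exact h.mid_pt e hs v hq
  · simp only [mem_iUnion] at hq
    obtain ⟨⟨d, hd⟩, t, ht, k⟩ := hq
    simp only at ht k
    by_cases he : e = d.1
    · exact hev d.2 (by rw [he]; exact hd)
    · obtain ⟨a, ha⟩ := h.gx _ _ he s (icc_mid hs) t (stubI_sub _ ht) k.symm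
      exact h.mid_pt e hs a ha

lemma stubI_compact (b : Bool) : IsCompact (stubI b) := by
  cases b <;> simp [stubI] <;> exact isCompact_Icc

lemma stubI_conn (b : Bool) : IsPreconnected (stubI b) := by
  cases b <;> simp [stubI] <;> exact isPreconnected_Icc

lemma Drawn.star_compact [Finite E] (h : Drawn own p γ) (v : V) : IsCompact (starSet own p γ v) := by
  refine isCompact_singleton.union (isCompact_iUnion fun d => ?_)
  exact (stubI_compact _).image (h.gc _)

lemma Drawn.star_conn (h : Drawn own p γ) (v : V) : IsPreconnected (starSet own p γ v) := by
  have : starSet own p γ v = ⋃ d : Option {d : E × Bool // own d = v},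
      (match d with | none => {p v} | some d => γ d.1.1 '' stubI d.1.2) := by
    ext q
    simp [starSet, mem_iUnion, Option.exists]
  rw [this]
  refine isPreconnected_iUnion ⟨p v, ?_⟩ ?_
  · rw [mem_iInter]
    rintro (_ | ⟨d, hd⟩)
    · rfl
    · exact ⟨endt d.2, endt_stub _, by rw [h.ge, hd]⟩
  · rintro (_ | ⟨d, hd⟩)
    · exact isPreconnected_singleton
    · exact (stubI_conn _).image _ (h.gc _).continuousOn

lemma Drawn.mid_compact (h : Drawn own p γ) (e : E) : IsCompact (midSet γ e) :=
  isCompact_Icc.image (h.gc _)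

lemma Drawn.mid_conn (h : Drawn own p γ) (e : E) : IsPreconnected (midSet γ e) :=
  isPreconnected_Icc.image _ (h.gc _).continuousOn

lemma Drawn.meet (h : Drawn own p γ) (d : E × Bool) :
    (midSet γ d.1 ∩ starSet own p γ (own d)).Nonempty := by
  refine ⟨γ d.1 (if d.2 then 2 / 3 else 1 / 3), ⟨_, ?_, rfl⟩, Or.inr ?_⟩
  · cases d.2 <;> simp <;> norm_num
  · rw [mem_iUnion]
    refine ⟨⟨d, rfl⟩, _, ?_, rfl⟩
    cases hd : d.2 <;> simp [stubI] <;> norm_num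

end top
end BK

namespace BK
open Set

section top2
variable {V E : Type} {own : E × Bool → V} {p : V → ℝ × ℝ} {γ : E → ℝ → ℝ × ℝ}

def xown (own : E × Bool → V) (T : Fin 3 → V) : (E ⊕ Fin 3) × Bool → Option V
  | (.inl e, b) => some (own (e, b))
  | (.inr i, b) => if b then some (T i) else none

def emb : Itm V (E × Bool) → Itm (Option V) ((E ⊕ Fin 3) × Bool)
  | .v v => .v (some v)
  | .d d => .d (.inl d.1, d.2)

lemma emb_inj : Function.Injective (emb : Itm V (E × Bool) → _) := by
  rintro (x | ⟨x, a⟩) (y | ⟨y, b⟩) h <;> simp_all [emb]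

/-- the combinatorial part -/
lemma book_pre (T : Fin 3 → V) (f : Itm (Option V) ((E ⊕ Fin 3) × Bool) → ℕ)
    (hf : IsBook (xown own T) f) (h0 : f (.v none) = 0)
    (hT : ∀ i, f (.v (some (T i))) = f (.d (.inr i, false)) + 1) :
    Pre own T (fun x => (f (emb x) : ℤ)) ∧
      ∀ d, (f (emb (.v (own d)) : Itm (Option V) ((E ⊕ Fin 3) × Bool)) : ℤ) < f (emb (.d d)) := by
  have lt : ∀ d : E × Bool, f (.v (some (own d))) < f (.d (.inl d.1, d.2)) := by
    intro d
    exact hf.lt (.inl d.1, d.2)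
  have str : ∀ i (e : E × Bool), ¬ (f (.v (some (own e))) < f (.v (some (T i))) ∧
      f (.v (some (T i))) < f (.d (.inl e.1, e.2))) := by
    rintro i e ⟨h1, h2⟩
    have hn := hf.near (.inr i, false) (.inl e.1, e.2)
    have hti := hT i
    have := fun k => @hf.inj (.v (some (own e))) (.d (.inr i, false)) k
    simp only [reduceCtorEq, imp_false] at this
    have hn := hn (by show f (.v (some (own e))) < _; omega) (by omega)
    rcases hn with hn | hn
    · simp [xown] at hn
    · have : f (.v (xown own T (.inr i, false))) = 0 := h0
      omega
  have near : ∀ c e : E × Bool, f (.v (some (own e))) < f (.d (.inl c.1, c.2)) →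
      f (.d (.inl c.1, c.2)) < f (.d (.inl e.1, e.2)) →
      own c = own e ∨ f (.v (some (own e))) < f (.v (some (own c))) := by
    intro c e h1 h2
    rcases hf.near (.inl c.1, c.2) (.inl e.1, e.2) h1 h2 with h | h
    · left; simpa [xown] using h
    · right; exact h
  refine ⟨⟨?_, ?_, ?_, ?_, ?_⟩, ?_⟩
  · intro x y h
    have h' : (f (emb x) : ℤ) = f (emb y) := h
    exact emb_inj (hf.inj (by exact_mod_cast h'))
  · intro c e h1 _ _
    have a1 := lt c
    have a2 := lt e
    have b1 := near c e
    have b2 := near e c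
    simp only [h1, Ne.symm h1, false_or] at b1 b2
    simp only [emb, IL]
    omega
  · rintro c e ⟨i, hi⟩ hne
    have a1 := lt c
    have a2 := lt e
    have b1 := near c e
    have b2 := str i e
    simp only [emb, BT]
    rw [← hi] at *
    have : own e ≠ T i := fun k => hne ⟨i, k.symm⟩
    simp only [this.symm, false_or] at b1
    omega
  · intro c e h1
    have h1' : (Sum.inl c.1 : E ⊕ Fin 3) ≠ Sum.inl e.1 := by simpa using h1
    have q : ∀ a b : Bool, _ := fun a b => hf.far (.inl c.1, a) (.inl e.1, b) h1'
    have q' : ∀ a b : Bool, _ := fun a b => hf.far (.inl e.1, b) (.inl c.1, a) h1'.symm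
    simp only [fl] at q q'
    have k1 := q c.2 e.2
    have k2 := q (!c.2) e.2
    have k3 := q c.2 (!e.2)
    have k4 := q (!c.2) (!e.2)
    have l1 := q' c.2 e.2
    have l2 := q' (!c.2) e.2
    have l3 := q' c.2 (!e.2)
    have l4 := q' (!c.2) (!e.2)
    simp only [Bool.not_not] at k1 k2 k3 k4 l1 l2 l3 l4
    simp only [emb, IL, fl]
    omega
  · intro i e
    have a2 := lt e
    have b2 := str i e
    simp only [emb, BT]
    omega
  · intro d
    exact_mod_cast lt d

theorem top_side [Finite V] [Finite E] (h : Drawn own p γ) (T : Fin 3 → V)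
    (Tinj : Function.Injective T) (U : Set (ℝ × ℝ)) (Uo : IsOpen U) (Uc : IsConnected U)
    (Up : ∀ v, p v ∉ U) (Ug : ∀ e, ∀ s ∈ Icc (0 : ℝ) 1, γ e s ∉ U)
    (Ucl : ∀ i, p (T i) ∈ closure U) : ∃ g lab, IsSide own T g lab := by
  classical
  have US : ∀ v, Disjoint U (starSet own p γ v) := by
    intro v
    rw [disjoint_right]
    rintro q (hq | hq)
    · rw [mem_singleton_iff] at hq; rw [hq]; exact Up v
    · simp only [mem_iUnion] at hq
      obtain ⟨⟨d, hd⟩, t, ht, k⟩ := hq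
      rw [← k]
      exact Ug _ _ (stubI_sub _ ht)
  have UM : ∀ e, Disjoint U (midSet γ e) := by
    intro e
    rw [disjoint_right]
    rintro q ⟨s, hs, rfl⟩
    exact Ug _ _ (icc_mid hs)
  -- balls
  obtain ⟨O, hO1, hO2⟩ := (Set.finite_range (fun i => p (T i))).t2_separation
  have pself : ∀ v, p v ∈ starSet own p γ v := fun v => Or.inl rfl
  have hball : ∀ i, ∃ r > 0, Metric.ball (p (T i)) r ⊆ O (p (T i)) ∩
      ((⋃ v : {v // v ≠ T i}, starSet own p γ v)ᶜ ∩ (⋃ e, midSet γ e)ᶜ) := by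
    intro i
    apply Metric.isOpen_iff.mp
    · refine (hO1 _).2.inter (IsOpen.inter ?_ ?_)
      · exact (isCompact_iUnion fun v : {v // v ≠ T i} => h.star_compact v.1).isClosed.isOpen_compl
      · exact (isCompact_iUnion fun e => h.mid_compact e).isClosed.isOpen_compl
    · refine ⟨(hO1 _).1, ?_, ?_⟩
      · rw [mem_compl_iff, mem_iUnion]
        rintro ⟨⟨v, hv⟩, hm⟩
        exact disjoint_left.mp (h.star_disj hv) hm (pself _)
      · rw [mem_compl_iff, mem_iUnion]
        rintro ⟨e, s, hs, hm⟩
        exact h.mid_pt e hs _ hm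
  choose r hr0 hr using hball
  have hq : ∀ i, ∃ q ∈ U, q ∈ Metric.ball (p (T i)) (r i) := by
    intro i
    obtain ⟨q, hq, hd⟩ := Metric.mem_closure_iff.mp (Ucl i) (r i) (hr0 i)
    exact ⟨q, hq, by rw [Metric.mem_ball, dist_comm]; exact hd⟩
  choose q qU qB using hq
  have hpc : IsPathConnected U := Uo.isConnected_iff_isPathConnected.mp Uc
  choose w hw using fun i => hpc.joinedIn (q 0) (qU 0) (q i) (qU i)
  have segB : ∀ i, segment ℝ (q i) (p (T i)) ⊆ Metric.ball (p (T i)) (r i) := fun i =>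
    (convex_ball _ _).segment_subset (qB i) (Metric.mem_ball_self (hr0 i))
  let S : Option V → Set (ℝ × ℝ) := fun v => v.elim (⋃ i, range (w i)) (starSet own p γ)
  let M : E ⊕ Fin 3 → Set (ℝ × ℝ) := Sum.elim (midSet γ) (fun i => segment ℝ (q i) (p (T i)))
  have WU : (⋃ i, range (w i)) ⊆ U := by
    intro z hz
    rw [mem_iUnion] at hz
    obtain ⟨i, t, rfl⟩ := hz
    exact hw i t
  have ofl : ∀ d, xown own T (fl d) ≠ xown own T d := by
    rintro ⟨e | i, b⟩
    · intro k
      simp only [xown, fl, Option.some.injEq] at k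
      exact h.own_fl (e, b) k
    · cases b <;> simp [xown]
  obtain ⟨pd, rk, cmp, F1, F2, F3, F4, F5⟩ := forest (xown own T) none
  obtain ⟨f, f1, f2, f3⟩ := topo_book (xown own T) ofl S M
    (by
      rintro (_ | v)
      · exact isCompact_iUnion fun i => isCompact_range (w i).continuous
      · exact h.star_compact v)
    (by
      rintro (_ | v)
      · refine isPreconnected_iUnion ⟨q 0, mem_iInter.mpr fun i => ⟨0, (w i).source⟩⟩ fun i => ?_
        exact isPreconnected_range (w i).continuous
      · exact h.star_conn v)
    (by
      rintro (_ | v)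
      · exact ⟨q 0, mem_iUnion.mpr ⟨0, 0, (w 0).source⟩⟩
      · exact ⟨_, pself v⟩)
    (by
      rintro (_ | v) (_ | w) hvw
      · exact absurd rfl hvw
      · exact (US w).mono_left WU
      · exact ((US v).mono_left WU).symm
      · exact h.star_disj (fun k => hvw (by rw [k])))
    (by
      rintro (e | i)
      · exact h.mid_compact e
      · show IsCompact (segment ℝ _ _)
        rw [segment_eq_image_lineMap]
        exact isCompact_Icc.image AffineMap.lineMap_continuous)
    (by
      rintro (e | i)
      · exact h.mid_conn e
      · exact (convex_segment _ _).isPreconnected)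
    (by
      have k : ∀ e i, Disjoint (midSet γ e) (segment ℝ (q i) (p (T i))) := by
        intro e i
        rw [disjoint_right]
        intro z hz hz'
        exact (hr i (segB i hz)).2.2 (mem_iUnion.mpr ⟨e, hz'⟩)
      rintro (e | i) (f | j) hef
      · exact h.mid_disj (fun k => hef (by rw [k]))
      · exact k e j
      · exact (k f i).symm
      · have hij : i ≠ j := fun k => hef (by rw [k])
        have := hO2 ⟨i, rfl⟩ ⟨j, rfl⟩ (fun k => hij (Tinj (h.pinj k)))
        exact this.mono (fun z hz => (hr i (segB i hz)).1) (fun z hz => (hr j (segB j hz)).1))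
    (by
      rintro (e | i) (_ | v) hev
      · exact ((UM e).mono_left WU).symm
      · exact h.mid_star (fun b k => hev b (by simp [xown, k]))
      · exact absurd (show xown own T (Sum.inr i, false) = none by simp [xown]) (hev false)
      · have hv : v ≠ T i := fun k => hev true (by simp [xown, k])
        rw [disjoint_left]
        intro z hz hz'
        exact (hr i (segB i hz)).2.1 (mem_iUnion.mpr ⟨⟨v, hv⟩, hz'⟩))
    (by
      rintro ⟨e | i, b⟩
      · exact h.meet (e, b)
      · cases b
        · exact ⟨q i, left_mem_segment _ _ _, mem_iUnion.mpr ⟨i, 1, (w i).target⟩⟩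
        · exact ⟨p (T i), right_mem_segment _ _ _, pself _⟩)
    pd rk cmp F1 F2 F3 none F4
  obtain ⟨P1, P2⟩ := book_pre T f f1 f2 (by
    intro i
    obtain ⟨d', k1, k2⟩ := F5 (.inr i, false) (by simp [xown]) (by simp [xown])
    have o1 := (F1 _ _ k1).1
    have hd : d' = (Sum.inr i, true) := by
      rcases d' with ⟨e | j, b⟩
      · simp [xown] at k2
      · cases b
        · simp [xown] at k2
        · simp [xown] at o1
          rw [Tinj o1]
    have := (f3 _ _ k1).1
    rw [hd] at this
    simpa [xown, fl] using this)
  exact P1.norm Tinj P2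

end top2
end BK

namespace BK
open Set

section sidefin
variable {V E : Type} {own : E × Bool → V} {p : V → ℝ × ℝ} {γ : E → ℝ → ℝ × ℝ}

def itmIn (A : Set V) (es : Set E) : Itm V (E × Bool) → Prop
  | .v v => v ∈ A
  | .d d => d.1 ∈ es

variable (own)
structure SideOn (T : Fin 3 → V) (A : Set V) (es : Set E)
    (g lab : Itm V (E × Bool) → ℤ) : Prop where
  inj : ∀ x y, itmIn A es x → itmIn A es y → g x = g y → x = y
  near : ∀ c e : E × Bool, c.1 ∈ es → e.1 ∈ es → own c ≠ own e → own c ∉ Set.range T →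
    own e ∉ Set.range T → ¬ IL (g (.v (own c))) (g (.d c)) (g (.v (own e))) (g (.d e))
  nearT : ∀ c e : E × Bool, c.1 ∈ es → e.1 ∈ es → own c ∈ Set.range T → own e ∉ Set.range T →
    ¬ BT (g (.v (own e))) (g (.d e)) (g (.d c))
  far : ∀ c e : E × Bool, c.1 ∈ es → e.1 ∈ es → c.1 ≠ e.1 →
    ¬ IL (g (.d c)) (g (.d (fl c))) (g (.d e)) (g (.d (fl e)))
  mono : ∀ x y, itmIn A es x → itmIn A es y → lab x < lab y → g x < g y
  labT : ∀ i, lab (.v (T i)) = (i : ℕ)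
  labd : ∀ d : E × Bool, d.1 ∈ es → lab (.d d) = lab (.v (own d))
  labr : ∀ x, 0 ≤ lab x ∧ lab x ≤ 2
variable {own}

open Classical in
noncomputable def exti (A : Set V) (es : Set E) (g : Itm {v // v ∈ A} ({e // e ∈ es} × Bool) → ℤ) :
    Itm V (E × Bool) → ℤ
  | .v v => if h : v ∈ A then g (.v ⟨v, h⟩) else 0
  | .d d => if h : d.1 ∈ es then g (.d (⟨d.1, h⟩, d.2)) else 0

/-- the set occupied by a drawn system -/
def occ (p : V → ℝ × ℝ) (γ : E → ℝ → ℝ × ℝ) : Set (ℝ × ℝ) :=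
  (⋃ e, γ e '' Icc 0 1) ∪ range p

theorem side_fin (h : Drawn own p γ) (T : Fin 3 → V) (Tinj : Function.Injective T)
    (x0 : ℝ × ℝ) (hx0 : x0 ∉ occ p γ)
    (hcl : ∀ i, p (T i) ∈ closure (connectedComponentIn (occ p γ)ᶜ x0))
    (A : Set V) (es : Set E) (hA : A.Finite) (hes : es.Finite) (hT : ∀ i, T i ∈ A)
    (hown : ∀ d : E × Bool, d.1 ∈ es → own d ∈ A) : ∃ g lab, SideOn own T A es g lab := by
  have := hA.to_subtype
  have := hes.to_subtype
  let own' : {e // e ∈ es} × Bool → {v // v ∈ A} := fun d => ⟨own (d.1.1, d.2), hown _ d.1.2⟩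
  let p' : {v // v ∈ A} → ℝ × ℝ := fun v => p v.1
  let γ' : {e // e ∈ es} → ℝ → ℝ × ℝ := fun e => γ e.1
  have h' : Drawn own' p' γ' :=
    { own_fl := fun d k => h.own_fl (d.1.1, d.2) (congrArg Subtype.val k)
      pinj := fun a b k => Subtype.ext (h.pinj k)
      gc := fun e => h.gc e.1
      gi := fun e => h.gi e.1
      ge := fun d => h.ge (d.1.1, d.2)
      gx := fun e e' hne s hs t ht k => by
        obtain ⟨a, ha⟩ := h.gx e.1 e'.1 (fun k => hne (Subtype.ext k)) s hs t ht k
        obtain ⟨b, hb⟩ := h.gv e.1 s hs a ha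
        exact ⟨⟨a, hb ▸ hown _ e.2⟩, ha⟩
      gv := fun e s hs a k => by
        obtain ⟨b, hb⟩ := h.gv e.1 s hs a.1 k
        exact ⟨b, Subtype.ext hb⟩ }
  have hsub : occ p' γ' ⊆ occ p γ := by
    rintro q (hq | ⟨v, rfl⟩)
    · rw [mem_iUnion] at hq
      obtain ⟨e, hq⟩ := hq
      exact Or.inl (mem_iUnion.mpr ⟨e.1, hq⟩)
    · exact Or.inr ⟨v.1, rfl⟩
  have hco : IsClosed (occ p' γ') := by
    refine IsClosed.union ?_ (Set.finite_range _).isClosed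
    exact (isCompact_iUnion fun e => isCompact_Icc.image (h'.gc e)).isClosed
  have hx' : x0 ∈ (occ p' γ')ᶜ := fun k => hx0 (hsub k)
  have UK : connectedComponentIn (occ p' γ')ᶜ x0 ⊆ (occ p' γ')ᶜ := connectedComponentIn_subset _ _
  obtain ⟨g, lab, H⟩ := top_side h' (fun i => ⟨T i, hT i⟩)
    (fun i j k => Tinj (congrArg Subtype.val k))
    (connectedComponentIn (occ p' γ')ᶜ x0) hco.isOpen_compl.connectedComponentIn
    (isConnected_connectedComponentIn_iff.mpr hx')
    (fun v k => UK k (Or.inr ⟨v, rfl⟩))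
    (fun e s hs k => UK k (Or.inl (mem_iUnion.mpr ⟨e, s, hs, rfl⟩)))
    (fun i => closure_mono (connectedComponentIn_mono _ (compl_subset_compl.mpr hsub)) (hcl i))
  have ev : ∀ (f : Itm {v // v ∈ A} ({e // e ∈ es} × Bool) → ℤ) (v) (hv : v ∈ A),
      exti A es f (.v v) = f (.v ⟨v, hv⟩) := fun f v hv => dif_pos hv
  have ed : ∀ (f : Itm {v // v ∈ A} ({e // e ∈ es} × Bool) → ℤ) (d : E × Bool) (hd : d.1 ∈ es),
      exti A es f (.d d) = f (.d (⟨d.1, hd⟩, d.2)) := fun f d hd => dif_pos hd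
  have hr : ∀ v, (hv : v ∈ A) → (v ∈ range T ↔
      (⟨v, hv⟩ : {v // v ∈ A}) ∈ range (fun i => (⟨T i, hT i⟩ : {v // v ∈ A}))) := by
    intro v hv
    simp [mem_range, Subtype.ext_iff]
  refine ⟨exti A es g, exti A es lab, ?_, ?_, ?_, ?_, ?_, ?_, ?_, ?_⟩
  · rintro (x | x) (y | y) hx hy k
    · rw [ev _ _ hx, ev _ _ hy] at k
      have := H.inj k
      rw [Itm.v.injEq] at this
      rw [show x = y from congrArg Subtype.val this]
    · rw [ev _ _ hx, ed _ _ hy] at k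
      simpa using H.inj k
    · rw [ed _ _ hx, ev _ _ hy] at k
      simpa using H.inj k
    · rw [ed _ _ hx, ed _ _ hy] at k
      have := H.inj k
      simp only [Itm.d.injEq, Prod.mk.injEq] at this
      rw [Prod.ext (congrArg Subtype.val this.1) this.2]
  · intro c e hc he h1 h2 h3
    rw [ev _ _ (hown c hc), ev _ _ (hown e he), ed _ _ hc, ed _ _ he]
    refine H.near (⟨c.1, hc⟩, c.2) (⟨e.1, he⟩, e.2) (fun k => h1 (congrArg Subtype.val k)) ?_ ?_
    · exact fun k => h2 ((hr _ (hown c hc)).mpr k)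
    · exact fun k => h3 ((hr _ (hown e he)).mpr k)
  · intro c e hc he h1 h2
    rw [ev _ _ (hown e he), ed _ _ hc, ed _ _ he]
    refine H.nearT (⟨c.1, hc⟩, c.2) (⟨e.1, he⟩, e.2) ?_ ?_
    · exact ((hr _ (hown c hc)).mp h1)
    · exact fun k => h2 ((hr _ (hown e he)).mpr k)
  · intro c e hc he h1
    rw [ed _ _ hc, ed _ _ he, ed _ (fl c) hc, ed _ (fl e) he]
    exact H.far (⟨c.1, hc⟩, c.2) (⟨e.1, he⟩, e.2) (fun k => h1 (congrArg Subtype.val k))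
  · rintro (x | x) (y | y) hx hy k
    · rw [ev _ _ hx, ev _ _ hy] at *; exact H.mono _ _ k
    · rw [ev _ _ hx, ed _ _ hy] at *; exact H.mono _ _ k
    · rw [ed _ _ hx, ev _ _ hy] at *; exact H.mono _ _ k
    · rw [ed _ _ hx, ed _ _ hy] at *; exact H.mono _ _ k
  · intro i
    rw [ev _ _ (hT i)]; exact H.labT i
  · intro d hd
    rw [ed _ _ hd, ev _ _ (hown d hd)]; exact H.labd (⟨d.1, hd⟩, d.2)
  · rintro (x | x)
    · by_cases hx : x ∈ A
      · rw [ev _ _ hx]; exact H.labr _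
      · simp [exti, hx]
    · by_cases hx : x.1 ∈ es
      · rw [ed _ _ hx]; exact H.labr _
      · simp [exti, hx]

end sidefin
end BK

namespace BK
open Set

lemma IL_iff {α : Type*} [LinearOrder α] (p q r s : α) : IL p q r s ↔
    (p < r ∧ r < q ∧ q < s) ∨ (p < s ∧ s < q ∧ q < r) ∨ (q < r ∧ r < p ∧ p < s) ∨
    (q < s ∧ s < p ∧ p < r) ∨ (r < p ∧ p < s ∧ s < q) ∨ (r < q ∧ q < s ∧ s < p) ∨
    (s < p ∧ p < r ∧ r < q) ∨ (s < q ∧ q < r ∧ r < p) := by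
  unfold IL
  rcases le_total p q with h | h <;> rcases le_total r s with h' | h' <;>
    simp only [min_eq_left, min_eq_right, max_eq_left, max_eq_right, h, h'] <;> grind

lemma IL_map {ι α β : Type*} [LinearOrder α] [LinearOrder β] (f : ι → α) (f' : ι → β)
    (X : ι → Prop) (h : ∀ x y, X x → X y → f' x < f' y → f x < f y) {a b c d : ι}
    (ha : X a) (hb : X b) (hc : X c) (hd : X d) (k : IL (f' a) (f' b) (f' c) (f' d)) :
    IL (f a) (f b) (f c) (f d) := by
  rw [IL_iff] at *
  rcases k with k | k | k | k | k | k | k | k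
  · exact Or.inl ⟨h _ _ ha hc k.1, h _ _ hc hb k.2.1, h _ _ hb hd k.2.2⟩
  · exact Or.inr (Or.inl ⟨h _ _ ha hd k.1, h _ _ hd hb k.2.1, h _ _ hb hc k.2.2⟩)
  · exact Or.inr (Or.inr (Or.inl ⟨h _ _ hb hc k.1, h _ _ hc ha k.2.1, h _ _ ha hd k.2.2⟩))
  · exact Or.inr (Or.inr (Or.inr (Or.inl ⟨h _ _ hb hd k.1, h _ _ hd ha k.2.1, h _ _ ha hc k.2.2⟩)))
  · exact Or.inr (Or.inr (Or.inr (Or.inr (Or.inl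
      ⟨h _ _ hc ha k.1, h _ _ ha hd k.2.1, h _ _ hd hb k.2.2⟩))))
  · exact Or.inr (Or.inr (Or.inr (Or.inr (Or.inr (Or.inl
      ⟨h _ _ hc hb k.1, h _ _ hb hd k.2.1, h _ _ hd ha k.2.2⟩)))))
  · exact Or.inr (Or.inr (Or.inr (Or.inr (Or.inr (Or.inr (Or.inl
      ⟨h _ _ hd ha k.1, h _ _ ha hc k.2.1, h _ _ hc hb k.2.2⟩))))))
  · exact Or.inr (Or.inr (Or.inr (Or.inr (Or.inr (Or.inr (Or.inr
      ⟨h _ _ hd hb k.1, h _ _ hb hc k.2.1, h _ _ hc ha k.2.2⟩))))))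

/-- a two page book with every edge subdivided twice -/
structure Book2 {V E : Type} {α : Type*} [LinearOrder α] (own : E × Bool → V) (side : E → Bool)
    (A : Set V) (es : Set E) (f : Itm V (E × Bool) → α) : Prop where
  inj : ∀ x y, itmIn A es x → itmIn A es y → f x = f y → x = y
  nn : ∀ c e : E × Bool, c.1 ∈ es → e.1 ∈ es → side c.1 = side e.1 → own c ≠ own e →
    ¬ IL (f (.v (own c))) (f (.d c)) (f (.v (own e))) (f (.d e))
  ff : ∀ c e : E × Bool, c.1 ∈ es → e.1 ∈ es → side c.1 = side e.1 → c.1 ≠ e.1 →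
    ¬ IL (f (.d c)) (f (.d (fl c))) (f (.d e)) (f (.d (fl e)))
  nf : ∀ c e : E × Bool, c.1 ∈ es → e.1 ∈ es → side c.1 ≠ side e.1 →
    ¬ IL (f (.v (own c))) (f (.d c)) (f (.d e)) (f (.d (fl e)))

section merge
variable {V : Type} {W E : Bool → Type} {own : ∀ b, E b × Bool → W b} {j : ∀ b, W b → V}
  {T : ∀ b, Fin 3 → W b}

def mown (own : ∀ b, E b × Bool → W b) (j : ∀ b, W b → V) : (Σ b, E b) × Bool → V :=
  fun d => j d.1.1 (own d.1.1 (d.1.2, d.2))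

lemma itm_finite {V E : Type} {A : Set V} {es : Set E} (hA : A.Finite) (he : es.Finite) :
    {x : Itm V (E × Bool) | itmIn A es x}.Finite := by
  have h1 := hA.image (fun v => (Itm.v v : Itm V (E × Bool)))
  have h2 := (he.prod (Set.finite_univ (α := Bool))).image
    (fun d => (Itm.d d : Itm V (E × Bool)))
  refine (h1.union h2).subset ?_
  rintro (v | d) h
  · exact Or.inl ⟨v, h, rfl⟩
  · exact Or.inr ⟨d, ⟨h, trivial⟩, rfl⟩

set_option maxHeartbeats 4000000 in
theorem merge (jinj : ∀ b, Function.Injective (j b)) (jT : ∀ i, j false (T false i) = j true (T true i))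
    (jj : ∀ v w, j false v = j true w → ∃ i, v = T false i)
    (jsurj : ∀ v, ∃ b w, j b w = v)
    (Tinj : ∀ b, Function.Injective (T b))
    (H : ∀ b (A : Set (W b)) (es : Set (E b)), A.Finite → es.Finite → (∀ i, T b i ∈ A) →
      (∀ d : E b × Bool, d.1 ∈ es → own b d ∈ A) → ∃ g lab, SideOn (own b) (T b) A es g lab)
    (A : Set V) (es : Set (Σ b, E b)) (hA : A.Finite) (hes : es.Finite) :
    ∃ f : Itm V ((Σ b, E b) × Bool) → ℤ, Book2 (mown own j) Sigma.fst A es f := by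
  classical
  let es' : ∀ b, Set (E b) := fun b => {e | (⟨b, e⟩ : Σ b, E b) ∈ es}
  have hes' : ∀ b, (es' b).Finite := fun b =>
    hes.preimage (fun x _ y _ h => by simpa using h)
  let A' : ∀ b, Set (W b) := fun b => (j b ⁻¹' A ∪ range (T b)) ∪
    (own b '' {d | d.1 ∈ es' b})
  have hA' : ∀ b, (A' b).Finite := by
    intro b
    refine ((hA.preimage (jinj b).injOn).union (finite_range _)).union ?_
    refine Set.Finite.image _ ?_
    exact ((hes' b).prod (Set.finite_univ (α := Bool))).subset (fun d hd => ⟨hd, trivial⟩)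
  have ownA : ∀ b (d : E b × Bool), d.1 ∈ es' b → own b d ∈ A' b :=
    fun b d hd => Or.inr ⟨d, hd, rfl⟩
  choose g lab G using fun b => H b (A' b) (es' b) (hA' b) (hes' b)
    (fun i => Or.inl (Or.inr ⟨i, rfl⟩)) (ownA b)
  obtain ⟨K, hK⟩ : ∃ K : ℤ, ∀ b x, itmIn (A' b) (es' b) x → -K ≤ g b x ∧ g b x ≤ K := by
    have : ∀ b, ∃ K : ℤ, ∀ x, itmIn (A' b) (es' b) x → |g b x| ≤ K := by
      intro b
      obtain ⟨K, hK⟩ := ((itm_finite (hA' b) (hes' b)).image (fun x => |g b x|)).bddAbove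
      exact ⟨K, fun x hx => hK ⟨x, hx, rfl⟩⟩
    choose K hK using this
    refine ⟨max (K false) (K true), fun b x hx => ?_⟩
    have := abs_le.mp (hK b x hx)
    cases b <;> omega
  set B : ℤ := 4 * |K| + 10 with hB
  have hBK : 4 * K + 10 ≤ B ∧ 10 ≤ B := by
    have := le_abs_self K; have := abs_nonneg K; omega
  let off : Bool → ℤ := fun b => if b then -1 - K else 1 + K
  let pos : ∀ b, Itm (W b) (E b × Bool) → ℤ := fun b x => lab b x * B + off b + g b x
  let hv : V → ℤ := fun v => if h : ∃ i, v = j false (T false i) then (h.choose : ℕ) * B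
    else pos (jsurj v).choose (.v (jsurj v).choose_spec.choose)
  let f : Itm V ((Σ b, E b) × Bool) → ℤ := fun x => match x with
    | .v v => hv v
    | .d d => pos d.1.1 (.d (d.1.2, d.2))
  have jTb : ∀ b i, j b (T b i) = j false (T false i) := by
    intro b i; cases b
    · rfl
    · exact (jT i).symm
  have hvT : ∀ b i, hv (j b (T b i)) = (i : ℕ) * B := by
    intro b i
    have h : ∃ i', j b (T b i) = j false (T false i') := ⟨i, jTb b i⟩
    have e : hv (j b (T b i)) = (h.choose : ℕ) * B := dif_pos h
    have : h.choose = i := by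
      have := (jTb b i).symm.trans h.choose_spec
      exact (Tinj _ (jinj _ this)).symm
    rw [e, this]
  have hvN : ∀ b w, w ∉ range (T b) → hv (j b w) = pos b (.v w) := by
    intro b w hw
    have hn : ¬ ∃ i, j b w = j false (T false i) := by
      rintro ⟨i, hi⟩
      rw [← jTb b] at hi
      exact hw ⟨i, (jinj b hi).symm⟩
    have e : hv (j b w) = pos (jsurj (j b w)).choose (.v (jsurj (j b w)).choose_spec.choose) :=
      dif_neg hn
    rw [e]
    have k := (jsurj (j b w)).choose_spec.choose_spec
    generalize (jsurj (j b w)).choose_spec.choose = w' at *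
    revert w' k
    generalize (jsurj (j b w)).choose = b'
    intro w' e k
    by_cases hb : b' = b
    · subst hb
      rw [jinj _ k]
    · exfalso
      cases b <;> cases b' <;> simp at hb
      · obtain ⟨i, hi⟩ := jj _ _ k.symm
        exact hw ⟨i, hi.symm⟩
      · obtain ⟨i, hi⟩ := jj _ _ k
        rw [hi, jT] at k
        exact hw ⟨i, jinj true k⟩
  have Z : ∀ l l' : ℤ, (l = l' ∧ l * B = l' * B) ∨ (l < l' ∧ l * B + B ≤ l' * B) ∨
      (l' < l ∧ l' * B + B ≤ l * B) := by
    intro l l'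
    rcases lt_trichotomy l l' with h | h | h
    · right; left; refine ⟨h, ?_⟩; nlinarith
    · left; exact ⟨h, by rw [h]⟩
    · right; right; refine ⟨h, ?_⟩; nlinarith
  have pm : ∀ b x y, itmIn (A' b) (es' b) x → itmIn (A' b) (es' b) y →
      pos b x < pos b y → g b x < g b y := by
    intro b x y hx hy hxy
    have k1 := hK b x hx
    have k2 := hK b y hy
    have m1 := (G b).mono x y hx hy
    have m2 := (G b).mono y x hy hx
    have z := Z (lab b x) (lab b y)
    simp only [pos] at hxy
    omega
  have pinj : ∀ b x y, itmIn (A' b) (es' b) x → itmIn (A' b) (es' b) y → pos b x = pos b y → x = y := by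
    intro b x y hx hy hxy
    refine (G b).inj x y hx hy ?_
    have k1 := hK b x hx
    have k2 := hK b y hy
    have m1 := (G b).mono x y hx hy
    have m2 := (G b).mono y x hy hx
    have z := Z (lab b x) (lab b y)
    simp only [pos] at hxy
    omega
  have pdiff : ∀ x y, itmIn (A' false) (es' false) x → itmIn (A' true) (es' true) y →
      pos false x ≠ pos true y := by
    intro x y hx hy
    have k1 := hK _ x hx
    have k2 := hK _ y hy
    have z := Z (lab _ x) (lab _ y)
    simp only [pos, off]
    simp only [if_true, Bool.false_eq_true, if_false]
    omega
  have pT : ∀ b (i : Fin 3) x, itmIn (A' b) (es' b) x → ((i : ℕ) : ℤ) * B ≠ pos b x := by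
    intro b i x hx
    have k1 := hK _ x hx
    have z := Z (lab _ x) (i : ℕ)
    simp only [pos, off]
    cases b <;> simp only [if_true, Bool.false_eq_true, if_false] <;> omega
  -- description of items
  have desc : ∀ x, itmIn A es x → (∃ i : Fin 3, x = .v (j false (T false i)) ∧ f x = (i : ℕ) * B) ∨
      (∃ b, ∃ w, w ∉ range (T b) ∧ x = .v (j b w) ∧ itmIn (A' b) (es' b) (.v w) ∧
        f x = pos b (.v w)) ∨
      (∃ b, ∃ d : E b × Bool, x = .d (⟨b, d.1⟩, d.2) ∧ itmIn (A' b) (es' b) (.d d) ∧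
        f x = pos b (.d d)) := by
    rintro (v | ⟨⟨b, e⟩, s⟩) hx
    · obtain ⟨b, w, rfl⟩ := jsurj v
      by_cases hw : w ∈ range (T b)
      · obtain ⟨i, rfl⟩ := hw
        left
        exact ⟨i, by rw [jTb], hvT b i⟩
      · right; left
        exact ⟨b, w, hw, rfl, Or.inl (Or.inl hx), hvN b w hw⟩
    · right; right
      exact ⟨b, (e, s), rfl, hx, rfl⟩
  have finj : ∀ x y, itmIn A es x → itmIn A es y → f x = f y → x = y := by
    intro x y hx hy hxy
    rcases desc x hx with ⟨i, e1, e2⟩ | ⟨b, w, hw, e1, hi, e2⟩ | ⟨b, d, e1, hi, e2⟩ <;>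
    rcases desc y hy with ⟨i', e1', e2'⟩ | ⟨b', w', hw', e1', hi', e2'⟩ | ⟨b', d', e1', hi', e2'⟩ <;>
    rw [e2, e2'] at hxy
    · have : (i : ℕ) = i' := by have := Z (i : ℕ) (i' : ℕ); omega
      rw [e1, e1', Fin.ext this]
    · exact absurd hxy (pT _ _ _ hi')
    · exact absurd hxy (pT _ _ _ hi')
    · exact absurd hxy.symm (pT _ _ _ hi)
    · cases b <;> cases b'
      · have := pinj _ _ _ hi hi' hxy
        rw [Itm.v.injEq] at this; rw [e1, e1', this]
      · exact absurd hxy (pdiff _ _ hi hi')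
      · exact absurd hxy.symm (pdiff _ _ hi' hi)
      · have := pinj _ _ _ hi hi' hxy
        rw [Itm.v.injEq] at this; rw [e1, e1', this]
    · cases b <;> cases b'
      · have := pinj _ _ _ hi hi' hxy
        cases this
      · exact absurd hxy (pdiff _ _ hi hi')
      · exact absurd hxy.symm (pdiff _ _ hi' hi)
      · have := pinj _ _ _ hi hi' hxy
        cases this
    · exact absurd hxy.symm (pT _ _ _ hi)
    · cases b <;> cases b'
      · have := pinj _ _ _ hi hi' hxy
        cases this
      · exact absurd hxy (pdiff _ _ hi hi')
      · exact absurd hxy.symm (pdiff _ _ hi' hi)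
      · have := pinj _ _ _ hi hi' hxy
        cases this
    · cases b <;> cases b'
      · have := pinj _ _ _ hi hi' hxy
        rw [Itm.d.injEq] at this; rw [e1, e1', this]
      · exact absurd hxy (pdiff _ _ hi hi')
      · exact absurd hxy.symm (pdiff _ _ hi' hi)
      · have := pinj _ _ _ hi hi' hxy
        rw [Itm.d.injEq] at this; rw [e1, e1', this]
  have inO : ∀ b (d : E b × Bool), d.1 ∈ es' b → itmIn (A' b) (es' b) (.v (own b d)) := ownA
  refine ⟨f, finj, ?_, ?_, ?_⟩
  · rintro ⟨⟨b, c⟩, s⟩ ⟨⟨b', e⟩, t⟩ hc he hs hne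
    simp only at hs
    subst hs
    have hc' : c ∈ es' b := hc
    have he' : e ∈ es' b := he
    have hne' : own b (c, s) ≠ own b (e, t) := fun k => hne (by simp [mown, k])
    show ¬ IL (hv (j b (own b (c, s)))) (pos b (.d (c, s))) (hv (j b (own b (e, t)))) (pos b (.d (e, t)))
    have lc := (G b).labd (c, s) hc'
    have le := (G b).labd (e, t) he'
    have key : ∀ (c e : E b) (s t : Bool), c ∈ es' b → e ∈ es' b → own b (c, s) ∈ range (T b) →
        own b (e, t) ∉ range (T b) →
        ¬ IL (hv (j b (own b (c, s)))) (pos b (.d (c, s))) (hv (j b (own b (e, t)))) (pos b (.d (e, t))) := by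
      intro c e s t hc' he' h1 h2
      have lc := (G b).labd (c, s) hc'
      have le := (G b).labd (e, t) he'
      rw [hvN _ _ h2]
      have nT := (G b).nearT (c, s) (e, t) hc' he' h1 h2
      obtain ⟨i, hi⟩ := h1
      rw [← hi, hvT]
      rw [← hi, (G b).labT] at lc
      have z1 := Z (i : ℕ) (lab b (.v (own b (e, t))))
      have p1 := pm b (.d (c, s)) (.d (e, t)) hc' he'
      have p2 := pm b (.d (e, t)) (.d (c, s)) he' hc'
      have p3 := pm b (.d (c, s)) (.v (own b (e, t))) hc' (inO _ _ he')
      have p4 := pm b (.v (own b (e, t))) (.d (c, s)) (inO _ _ he') hc'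
      have k1 := hK b (.d (c, s)) hc'
      have k2 := hK b (.d (e, t)) he'
      have k3 := hK b (.v (own b (e, t))) (inO _ _ he')
      unfold BT at nT
      clear G hvT hvN pm pinj pdiff pT desc finj inO Z ownA H jj jT jTb
      simp only [IL, pos, lc, le, off] at p1 p2 p3 p4 nT k1 k2 k3 z1 ⊢
      cases b <;> simp only [if_true, Bool.false_eq_true, if_false] at p1 p2 p3 p4 nT k1 k2 k3 z1 ⊢ <;> omega
    by_cases h1 : own b (c, s) ∈ range (T b) <;> by_cases h2 : own b (e, t) ∈ range (T b)
    · obtain ⟨i, hi⟩ := h1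
      obtain ⟨i', hi'⟩ := h2
      have hii : (i : ℕ) ≠ i' := fun k => hne' (by rw [← hi, ← hi', Fin.ext k])
      rw [← hi, ← hi', hvT, hvT]
      rw [← hi, (G b).labT] at lc
      rw [← hi', (G b).labT] at le
      have z1 := Z (i : ℕ) (i' : ℕ)
      have k1 := hK b (.d (c, s)) hc'
      have k2 := hK b (.d (e, t)) he'
      simp only [IL, pos, lc, le, off]
      cases b <;> simp only [if_true, Bool.false_eq_true, if_false] <;> omega
    · exact key c e s t hc' he' h1 h2
    · have := key e c t s he' hc' h2 h1
      unfold IL at *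
      tauto
    · rw [hvN _ _ h1, hvN _ _ h2]
      intro k
      exact (G b).near (c, s) (e, t) hc' he' hne' h1 h2
        (IL_map (g b) (pos b) (itmIn (A' b) (es' b)) (pm b) (inO _ _ hc') hc' (inO _ _ he') he' k)
  · rintro ⟨⟨b, c⟩, s⟩ ⟨⟨b', e⟩, t⟩ hc he hs hne
    simp only at hs
    subst hs
    intro k
    exact (G b).far (c, s) (e, t) hc he (fun k => hne (by simp only at k; simp [k]))
        (IL_map (g b) (pos b) (itmIn (A' b) (es' b)) (pm b) (a := .d (c, s)) (b := .d (c, !s))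
          (c := .d (e, t)) (d := .d (e, !t)) hc hc he he k)
  · rintro ⟨⟨b, c⟩, s⟩ ⟨⟨b', e⟩, t⟩ hc he hs
    simp only at hs
    have hc' : c ∈ es' b := hc
    have he' : e ∈ es' b' := he
    show ¬ IL (hv (j b (own b (c, s)))) (pos b (.d (c, s))) (pos b' (.d (e, t))) (pos b' (.d (e, !t)))
    have lc := (G b).labd (c, s) hc'
    have k1 := hK b (.d (c, s)) hc'
    have k2 := hK b' (.d (e, t)) he'
    have k3 := hK b' (.d (e, !t)) he'
    have k4 := hK b _ (inO b (c, s) hc')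
    have z1 := Z (lab b (.v (own b (c, s)))) (lab b' (.d (e, t)))
    have z2 := Z (lab b (.v (own b (c, s)))) (lab b' (.d (e, !t)))
    have hb' : b' = !b := by cases b <;> cases b' <;> simp_all
    subst hb'
    by_cases h1 : own b (c, s) ∈ range (T b)
    · obtain ⟨i, hi⟩ := h1
      rw [← hi, hvT]
      rw [← hi, (G b).labT] at lc z1 z2
      simp only [IL, pos, lc, off]
      cases b <;> simp only [if_true, Bool.false_eq_true, if_false, Bool.not_true, Bool.not_false] at k1 k2 k3 k4 z1 z2 lc ⊢ <;> omega
    · rw [hvN _ _ h1]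
      simp only [IL, pos, lc, off]
      cases b <;> simp only [if_true, Bool.false_eq_true, if_false, Bool.not_true, Bool.not_false] at k1 k2 k3 k4 z1 z2 lc ⊢ <;> omega

end merge
end BK

namespace BK
open Set Filter

lemma itm_countable {V D : Type} [Countable V] [Countable D] : Countable (Itm V D) := by
  have : Function.Injective (fun x : Itm V D => match x with
    | .v a => (Sum.inl a : V ⊕ D)
    | .d a => Sum.inr a) := by
    rintro (a | a) (b | b) h <;> simp_all
  exact this.countable

lemma germ_IL {X : Type} (F : Ultrafilter X) (p q r s : X → ℤ)
    (h : IL (p : (F : Filter X).Germ ℤ) (q : (F : Filter X).Germ ℤ) (r : (F : Filter X).Germ ℤ)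
      (s : (F : Filter X).Germ ℤ)) : ∀ᶠ x in (F : Filter X), IL (p x) (q x) (r x) (s x) := by
  rw [IL_iff] at h
  simp only [Germ.coe_lt] at h
  rcases h with h | h | h | h | h | h | h | h <;>
  · filter_upwards [h.1, h.2.1, h.2.2] with x a b c
    rw [IL_iff]
    simp only [a, b, c, and_self, true_or, or_true]

lemma IL_sub {α : Type*} [LinearOrder α] {S : Set α} (p q r s : S) (h : IL p q r s) :
    IL (p : α) (q : α) r s := by
  rw [IL_iff] at *
  simpa only [Subtype.coe_lt_coe] using h

theorem compact_book {V E : Type} [Countable V] [Countable E] (own : E × Bool → V) (side : E → Bool)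
    (H : ∀ (A : Set V) (es : Set E), A.Finite → es.Finite →
      ∃ f : Itm V (E × Bool) → ℤ, Book2 own side A es f) :
    ∃ l r : Itm V (E × Bool) → ℝ, (∀ x, 0 < l x ∧ l x < r x ∧ r x < 1) ∧
      (∀ x y, x ≠ y → r x < l y ∨ r y < l x) ∧ Book2 own side univ univ l := by
  classical
  let I := Itm V (E × Bool)
  have : Countable I := itm_countable
  let A : Finset I → Set V := fun s => {v | (.v v : I) ∈ s}
  let es : Finset I → Set E := fun s => {e | ∃ b, (.d (e, b) : I) ∈ s}
  have hA : ∀ s, (A s).Finite := fun s =>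
    (s.finite_toSet).preimage (fun x _ y _ h => by cases h; rfl)
  have hes : ∀ s, (es s).Finite := by
    intro s
    have : es s = ⋃ b : Bool, {e | (.d (e, b) : I) ∈ s} := by ext; simp [es]
    rw [this]
    exact finite_iUnion fun b => (s.finite_toSet).preimage (fun x _ y _ h => by cases h; rfl)
  choose f hf using fun s => H (A s) (es s) (hA s) (hes s)
  let F : Ultrafilter (Finset I) := Ultrafilter.of atTop
  have hF : (F : Filter (Finset I)) ≤ atTop := Ultrafilter.of_le _
  let G : I → (F : Filter (Finset I)).Germ ℤ := fun x => ((fun s => f s x : Finset I → ℤ) : Germ _ ℤ)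
  have mem : ∀ x : I, ∀ᶠ s in (F : Filter (Finset I)), x ∈ s := by
    intro x
    refine hF ?_
    filter_upwards [eventually_ge_atTop {x}] with s hs
    exact hs (Finset.mem_singleton_self x)
  have memI : ∀ x : I, ∀ᶠ s in (F : Filter (Finset I)), itmIn (A s) (es s) x := by
    intro x
    filter_upwards [mem x] with s hs
    rcases x with v | ⟨e, b⟩
    · exact hs
    · exact ⟨b, hs⟩
  have meme : ∀ e : E, ∀ᶠ s in (F : Filter (Finset I)), e ∈ es s := fun e => memI (.d (e, true))
  have Ginj : Function.Injective G := by
    intro x y h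
    have h' : ∀ᶠ s in (F : Filter (Finset I)), f s x = f s y := Germ.coe_eq.mp h
    obtain ⟨s, h1, h2, h3⟩ := (h'.and ((memI x).and (memI y))).exists
    exact (hf s).inj x y h2 h3 h1
  let Ω := range G
  have : Countable Ω := (countable_range G).to_subtype
  have : Countable (Ω ×ₗ Bool) := by unfold Lex; infer_instance
  have : Nontrivial (Ioo (0:ℝ) 1) := ⟨⟨1/2, by norm_num, by norm_num⟩, ⟨1/3, by norm_num, by norm_num⟩, by
    intro h; have := congrArg Subtype.val h; norm_num at this⟩
  obtain ⟨φ⟩ := Order.embedding_from_countable_to_dense (Ω ×ₗ Bool) (Ioo (0:ℝ) 1)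
  let g : I → Ω := fun x => ⟨G x, x, rfl⟩
  have ginj : Function.Injective g := fun x y h => Ginj (congrArg Subtype.val h)
  let l : I → ℝ := fun x => (φ (toLex (g x, false)) : ℝ)
  let r : I → ℝ := fun x => (φ (toLex (g x, true)) : ℝ)
  have hlt : ∀ x y, g x < g y → r x < l y := by
    intro x y h
    show (φ _ : ℝ) < φ _
    rw [Subtype.coe_lt_coe, OrderEmbedding.lt_iff_lt, Prod.Lex.toLex_lt_toLex]
    exact Or.inl h
  have hlr : ∀ x, l x < r x := by
    intro x
    show (φ _ : ℝ) < φ _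
    rw [Subtype.coe_lt_coe, OrderEmbedding.lt_iff_lt, Prod.Lex.toLex_lt_toLex]
    exact Or.inr ⟨rfl, Bool.false_lt_true⟩
  have tot : ∀ x y, x ≠ y → g x < g y ∨ g y < g x := fun x y h => lt_or_gt_of_ne (ginj.ne h)
  have hback : ∀ x y : I, True → True → l x < l y → g x < g y := by
    intro x y _ _ h
    by_contra hn
    rcases (not_lt.mp hn).lt_or_eq with k | k
    · have := hlt _ _ k; have := hlr y; linarith
    · rw [ginj k] at h; exact lt_irrefl _ h
  have main : ∀ a b c d : I, IL (l a) (l b) (l c) (l d) →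
      ∀ᶠ s in (F : Filter (Finset I)), IL (f s a) (f s b) (f s c) (f s d) := by
    intro a b c d h
    have := IL_map g l (fun _ => True) hback (a := a) (b := b) (c := c) (d := d) trivial trivial trivial trivial h
    exact germ_IL F _ _ _ _ (IL_sub _ _ _ _ this)
  refine ⟨l, r, fun x => ⟨(φ _).2.1, hlr x, (φ _).2.2⟩, fun x y h => (tot x y h).imp (hlt x y) (hlt y x), ?_, ?_, ?_, ?_⟩
  · intro x y _ _ h
    by_contra hn
    rcases tot x y hn with k | k
    · have := hlt _ _ k; have := hlr x; linarith
    · have := hlt _ _ k; have := hlr y; linarith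
  · intro c e _ _ h1 h2 k
    obtain ⟨s, k, a, b⟩ := ((main _ _ _ _ k).and ((meme c.1).and (meme e.1))).exists
    exact (hf s).nn c e a b h1 h2 k
  · intro c e _ _ h1 h2 k
    obtain ⟨s, k, a, b⟩ := ((main _ _ _ _ k).and ((meme c.1).and (meme e.1))).exists
    exact (hf s).ff c e a b h1 h2 k
  · intro c e _ _ h1 k
    obtain ⟨s, k, a, b⟩ := ((main _ _ _ _ k).and ((meme c.1).and (meme e.1))).exists
    exact (hf s).nf c e a b h1 k
end BK

namespace BK
open Set

def kown : (Fin 3 × Fin 3) × Bool → Bool × Fin 3 := fun d => (d.2, if d.2 then d.1.2 else d.1.1)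

def kpd : Bool × Fin 3 → Option ((Fin 3 × Fin 3) × Bool) := fun v =>
  if v.1 then some ((0, v.2), true) else if v.2 = 0 then none else some ((v.2, 0), false)

def krk : Bool × Fin 3 → ℕ := fun v => if v.1 then 1 else if v.2 = 0 then 0 else 2

lemma k33_num (a b : Fin 3 → ℕ) (A B : Fin 3 → Fin 3 → ℕ)
    (hb : ∀ i, b i = A 0 i + 1) (ha : ∀ j, j ≠ 0 → a j = B 0 j + 1)
    (ltA : ∀ j i, a j < A j i) (ltB : ∀ i j, b i < B i j)
    (F1 : ∀ i k j, b i < A 0 k → A 0 k < B i j → False)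
    (F2 : ∀ j i k, j ≠ 0 → a j < A 0 k → A 0 k < A j i → False)
    (F3 : ∀ j j' i, j ≠ 0 → j' ≠ 0 → j ≠ j' → a j < B 0 j' → B 0 j' < A j i → False)
    (inj1 : ∀ i k, A 0 i = A 0 k → i = k) (inj2 : ∀ j k, B 0 j = B 0 k → j = k)
    (inj3 : ∀ i k j, b i ≠ A 0 k ∧ A 0 k ≠ B i j)
    (inj4 : ∀ i j k, j ≠ 0 → a j ≠ A 0 k ∧ A 0 k ≠ A j i)
    (inj5 : ∀ j j', a j ≠ B 0 j') (inj6 : ∀ j j' i, B 0 j' ≠ A j i)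
    (far1 : ∀ j i j' i', (j, i) ≠ (j', i') → ¬ (A j i < A j' i' ∧ A j' i' < B i j ∧ B i j < B i' j'))
    (far2 : ∀ j i j' i', (j, i) ≠ (j', i') → ¬ (A j i < B i' j' ∧ B i' j' < B i j ∧ B i j < A j' i'))
    (far3 : ∀ j i j' i', (j, i) ≠ (j', i') → ¬ (B i j < A j' i' ∧ A j' i' < A j i ∧ A j i < B i' j'))
    (far4 : ∀ j i j' i', (j, i) ≠ (j', i') → ¬ (B i j < B i' j' ∧ B i' j' < A j i ∧ A j i < A j' i')) :
    False := by
  have G1 : ∀ i j k, A 0 i < B i j ∧ (k = i ∨ A 0 k < A 0 i ∨ B i j < A 0 k) := by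
    intro i j k
    have h1 := hb i
    have h2 := ltB i j
    have h3 : ¬ (b i < A 0 k ∧ A 0 k < B i j) := fun h => F1 i k j h.1 h.2
    have h4 := inj3 i k j
    refine ⟨by omega, ?_⟩
    by_cases hk : k = i
    · exact Or.inl hk
    · have := mt (inj1 k i) hk
      right; omega
  have G2 : ∀ j i k, j ≠ 0 → A 0 0 < A j i ∧ (k = 0 ∨ A 0 k < A 0 0 ∨ A j i < A 0 k) := by
    intro j i k hj
    have h1 := ha j hj
    have h2 := ltA j i
    have h3 : ¬ (a j < A 0 k ∧ A 0 k < A j i) := fun h => F2 j i k hj h.1 h.2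
    have h4 := inj4 i j k hj
    have h5 := G1 0 j k
    refine ⟨by omega, ?_⟩
    rcases h5.2 with h | h | h
    · exact Or.inl h
    · exact Or.inr (Or.inl h)
    · right; right; omega
  have main : ∀ j j', j ≠ 0 → j' ≠ 0 → j ≠ j' → a j < a j' → False := by
    intro j j' hj hj' hjj hlt
    have o : ∀ i i', A j i < A j' i' := by
      intro i i'
      have h1 := ha j hj
      have h2 := ha j' hj'
      have h3 : ¬ (a j < B 0 j' ∧ B 0 j' < A j i) := fun h => F3 j j' i hj hj' hjj h.1 h.2
      have h4 := ltA j' i'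
      have h5 := inj5 j j'
      have h6 := inj6 j j' i
      have h7 := mt (inj2 j j') hjj
      omega
    have o1 := o 1 1
    have o2 := o 1 2
    have o3 := o 2 1
    have o4 := o 2 2
    have s := fun jj i k => (G1 i jj k)
    have t := fun jj i k (h : jj ≠ 0) => (G2 jj i k h)
    have e1 : (1 : Fin 3) ≠ 0 := by decide
    have e2 : (2 : Fin 3) ≠ 0 := by decide
    have e3 : (1 : Fin 3) ≠ 2 := by decide
    have q : ∀ i k, i ≠ k → A 0 i ≠ A 0 k := fun i k h => mt (inj1 i k) h
    have q1 := q 1 0 e1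
    have q2 := q 2 0 e2
    have q3 := q 1 2 e3
    -- segment facts
    have a1 : ∀ jj, (jj = j ∨ jj = j') → ∀ i k, k ≠ 0 → A 0 0 < A jj i ∧ (A 0 k < A 0 0 ∨ A jj i < A 0 k) := by
      rintro jj (rfl | rfl) i k hk
      · exact ⟨(t jj i k hj).1, (t jj i k hj).2.resolve_left hk⟩
      · exact ⟨(t jj i k hj').1, (t jj i k hj').2.resolve_left hk⟩
    have b1 : ∀ jj i k, k ≠ i → A 0 i < B i jj ∧ (A 0 k < A 0 i ∨ B i jj < A 0 k) := by
      intro jj i k hk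
      exact ⟨(s jj i k).1, (s jj i k).2.resolve_left hk⟩
    have n1 : ((j, 1) : Fin 3 × Fin 3) ≠ (j', 2) := fun k => hjj (congrArg Prod.fst k)
    have n2 : ((j, 2) : Fin 3 × Fin 3) ≠ (j', 1) := fun k => hjj (congrArg Prod.fst k)
    have u : ∀ x y, x ≠ 0 → y ≠ 0 → x ≠ y → A 0 x < A 0 y → False := by
      intro x y hx hy hxy hl
      have m1 : ((j, x) : Fin 3 × Fin 3) ≠ (j', y) := fun k => hjj (congrArg Prod.fst k)
      have m2 : ((j, y) : Fin 3 × Fin 3) ≠ (j', x) := fun k => hjj (congrArg Prod.fst k)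
      have w1 := a1 j (Or.inl rfl) x x hx
      have w2 := a1 j (Or.inl rfl) x y hy
      have w3 := a1 j (Or.inl rfl) y x hx
      have w4 := a1 j (Or.inl rfl) y y hy
      have w5 := a1 j' (Or.inr rfl) x x hx
      have w6 := a1 j' (Or.inr rfl) x y hy
      have w7 := a1 j' (Or.inr rfl) y x hx
      have w8 := a1 j' (Or.inr rfl) y y hy
      have y1 := b1 j x 0 hx.symm
      have y2 := b1 j x y hxy.symm
      have y3 := b1 j' x 0 hx.symm
      have y4 := b1 j' x y hxy.symm
      have y5 := b1 j y 0 hy.symm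
      have y6 := b1 j y x hxy
      have y7 := b1 j' y 0 hy.symm
      have y8 := b1 j' y x hxy
      have p1 := o x y
      have p2 := o y x
      have q1 := q x 0 hx
      have q2 := q y 0 hy
      rcases lt_or_gt_of_ne q1 with r1 | r1
      · rcases lt_or_gt_of_ne q2 with r2 | r2
        · have := far4 j x j' y m1
          omega
        · have := far3 j' x j y m2.symm
          omega
      · have := far1 j x j' y m1
        omega
    rcases lt_or_gt_of_ne q3 with h | h
    · exact u 1 2 e1 e2 e3 h
    · exact u 2 1 e2 e1 e3.symm h
  have e1 : (1 : Fin 3) ≠ 0 := by decide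
  have e2 : (2 : Fin 3) ≠ 0 := by decide
  have e3 : (1 : Fin 3) ≠ 2 := by decide
  have h1 := ha 1 e1
  have h2 := ha 2 e2
  have h3 := mt (inj2 1 2) e3
  rcases lt_trichotomy (a 1) (a 2) with h | h | h
  · exact main 1 2 e1 e2 e3 h
  · omega
  · exact main 2 1 e2 e1 e3.symm h

theorem no_k33 (P Q : Fin 3 → Set (ℝ × ℝ)) (M : Fin 3 × Fin 3 → Set (ℝ × ℝ))
    (Pc : ∀ v, IsCompact (P v)) (Pp : ∀ v, IsPreconnected (P v)) (Pne : ∀ v, (P v).Nonempty)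
    (Pd : ∀ v w, v ≠ w → Disjoint (P v) (P w))
    (Qc : ∀ v, IsCompact (Q v)) (Qp : ∀ v, IsPreconnected (Q v)) (Qne : ∀ v, (Q v).Nonempty)
    (Qd : ∀ v w, v ≠ w → Disjoint (Q v) (Q w)) (PQ : ∀ v w, Disjoint (P v) (Q w))
    (Mc : ∀ e, IsCompact (M e)) (Mp : ∀ e, IsPreconnected (M e))
    (Md : ∀ e f, e ≠ f → Disjoint (M e) (M f))
    (MP : ∀ j i v, v ≠ j → Disjoint (M (j, i)) (P v))
    (MQ : ∀ j i v, v ≠ i → Disjoint (M (j, i)) (Q v))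
    (mP : ∀ j i, (M (j, i) ∩ P j).Nonempty) (mQ : ∀ j i, (M (j, i) ∩ Q i).Nonempty) : False := by
  obtain ⟨f, hf, f0, hpd⟩ := topo_book kown (by rintro ⟨⟨j, i⟩, b⟩; cases b <;> simp [kown, fl])
    (fun v => if v.1 then Q v.2 else P v.2) M
    (by rintro ⟨b, v⟩; cases b; exacts [Pc v, Qc v])
    (by rintro ⟨b, v⟩; cases b; exacts [Pp v, Qp v])
    (by rintro ⟨b, v⟩; cases b; exacts [Pne v, Qne v])
    (by
      rintro ⟨b, v⟩ ⟨b', v'⟩ h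
      cases b <;> cases b'
      · exact Pd v v' (fun k => h (by rw [k]))
      · exact PQ v v'
      · exact (PQ v' v).symm
      · exact Qd v v' (fun k => h (by rw [k])))
    Mc Mp Md
    (by
      rintro ⟨j, i⟩ ⟨b, v⟩ h
      cases b
      · exact MP j i v (fun k => h false (by simp [kown, k]))
      · exact MQ j i v (fun k => h true (by simp [kown, k])))
    (by
      rintro ⟨⟨j, i⟩, b⟩
      cases b
      · exact mP j i
      · exact mQ j i)
    kpd krk (fun _ => (false, 0))
    (by
      have : ∀ v d, kpd v = some d → kown d = v ∧ krk (kown (fl d)) < krk v := by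
        unfold kpd kown krk fl; decide
      exact this)
    (fun _ => rfl)
    (by
      have : ∀ v, kpd v = none → (false, 0) = v := by
        unfold kpd; decide
      exact this) (false, 0) (by decide)
  have inj := hf.inj
  have vne : ∀ v d, f (.v v) ≠ f (.d d) := fun v d h => by cases inj h
  have dinj : ∀ d d', f (.d d) = f (.d d') → d = d' := fun d d' h => by cases inj h; rfl
  refine k33_num (fun j => f (.v (false, j))) (fun i => f (.v (true, i)))
    (fun j i => f (.d ((j, i), false))) (fun i j => f (.d ((j, i), true)))
    ?_ ?_ ?_ ?_ ?_ ?_ ?_ ?_ ?_ ?_ ?_ ?_ ?_ ?_ ?_ ?_ ?_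
  · intro i
    exact (hpd (true, i) ((0, i), true) rfl).1
  · intro j hj
    exact (hpd (false, j) ((j, 0), false) (by simp [kpd, hj])).1
  · intro j i; exact hf.lt ((j, i), false)
  · intro i j; exact hf.lt ((j, i), true)
  · intro i k j h1 h2
    rcases hf.near ((0, k), false) ((j, i), true) h1 h2 with h | h
    · simp [kown] at h
    · change f (.v (true, i)) < f (.v (false, 0)) at h
      omega
  · intro j i k hj h1 h2
    rcases hf.near ((0, k), false) ((j, i), false) h1 h2 with h | h
    · simp [kown, hj.symm] at h
    · change f (.v (false, j)) < f (.v (false, 0)) at h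
      omega
  · intro j j' i hj hj' hjj h1 h2
    rcases hf.near ((j', 0), true) ((j, i), false) h1 h2 with h | h
    · simp [kown] at h
    · change f (.v (false, j)) < f (.v (true, 0)) at h
      have a1 : f (.v (false, j)) = f (.d ((j, 0), true)) + 1 := (hpd (false, j) ((j, 0), false) (by simp [kpd, hj])).1
      have a2 : f (.v (true, 0)) < f (.d ((j, 0), true)) := hf.lt ((j, 0), true)
      omega
  · intro i k h; have := dinj _ _ h; simpa using this
  · intro i k h; have := dinj _ _ h; simpa using this
  · intro i k j
    exact ⟨vne _ _, fun h => by have := dinj _ _ h; simp at this⟩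
  · intro i j k hj
    exact ⟨vne _ _, fun h => by have := dinj _ _ h; simp [hj.symm] at this⟩
  · intro j j'; exact vne _ _
  · intro j j' i h; have := dinj _ _ h; simp at this
  · intro j i j' i' h; exact hf.far ((j, i), false) ((j', i'), false) h
  · intro j i j' i' h; exact hf.far ((j, i), false) ((j', i'), true) h
  · intro j i j' i' h; exact hf.far ((j, i), true) ((j', i'), false) h
  · intro j i j' i' h; exact hf.far ((j, i), true) ((j', i'), true) h
end BK

namespace BK
open Set

theorem moore {Z : Type} (lam : Z → Fin 3 → ℝ → ℝ × ℝ) (hc : ∀ z i, Continuous (lam z i))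
    (h0 : ∀ z i j, lam z i 0 = lam z j 0)
    (hij : ∀ z i j s t, s ∈ Icc (0:ℝ) 1 → t ∈ Icc (0:ℝ) 1 → i ≠ j → lam z i s = lam z j t → s = 0)
    (hz : ∀ z z' i j s t, s ∈ Icc (0:ℝ) 1 → t ∈ Icc (0:ℝ) 1 → lam z i s = lam z' j t → z = z') :
    Countable Z := by
  classical
  let leg : Z → Fin 3 → Set (ℝ × ℝ) := fun z i => lam z i '' Icc 0 1
  have legc : ∀ z i, IsCompact (leg z i) := fun z i => isCompact_Icc.image (hc z i)
  have I1 : (1:ℝ) ∈ Icc (0:ℝ) 1 := by simp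
  have I0 : (0:ℝ) ∈ Icc (0:ℝ) 1 := by simp
  have data : ∀ z, ∃ nk : ℕ × (Fin 3 → ℕ), ∀ i,
      lam z i 1 ∈ Metric.closedBall (TopologicalSpace.denseSeq (ℝ × ℝ) (nk.2 i)) (1 / (nk.1 + 1 : ℝ)) ∧
      ∀ j, j ≠ i → (∀ x ∈ leg z j, 4 / (nk.1 + 1 : ℝ) < dist (lam z i 1) x) := by
    intro z
    have h1 : ∀ i j, ∃ δ : ℝ, 0 < δ ∧ (j ≠ i → ∀ x ∈ leg z j, δ ≤ dist (lam z i 1) x) := by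
      intro i j
      by_cases hji : j = i
      · exact ⟨1, one_pos, fun h => absurd hji h⟩
      have hn : lam z i 1 ∉ leg z j := by
        rintro ⟨s, hs, h⟩
        have := hij z i j 1 s I1 hs (Ne.symm hji) h.symm
        norm_num at this
      have := ((legc z j).isClosed.notMem_iff_infDist_pos ⟨_, 0, I0, rfl⟩).mp hn
      exact ⟨_, this, fun _ x hx => Metric.infDist_le_dist_of_mem hx⟩
    choose δ d1 d2 using h1
    obtain ⟨ε, he, hε⟩ : ∃ ε : ℝ, 0 < ε ∧ ∀ i j, ε ≤ δ i j := by
      let F : Finset ℝ := Finset.univ.image (fun q : Fin 3 × Fin 3 => δ q.1 q.2)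
      have hF : F.Nonempty := ⟨δ 0 0, Finset.mem_image.mpr ⟨(0, 0), Finset.mem_univ _, rfl⟩⟩
      refine ⟨F.min' hF, ?_, fun i j => F.min'_le _ (Finset.mem_image.mpr ⟨(i, j), Finset.mem_univ _, rfl⟩)⟩
      obtain ⟨q, -, hq⟩ := Finset.mem_image.mp (F.min'_mem hF)
      rw [← hq]; exact d1 _ _
    obtain ⟨n, hn⟩ := exists_nat_one_div_lt (show (0:ℝ) < ε / 4 by positivity)
    have hp : (0:ℝ) < 1 / (n + 1 : ℝ) := by positivity
    choose k hk using fun i => (TopologicalSpace.denseRange_denseSeq (ℝ × ℝ)).exists_dist_lt (lam z i 1) hp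
    refine ⟨(n, k), fun i => ⟨Metric.mem_closedBall.mpr (hk i).le, fun j hj x hx => ?_⟩⟩
    have := d2 i j hj x hx
    have := hε i j
    have e : 4 / (n + 1 : ℝ) = 4 * (1 / (n + 1 : ℝ)) := by ring
    show 4 / (n + 1 : ℝ) < _
    rw [e]; linarith
  choose nk hnk using data
  by_contra hunc
  have hfib : ∃ q, (nk ⁻¹' {q}).Infinite := by
    by_contra hcon
    push Not at hcon
    apply hunc
    rw [← countable_univ_iff]
    have : (univ : Set Z) = ⋃ q, nk ⁻¹' {q} := by ext; simp
    rw [this]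
    exact countable_iUnion fun q => (Set.not_infinite.mp (by simpa using hcon q)).countable
  obtain ⟨⟨n, k⟩, hq⟩ := hfib
  let zz : Fin 3 → Z := fun i => hq.natEmbedding _ i
  have zinj : Function.Injective zz := by
    intro i j h
    have := (hq.natEmbedding _).injective (Subtype.ext h)
    exact Fin.ext this
  have zq : ∀ j, nk (zz j) = (n, k) := fun j => (hq.natEmbedding _ j).2
  let Q : Fin 3 → Set (ℝ × ℝ) := fun i => Metric.closedBall (TopologicalSpace.denseSeq (ℝ × ℝ) (k i)) (1 / (n + 1 : ℝ))
  have Qend : ∀ j i, lam (zz j) i 1 ∈ Q i := by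
    intro j i; have := (hnk (zz j) i).1; rw [zq] at this; exact this
  have far : ∀ j i i', i' ≠ i → ∀ x ∈ leg (zz j) i', 4 * (1 / (n + 1 : ℝ)) < dist (lam (zz j) i 1) x := by
    intro j i i' h x hx
    have := (hnk (zz j) i).2 i' h x hx
    rw [zq] at this
    have e : 4 / (n + 1 : ℝ) = 4 * (1 / (n + 1 : ℝ)) := by ring
    rw [← e]; exact this
  have hp : (0:ℝ) < 1 / (n + 1 : ℝ) := by positivity
  have Qd : ∀ i x y, x ∈ Q i → y ∈ Q i → dist x y ≤ 2 * (1 / (n + 1 : ℝ)) := by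
    intro i x y hx hy
    have := dist_triangle_right x y (TopologicalSpace.denseSeq (ℝ × ℝ) (k i))
    have h1 := Metric.mem_closedBall.mp hx
    have h2 := Metric.mem_closedBall.mp hy
    linarith
  have Qleg : ∀ j i i', i' ≠ i → Disjoint (leg (zz j) i') (Q i) := by
    intro j i i' h
    rw [disjoint_left]
    intro x hx hx'
    have := far j i i' h x hx
    have := Qd i _ _ (Qend j i) hx'
    linarith
  have QQ : ∀ i i', i ≠ i' → Disjoint (Q i) (Q i') := by
    intro i i' h
    rw [disjoint_left]
    intro x hx hx'
    have h1 := far 0 i i' h.symm (lam (zz 0) i' 1) ⟨1, I1, rfl⟩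
    have h2 := Qd i _ _ (Qend 0 i) hx
    have h3 := Qd i' _ _ hx' (Qend 0 i')
    have := dist_triangle (lam (zz 0) i 1) x (lam (zz 0) i' 1)
    linarith
  have hit : ∀ j i, ∃ t ∈ Icc (0:ℝ) 1, lam (zz j) i t ∈ Q i ∧ ∀ s ∈ Icc (0:ℝ) 1, s < t → lam (zz j) i s ∉ Q i := by
    intro j i
    let K : Set ℝ := Icc 0 1 ∩ lam (zz j) i ⁻¹' Q i
    have Kc : IsCompact K := isCompact_Icc.inter_right (Metric.isClosed_closedBall.preimage (hc _ _))
    obtain ⟨t, ht, hm⟩ := Kc.exists_isLeast ⟨1, I1, Qend j i⟩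
    exact ⟨t, ht.1, ht.2, fun s hs hst hq => absurd (hm ⟨hs, hq⟩) (not_le.mpr hst)⟩
  choose t t1 t2 t3 using hit
  have tpos : ∀ j i, 0 < t j i := by
    intro j i
    rcases (t1 j i).1.lt_or_eq with h | h
    · exact h
    · exfalso
      have := t2 j i
      rw [← h] at this
      have hne : i + 1 ≠ i := by fin_cases i <;> simp
      rw [h0 _ i (i + 1)] at this
      exact disjoint_left.mp (Qleg j i (i + 1) hne) ⟨0, I0, rfl⟩ this
  have sub1 : ∀ j i, Icc 0 (t j i / 2) ⊆ Icc (0:ℝ) 1 := by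
    intro j i x hx
    have := (t1 j i).2; have := tpos j i
    exact ⟨hx.1, by linarith [hx.2]⟩
  have sub2 : ∀ j i, Icc (t j i / 2) (t j i) ⊆ Icc (0:ℝ) 1 := by
    intro j i x hx
    have := (t1 j i).2; have := tpos j i
    exact ⟨by linarith [hx.1], by linarith [hx.2]⟩
  have mem0 : ∀ j i, (0:ℝ) ∈ Icc 0 (t j i / 2) := fun j i => ⟨le_rfl, by linarith [tpos j i]⟩
  refine no_k33 (fun j => ⋃ i, lam (zz j) i '' Icc 0 (t j i / 2)) Q
    (fun e => lam (zz e.1) e.2 '' Icc (t e.1 e.2 / 2) (t e.1 e.2))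
    ?_ ?_ ?_ ?_ ?_ ?_ ?_ QQ ?_ ?_ ?_ ?_ ?_ ?_ ?_ ?_
  · exact fun j => isCompact_iUnion fun i => isCompact_Icc.image (hc _ _)
  · intro j
    refine isPreconnected_iUnion ⟨lam (zz j) 0 0, mem_iInter.mpr fun i => ⟨0, mem0 j i, h0 _ _ _⟩⟩ fun i => ?_
    exact isPreconnected_Icc.image _ (hc _ _).continuousOn
  · exact fun j => ⟨_, mem_iUnion.mpr ⟨0, 0, mem0 j 0, rfl⟩⟩
  · intro j j' h
    rw [disjoint_left]
    intro x hx hx'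
    simp only [mem_iUnion] at hx hx'
    obtain ⟨i, s, hs, e⟩ := hx
    obtain ⟨i', s', hs', e'⟩ := hx'
    exact h (zinj (hz _ _ _ _ _ _ (sub1 _ _ hs) (sub1 _ _ hs') (e.trans e'.symm)))
  · exact fun i => isCompact_closedBall _ _
  · exact fun i => (convex_closedBall _ _).isPreconnected
  · exact fun i => ⟨_, Qend 0 i⟩
  · intro j w
    rw [disjoint_left]
    intro x hx hx'
    simp only [mem_iUnion] at hx
    obtain ⟨i, s, hs, e⟩ := hx
    by_cases h : i = w
    · subst h
      refine t3 j i s (sub1 _ _ hs) ?_ (by rw [e]; exact hx')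
      linarith [hs.2, tpos j i]
    · exact disjoint_left.mp (Qleg j w i h) ⟨s, sub1 _ _ hs, e⟩ hx'
  · exact fun e => isCompact_Icc.image (hc _ _)
  · exact fun e => isPreconnected_Icc.image _ (hc _ _).continuousOn
  · rintro ⟨j, i⟩ ⟨j', i'⟩ h
    rw [disjoint_left]
    rintro x ⟨s, hs, e⟩ ⟨s', hs', e'⟩
    have k := e.trans e'.symm
    have hj : j = j' := zinj (hz _ _ _ _ _ _ (sub2 _ _ hs) (sub2 _ _ hs') k)
    subst hj
    have hi : i ≠ i' := fun k => h (by rw [k])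
    have := hij _ _ _ _ _ (sub2 _ _ hs) (sub2 _ _ hs') hi k
    have h1 := hs.1
    have := tpos j i
    simp only at h1
    linarith
  · intro j i v hv
    rw [disjoint_left]
    rintro x ⟨s, hs, e⟩ hx'
    simp only [mem_iUnion] at hx'
    obtain ⟨i', s', hs', e'⟩ := hx'
    exact hv (zinj (hz _ _ _ _ _ _ (sub1 _ _ hs') (sub2 _ _ hs) (e'.trans e.symm)))
  · intro j i v hv
    rw [disjoint_left]
    rintro x ⟨s, hs, e⟩ hx'
    exact disjoint_left.mp (Qleg j v i hv.symm) ⟨s, sub2 _ _ hs, e⟩ hx'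
  · intro j i
    have := tpos j i
    exact ⟨_, ⟨t j i / 2, ⟨le_rfl, by simp only; linarith⟩, rfl⟩, mem_iUnion.mpr ⟨i, t j i / 2, ⟨by linarith, le_rfl⟩, rfl⟩⟩
  · intro j i
    have := tpos j i
    exact ⟨_, ⟨t j i, ⟨by simp only; linarith, le_rfl⟩, rfl⟩, t2 j i⟩

end BK

namespace BK
open Set

/-- point of a parabolic chord -/
def chd (a b ε c : ℝ) : ℝ × ℝ := (a + (b - a) * c, ε * ((b - a) ^ 2 * (c * (1 - c))))

lemma chd_meet_lt {a b a' b' x : ℝ} (h1 : a < x) (h2 : x < b) (h1' : a' < x) (h2' : x < b')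
    (hn : ¬ IL a b a' b') (he : (x - a) * (b - x) = (x - a') * (b' - x)) : a = a' ∧ b = b' := by
  have hab : a < b := h1.trans h2
  have hab' : a' < b' := h1'.trans h2'
  unfold IL at hn
  simp only [min_eq_left hab.le, max_eq_right hab.le, min_eq_left hab'.le, max_eq_right hab'.le] at hn
  push Not at hn
  rcases lt_trichotomy a a' with h | h | h
  · rcases lt_trichotomy b b' with k | k | k
    · exact absurd k (not_lt.mpr (hn.1 h (h1'.trans h2)))
    · nlinarith [mul_pos (sub_pos.mpr h) (sub_pos.mpr h2)]
    · nlinarith [mul_pos (sub_pos.mpr h) (sub_pos.mpr h2), mul_pos (sub_pos.mpr h1') (sub_pos.mpr k)]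
  · rcases lt_trichotomy b b' with k | k | k
    · subst h; nlinarith [mul_pos (sub_pos.mpr h1) (sub_pos.mpr k)]
    · exact ⟨h, k⟩
    · subst h; nlinarith [mul_pos (sub_pos.mpr h1) (sub_pos.mpr k)]
  · rcases lt_trichotomy b b' with k | k | k
    · nlinarith [mul_pos (sub_pos.mpr h) (sub_pos.mpr h2'), mul_pos (sub_pos.mpr h1) (sub_pos.mpr k)]
    · nlinarith [mul_pos (sub_pos.mpr h) (sub_pos.mpr h2')]
    · exact absurd k (not_lt.mpr (hn.2 h (h1.trans h2')))

lemma chd_x {a b c : ℝ} (hab : a ≠ b) (hc : c ∈ Ioo (0:ℝ) 1) :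
    min a b < a + (b - a) * c ∧ a + (b - a) * c < max a b := by
  obtain ⟨h0, h1⟩ := hc
  rcases lt_or_gt_of_ne hab with h | h
  · rw [min_eq_left h.le, max_eq_right h.le]
    constructor <;> nlinarith
  · rw [min_eq_right h.le, max_eq_left h.le]
    constructor <;> nlinarith

lemma chd_meet {a b a' b' ε c c' : ℝ} (hε : ε ≠ 0) (hab : a ≠ b) (hab' : a' ≠ b')
    (hc : c ∈ Ioo (0:ℝ) 1) (hc' : c' ∈ Ioo (0:ℝ) 1) (hn : ¬ IL a b a' b')
    (he : chd a b ε c = chd a' b' ε c') :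
    (a = a' ∧ b = b' ∧ c = c') ∨ (a = b' ∧ b = a') := by
  have e1 : a + (b - a) * c = a' + (b' - a') * c' := congrArg Prod.fst he
  have e2 := mul_left_cancel₀ hε (congrArg Prod.snd he : ε * ((b - a) ^ 2 * (c * (1 - c))) = ε * ((b' - a') ^ 2 * (c' * (1 - c'))))
  have x1 := chd_x hab hc
  have x2 := chd_x hab' hc'
  rw [← e1] at x2
  have f1 : (b - a) ^ 2 * (c * (1 - c)) = (a + (b - a) * c - min a b) * (max a b - (a + (b - a) * c)) := by
    rcases le_total a b with h | h <;> simp only [min_eq_left, max_eq_right, min_eq_right, max_eq_left, h] <;> ring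
  have f2 : (b' - a') ^ 2 * (c' * (1 - c')) = (a + (b - a) * c - min a' b') * (max a' b' - (a + (b - a) * c)) := by
    rw [e1]
    rcases le_total a' b' with h | h <;> simp only [min_eq_left, max_eq_right, min_eq_right, max_eq_left, h] <;> ring
  have hn' : ¬ IL (min a b) (max a b) (min a' b') (max a' b') := by
    unfold IL at *
    simpa using hn
  obtain ⟨g1, g2⟩ := chd_meet_lt x1.1 x1.2 x2.1 x2.2 hn' (by rw [← f1, ← f2, e2])
  rcases le_total a b with h | h <;> rcases le_total a' b' with h' | h' <;>
    simp only [min_eq_left, max_eq_right, min_eq_right, max_eq_left, h, h'] at g1 g2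
  · left; subst g1; subst g2
    exact ⟨rfl, rfl, mul_left_cancel₀ (sub_ne_zero.mpr hab.symm) (by linarith)⟩
  · right; exact ⟨g1, g2⟩
  · right; exact ⟨g2, g1⟩
  · left; subst g1; subst g2
    exact ⟨rfl, rfl, mul_left_cancel₀ (sub_ne_zero.mpr hab.symm) (by linarith)⟩

lemma chd_sign {a b ε c : ℝ} (hab : a ≠ b) (hc : c ∈ Ioo (0:ℝ) 1) : ∃ y > 0, (chd a b ε c).2 = ε * y := by
  refine ⟨_, ?_, rfl⟩
  have : 0 < (b - a) ^ 2 := by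
    have := sub_ne_zero.mpr hab.symm
    positivity
  exact mul_pos this (mul_pos hc.1 (sub_pos.mpr hc.2))

/-- sign of a page -/
def sg (b : Bool) : ℝ := if b then 1 else -1

lemma sg_ne (b : Bool) : sg b ≠ 0 := by cases b <;> simp [sg]

lemma sg_not (b : Bool) : sg (!b) = - sg b := by cases b <;> simp [sg]

lemma chd_page {a b a' b' c c' : ℝ} {p q : Bool} (hab : a ≠ b) (hab' : a' ≠ b')
    (hc : c ∈ Ioo (0:ℝ) 1) (hc' : c' ∈ Ioo (0:ℝ) 1)
    (he : chd a b (sg p) c = chd a' b' (sg q) c') : p = q := by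
  obtain ⟨y, hy, e⟩ := chd_sign (ε := sg p) hab hc
  obtain ⟨y', hy', e'⟩ := chd_sign (ε := sg q) hab' hc'
  have := e.symm.trans ((congrArg Prod.snd he).trans e')
  cases p <;> cases q <;> simp [sg] at this ⊢ <;> linarith

def clp (x : ℝ) : ℝ := max 0 (min 1 x)

/-- three chords in a row -/
def tri (x0 x1 x2 x3 ε s : ℝ) : ℝ × ℝ :=
  (x0 + (x1 - x0) * clp (3 * s) + (x2 - x1) * clp (3 * s - 1) + (x3 - x2) * clp (3 * s - 2),
   ε * ((x1 - x0) ^ 2 * (clp (3 * s) * (1 - clp (3 * s))))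
    - ε * ((x2 - x1) ^ 2 * (clp (3 * s - 1) * (1 - clp (3 * s - 1))))
    + ε * ((x2 - x3) ^ 2 * (clp (3 * s - 2) * (1 - clp (3 * s - 2)))))

lemma tri_cont (x0 x1 x2 x3 ε : ℝ) : Continuous (tri x0 x1 x2 x3 ε) := by
  unfold tri clp; fun_prop

lemma clp0 {x : ℝ} (h : x ≤ 0) : clp x = 0 := by
  unfold clp; rw [min_eq_right (by linarith), max_eq_left h]
lemma clp1 {x : ℝ} (h : 1 ≤ x) : clp x = 1 := by
  unfold clp; rw [min_eq_left h, max_eq_right zero_le_one]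
lemma clpm {x : ℝ} (h : 0 ≤ x) (h' : x ≤ 1) : clp x = x := by
  unfold clp; rw [min_eq_right h', max_eq_right h]

lemma tri_zero (x0 x1 x2 x3 ε : ℝ) : tri x0 x1 x2 x3 ε 0 = (x0, 0) := by
  unfold tri; rw [clp0 (by norm_num), clp0 (by norm_num), clp0 (by norm_num)]; ext <;> simp
lemma tri_one (x0 x1 x2 x3 ε : ℝ) : tri x0 x1 x2 x3 ε 1 = (x3, 0) := by
  unfold tri; rw [clp1 (by norm_num), clp1 (by norm_num), clp1 (by norm_num)]; ext <;> simp

lemma tri_cases (x0 x1 x2 x3 : ℝ) (p : Bool) {s : ℝ} (hs : s ∈ Ioo (0:ℝ) 1) :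
    (∃ c ∈ Ioo (0:ℝ) 1, c = 3 * s ∧ tri x0 x1 x2 x3 (sg p) s = chd x0 x1 (sg p) c) ∨
    (s = 1 / 3 ∧ tri x0 x1 x2 x3 (sg p) s = (x1, 0)) ∨
    (∃ c ∈ Ioo (0:ℝ) 1, c = 3 * s - 1 ∧ tri x0 x1 x2 x3 (sg p) s = chd x1 x2 (sg (!p)) c) ∨
    (s = 2 / 3 ∧ tri x0 x1 x2 x3 (sg p) s = (x2, 0)) ∨
    (∃ c ∈ Ioo (0:ℝ) 1, c = 3 - 3 * s ∧ tri x0 x1 x2 x3 (sg p) s = chd x3 x2 (sg p) c) := by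
  obtain ⟨h0, h1⟩ := hs
  rcases lt_trichotomy s (1 / 3) with h | h | h
  · left
    refine ⟨3 * s, ⟨by linarith, by linarith⟩, rfl, ?_⟩
    unfold tri chd
    rw [clpm (by linarith) (by linarith), clp0 (by linarith), clp0 (by linarith)]
    ext <;> simp
  · right; left
    refine ⟨h, ?_⟩
    unfold tri
    rw [clp1 (by linarith), clp0 (by linarith), clp0 (by linarith)]
    ext <;> simp
  · rcases lt_trichotomy s (2 / 3) with k | k | k
    · right; right; left
      refine ⟨3 * s - 1, ⟨by linarith, by linarith⟩, rfl, ?_⟩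
      unfold tri chd
      rw [clp1 (by linarith), clpm (by linarith) (by linarith), clp0 (by linarith), sg_not]
      ext <;> simp
    · right; right; right; left
      refine ⟨k, ?_⟩
      unfold tri
      rw [clp1 (by linarith), clp1 (by linarith), clp0 (by linarith)]
      ext <;> simp
    · right; right; right; right
      refine ⟨3 - 3 * s, ⟨by linarith, by linarith⟩, rfl, ?_⟩
      unfold tri chd
      rw [clp1 (by linarith), clp1 (by linarith), clpm (by linarith) (by linarith)]
      refine Prod.ext ?_ ?_ <;> dsimp only <;> ring

lemma chd_bdd {a b c : ℝ} (p : Bool) (ha : a ∈ Icc (0:ℝ) 1) (hb : b ∈ Icc (0:ℝ) 1) (hc : c ∈ Ioo (0:ℝ) 1) :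
    (chd a b (sg p) c).1 ^ 2 + (chd a b (sg p) c).2 ^ 2 ≤ 2 := by
  obtain ⟨a0, a1⟩ := ha
  obtain ⟨b0, b1⟩ := hb
  obtain ⟨c0, c1⟩ := hc
  have hx0 : 0 ≤ a + (b - a) * c := by nlinarith
  have hx1 : a + (b - a) * c ≤ 1 := by nlinarith
  have h2 : (b - a) ^ 2 ≤ 1 := by nlinarith
  have h3 : c * (1 - c) ≤ 1 := by nlinarith
  have h4 : 0 ≤ c * (1 - c) := mul_nonneg c0.le (by linarith)
  have h5 : (b - a) ^ 2 * (c * (1 - c)) ≤ 1 := by nlinarith [sq_nonneg (b - a)]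
  have h6 : 0 ≤ (b - a) ^ 2 * (c * (1 - c)) := by positivity
  have h7 : (sg p) ^ 2 = 1 := by cases p <;> simp [sg]
  show (a + (b - a) * c) ^ 2 + (sg p * ((b - a) ^ 2 * (c * (1 - c)))) ^ 2 ≤ 2
  rw [mul_pow, h7]
  nlinarith

end BK

namespace BK
open Set

section curves
variable {C K : Type} (own : K × Bool → C) (side : K → Bool) (l r : Itm C (K × Bool) → ℝ)

/-- foot of the near chord at a dart -/
def ft (d : K × Bool) (t : ℝ) : ℝ :=
  if d.2 then r (.d d) - t * (r (.d d) - l (.d d)) else l (.d d) + t * (r (.d d) - l (.d d))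

def crv (κ : K) (t s : ℝ) : ℝ × ℝ :=
  tri (l (.v (own (κ, false)))) (ft l r (κ, false) t) (ft l r (κ, true) t) (l (.v (own (κ, true))))
    (sg (side κ)) s

variable {own side l r} (hl : ∀ x, 0 < l x ∧ l x < r x ∧ r x < 1)
  (hd : ∀ x y, x ≠ y → r x < l y ∨ r y < l x) (hB : Book2 own side univ univ l)

include hl in
lemma ft_mem (d : K × Bool) {t : ℝ} (ht : t ∈ Ioo (0:ℝ) 1) : l (.d d) < ft l r d t ∧ ft l r d t < r (.d d) := by
  have h := (hl (.d d)).2.1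
  obtain ⟨t0, t1⟩ := ht
  unfold ft
  split_ifs <;> constructor <;> nlinarith

include hl in
lemma ft_inj (d : K × Bool) {t t' : ℝ} (h : ft l r d t = ft l r d t') : t = t' := by
  have h' := (hl (.d d)).2.1
  unfold ft at h
  have : (t - t') * (r (.d d) - l (.d d)) = 0 := by
    split_ifs at h <;> linarith
  rcases mul_eq_zero.mp this with k | k <;> linarith

include hl hd in
lemma ft_inj2 {d d' : K × Bool} {t t' : ℝ} (ht : t ∈ Ioo (0:ℝ) 1) (ht' : t' ∈ Ioo (0:ℝ) 1)
    (h : ft l r d t = ft l r d' t') : d = d' ∧ t = t' := by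
  have hdd : d = d' := by
    by_contra hne
    have h1 := ft_mem hl d ht
    have h2 := ft_mem hl d' ht'
    rcases hd (.d d) (.d d') (fun k => hne (by injection k)) with k | k <;> linarith
  subst hdd
  exact ⟨rfl, ft_inj hl _ h⟩

include hl hd in
lemma ft_v (d : K × Bool) {t : ℝ} (ht : t ∈ Ioo (0:ℝ) 1) (u : C) : l (.v u) ≠ ft l r d t := by
  intro h
  have h1 := ft_mem hl d ht
  have h2 := hl (.v u)
  rcases hd (.d d) (.v u) (by simp) with k | k <;> linarith

include hl hd in
lemma lv_inj {u w : C} (h : l (.v u) = l (.v w)) : u = w := by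
  by_contra hne
  have h1 := hl (.v u)
  have h2 := hl (.v w)
  rcases hd (.v u) (.v w) (fun k => hne (by injection k)) with k | k <;> linarith

include hl hd in
/-- moving points inside their intervals does not create crossings -/
lemma IL_pt (f : Itm C (K × Bool) → ℝ) (hf : ∀ x, l x ≤ f x ∧ f x ≤ r x) {a b c d : Itm C (K × Bool)}
    (h : ¬ IL (l a) (l b) (l c) (l d)) : ¬ IL (f a) (f b) (f c) (f d) := by
  intro k
  refine h (IL_map l f (fun _ => True) ?_ trivial trivial trivial trivial k)
  intro x y _ _ hxy
  have hne : x ≠ y := fun k => by rw [k] at hxy; exact lt_irrefl _ hxy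
  have h1 := hf x
  have h2 := hf y
  have h3 := hl x
  have h4 := hl y
  rcases hd x y hne with k | k <;> linarith

/-- position function with parameter `t` at the edge `κ`, `t'` elsewhere -/
def pf (l r : Itm C (K × Bool) → ℝ) (τ : K → ℝ) : Itm C (K × Bool) → ℝ
  | .v u => l (.v u)
  | .d d => ft l r d (τ d.1)

include hl in
lemma pf_mem (τ : K → ℝ) (hτ : ∀ κ, τ κ ∈ Ioo (0:ℝ) 1) (x : Itm C (K × Bool)) :
    l x ≤ pf l r τ x ∧ pf l r τ x ≤ r x := by
  rcases x with u | d
  · exact ⟨le_rfl, (hl _).2.1.le⟩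
  · exact ⟨(ft_mem hl d (hτ _)).1.le, (ft_mem hl d (hτ _)).2.le⟩

lemma IL_same {α : Type*} [LinearOrder α] (a b c : α) : ¬ IL a b a c := by
  rw [IL_iff]; grind

include hl hd hB in
lemma near_near {d d' : K × Bool} {t t' : ℝ} (ht : t ∈ Ioo (0:ℝ) 1) (ht' : t' ∈ Ioo (0:ℝ) 1)
    {c c' : ℝ} (hc : c ∈ Ioo (0:ℝ) 1) (hc' : c' ∈ Ioo (0:ℝ) 1)
    (h : chd (l (.v (own d))) (ft l r d t) (sg (side d.1)) c =
      chd (l (.v (own d'))) (ft l r d' t') (sg (side d'.1)) c') : d = d' ∧ t = t' ∧ c = c' := by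
  classical
  have hs := chd_page (ft_v hl hd d ht _) (ft_v hl hd d' ht' _) hc hc' h
  rw [hs] at h
  have hn : ¬ IL (l (.v (own d))) (ft l r d t) (l (.v (own d'))) (ft l r d' t') := by
    by_cases ho : own d = own d'
    · rw [ho]; exact IL_same _ _ _
    · by_cases he : d.1 = d'.1
      · by_cases hdd : t = t'
        · subst hdd
          exact IL_pt hl hd (pf l r (fun _ => t)) (pf_mem hl _ fun _ => ht)
            (hB.nn d d' trivial trivial hs ho)
        · -- same edge, different parameters: use the independent position function
          have key := hB.nn d d' trivial trivial hs ho
          let f : Itm C (K × Bool) → ℝ := fun x => match x with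
            | .v u => l (.v u)
            | .d e => if e = d then ft l r e t else ft l r e t'
          have hf : ∀ x, l x ≤ f x ∧ f x ≤ r x := by
            rintro (u | e)
            · exact ⟨le_rfl, (hl _).2.1.le⟩
            · simp only [f]
              split_ifs
              · exact ⟨(ft_mem hl e ht).1.le, (ft_mem hl e ht).2.le⟩
              · exact ⟨(ft_mem hl e ht').1.le, (ft_mem hl e ht').2.le⟩
          have := IL_pt hl hd f hf key
          have hne : d' ≠ d := fun k => ho (by rw [k])
          simpa [f, hne] using this
      · have := IL_pt hl hd (pf l r (fun κ => if κ = d.1 then t else t'))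
          (pf_mem hl _ fun κ => by split_ifs; exacts [ht, ht'])
            (hB.nn d d' trivial trivial hs ho)
        have he' : d'.1 ≠ d.1 := fun k => he k.symm
        simpa [pf, he'] using this
  rcases chd_meet (sg_ne _) (ft_v hl hd d ht _) (ft_v hl hd d' ht' _) hc hc' hn h with k | k
  · obtain ⟨k1, k2, k3⟩ := k
    exact ⟨(ft_inj2 hl hd ht ht' k2).1, (ft_inj2 hl hd ht ht' k2).2, k3⟩
  · exact absurd k.1 (ft_v hl hd d' ht' _)

include hl hd in
lemma ft_ne (κ : K) {t : ℝ} (ht : t ∈ Ioo (0:ℝ) 1) : ft l r (κ, false) t ≠ ft l r (κ, true) t := by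
  intro h
  have := (ft_inj2 hl hd ht ht h).1
  simp at this

include hl hd hB in
lemma near_far {d : K × Bool} {κ : K} {t t' : ℝ} (ht : t ∈ Ioo (0:ℝ) 1) (ht' : t' ∈ Ioo (0:ℝ) 1)
    {c c' : ℝ} (hc : c ∈ Ioo (0:ℝ) 1) (hc' : c' ∈ Ioo (0:ℝ) 1)
    (h : chd (l (.v (own d))) (ft l r d t) (sg (side d.1)) c =
      chd (ft l r (κ, false) t') (ft l r (κ, true) t') (sg (!side κ)) c') : False := by
  classical
  have hs := chd_page (ft_v hl hd d ht _) (ft_ne hl hd κ ht') hc hc' h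
  have hne : side d.1 ≠ side κ := by rw [hs]; simp
  rw [hs] at h
  have hk : κ ≠ d.1 := fun k => hne (by rw [k])
  have hn := IL_pt hl hd (pf l r (fun k => if k = d.1 then t else t'))
          (pf_mem hl _ fun κ => by split_ifs; exacts [ht, ht'])
            (hB.nf d (κ, false) trivial trivial hne)
  simp only [pf, fl, Bool.not_false, if_true, hk, if_false] at hn
  rcases chd_meet (sg_ne _) (ft_v hl hd d ht _) (ft_ne hl hd κ ht') hc hc' hn h with k | k
  · exact absurd k.1 (ft_v hl hd _ ht' _)
  · exact absurd k.1 (ft_v hl hd _ ht' _)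

include hl hd hB in
lemma far_far {κ κ' : K} {t t' : ℝ} (ht : t ∈ Ioo (0:ℝ) 1) (ht' : t' ∈ Ioo (0:ℝ) 1)
    {c c' : ℝ} (hc : c ∈ Ioo (0:ℝ) 1) (hc' : c' ∈ Ioo (0:ℝ) 1)
    (h : chd (ft l r (κ, false) t) (ft l r (κ, true) t) (sg (!side κ)) c =
      chd (ft l r (κ', false) t') (ft l r (κ', true) t') (sg (!side κ')) c') :
      κ = κ' ∧ t = t' ∧ c = c' := by
  classical
  have hs := chd_page (ft_ne hl hd κ ht) (ft_ne hl hd κ' ht') hc hc' h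
  rw [hs] at h
  have hs' : side κ = side κ' := by simpa using hs
  have hn : ¬ IL (ft l r (κ, false) t) (ft l r (κ, true) t) (ft l r (κ', false) t') (ft l r (κ', true) t') := by
    by_cases hk : κ = κ'
    · subst hk
      have a1 := ft_mem hl (κ, false) ht
      have a2 := ft_mem hl (κ, true) ht
      have a3 := ft_mem hl (κ, false) ht'
      have a4 := ft_mem hl (κ, true) ht'
      have b1 := (hl (.d (κ, false))).2.1
      have b2 := (hl (.d (κ, true))).2.1
      have q : ∀ {x y : ℝ}, x < y → ft l r (κ, false) x < ft l r (κ, false) y ∧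
          ft l r (κ, true) y < ft l r (κ, true) x := by
        intro x y hxy
        simp only [ft, if_true, Bool.false_eq_true, if_false]
        constructor <;> nlinarith
      rw [IL_iff]
      rcases lt_trichotomy t t' with k | k | k
      · have := q k
        rcases hd (.d (κ, false)) (.d (κ, true)) (by simp) with m | m <;> grind
      · subst k; grind
      · have := q k
        rcases hd (.d (κ, false)) (.d (κ, true)) (by simp) with m | m <;> grind
    · have hk' : κ' ≠ κ := Ne.symm hk
      have := IL_pt hl hd (pf l r (fun k => if k = κ then t else t'))
          (pf_mem hl _ fun κ => by split_ifs; exacts [ht, ht'])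
            (hB.ff (κ, false) (κ', false) trivial trivial hs' hk)
      simpa [pf, fl, hk'] using this
  rcases chd_meet (sg_ne _) (ft_ne hl hd κ ht) (ft_ne hl hd κ' ht') hc hc' hn h with k | k
  · obtain ⟨k1, k2, k3⟩ := k
    have := ft_inj2 hl hd ht ht' k1
    exact ⟨by simpa using this.1, this.2, k3⟩
  · have := (ft_inj2 hl hd ht ht' k.1).1
    simp at this

lemma chd_ne_zero {a b c : ℝ} {p : Bool} (hab : a ≠ b) (hc : c ∈ Ioo (0:ℝ) 1) (x : ℝ) :
    chd a b (sg p) c ≠ (x, 0) := by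
  intro h
  obtain ⟨y, hy, e⟩ := chd_sign (ε := sg p) hab hc
  rw [h] at e
  rcases mul_eq_zero.mp e.symm with k | k
  · exact sg_ne p k
  · linarith

include hl hd in
lemma crv_cases (κ : K) {t s : ℝ} (ht : t ∈ Ioo (0:ℝ) 1) (hs : s ∈ Ioo (0:ℝ) 1) :
    (∃ b : Bool, ∃ c ∈ Ioo (0:ℝ) 1, (s = if b then 1 - c / 3 else c / 3) ∧
      crv own side l r κ t s = chd (l (.v (own (κ, b)))) (ft l r (κ, b) t) (sg (side κ)) c) ∨
    (∃ c ∈ Ioo (0:ℝ) 1, s = (c + 1) / 3 ∧ crv own side l r κ t s =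
      chd (ft l r (κ, false) t) (ft l r (κ, true) t) (sg (!side κ)) c) ∨
    (∃ b : Bool, (s = if b then 2 / 3 else 1 / 3) ∧ crv own side l r κ t s = (ft l r (κ, b) t, 0)) := by
  rcases tri_cases (l (.v (own (κ, false)))) (ft l r (κ, false) t) (ft l r (κ, true) t) (l (.v (own (κ, true))))
    (side κ) hs with ⟨c, hc, e, h⟩ | ⟨e, h⟩ | ⟨c, hc, e, h⟩ | ⟨e, h⟩ | ⟨c, hc, e, h⟩
  · left; exact ⟨false, c, hc, by simp; linarith, h⟩
  · right; right; exact ⟨false, by simpa using e, h⟩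
  · right; left; exact ⟨c, hc, by linarith, h⟩
  · right; right; exact ⟨true, by simpa using e, h⟩
  · left; exact ⟨true, c, hc, by simp; linarith, h⟩

include hl hd hB in
theorem crv_inj {κ κ' : K} {t t' s s' : ℝ} (ht : t ∈ Ioo (0:ℝ) 1) (ht' : t' ∈ Ioo (0:ℝ) 1)
    (hs : s ∈ Ioo (0:ℝ) 1) (hs' : s' ∈ Ioo (0:ℝ) 1)
    (h : crv own side l r κ t s = crv own side l r κ' t' s') : κ = κ' ∧ t = t' ∧ s = s' := by
  rcases crv_cases (own := own) (side := side) hl hd κ ht hs with ⟨b, c, hc, e, k⟩ | ⟨c, hc, e, k⟩ | ⟨b, e, k⟩ <;>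
  rcases crv_cases (own := own) (side := side) hl hd κ' ht' hs' with ⟨b', c', hc', e', k'⟩ | ⟨c', hc', e', k'⟩ | ⟨b', e', k'⟩ <;>
  rw [k, k'] at h
  · obtain ⟨h1, h2, h3⟩ := near_near (d := (κ, b)) (d' := (κ', b')) hl hd hB ht ht' hc hc' h
    have hb : b = b' := congrArg Prod.snd h1
    exact ⟨congrArg Prod.fst h1, h2, by rw [e, e', hb, h3]⟩
  · exact (near_far (d := (κ, b)) hl hd hB ht ht' hc hc' h).elim
  · exact absurd h (chd_ne_zero (ft_v hl hd _ ht _) hc _)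
  · exact (near_far (d := (κ', b')) hl hd hB ht' ht hc' hc h.symm).elim
  · obtain ⟨h1, h2, h3⟩ := far_far hl hd hB ht ht' hc hc' h
    exact ⟨h1, h2, by rw [e, e', h3]⟩
  · exact absurd h (chd_ne_zero (ft_ne hl hd _ ht) hc _)
  · exact absurd h.symm (chd_ne_zero (ft_v hl hd _ ht' _) hc' _)
  · exact absurd h.symm (chd_ne_zero (ft_ne hl hd _ ht') hc' _)
  · obtain ⟨h1, h2⟩ := ft_inj2 hl hd ht ht' (congrArg Prod.fst h)
    have hb : b = b' := congrArg Prod.snd h1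
    exact ⟨congrArg Prod.fst h1, h2, by rw [e, e', hb]⟩

include hl hd in
theorem crv_v {κ : K} {t s : ℝ} (ht : t ∈ Ioo (0:ℝ) 1) (hs : s ∈ Ioo (0:ℝ) 1) (u : C) :
    crv own side l r κ t s ≠ (l (.v u), 0) := by
  intro h
  rcases crv_cases (own := own) (side := side) hl hd κ ht hs with ⟨b, c, hc, e, k⟩ | ⟨c, hc, e, k⟩ | ⟨b, e, k⟩ <;>
    rw [k] at h
  · exact absurd h (chd_ne_zero (ft_v hl hd _ ht _) hc _)
  · exact absurd h (chd_ne_zero (ft_ne hl hd _ ht) hc _)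
  · exact ft_v hl hd _ ht u (congrArg Prod.fst h).symm

include hl hd in
theorem crv_bdd {κ : K} {t s : ℝ} (ht : t ∈ Ioo (0:ℝ) 1) (hs : s ∈ Ioo (0:ℝ) 1) :
    (crv own side l r κ t s).1 ^ 2 + (crv own side l r κ t s).2 ^ 2 ≤ 2 := by
  have hv : ∀ x, l x ∈ Icc (0:ℝ) 1 := fun x => by
    have := hl x; exact ⟨by linarith, by linarith⟩
  have hf : ∀ d, ft l r d t ∈ Icc (0:ℝ) 1 := fun d => by
    have := hl (.d d); have := ft_mem hl d ht; exact ⟨by linarith, by linarith⟩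
  rcases crv_cases (own := own) (side := side) hl hd κ ht hs with ⟨b, c, hc, e, k⟩ | ⟨c, hc, e, k⟩ | ⟨b, e, k⟩ <;>
    rw [k]
  · exact chd_bdd _ (hv _) (hf _) hc
  · exact chd_bdd _ (hf _) (hf _) hc
  · have := hf (κ, b)
    show (ft l r (κ, b) t) ^ 2 + (0:ℝ) ^ 2 ≤ 2
    nlinarith [this.1, this.2]

end curves
end BK

namespace BK
open Set

section loops
variable {C K : Type} (own : K × Bool → C) (side : K → Bool) (l r : Itm C (K × Bool) → ℝ)

def lown : (K ⊕ C) × Bool → C := fun d => match d.1 with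
  | .inl e => own (e, d.2)
  | .inr u => u

def lside : K ⊕ C → Bool := Sum.elim side (fun _ => true)

def lpar : Itm C ((K ⊕ C) × Bool) → Itm C (K × Bool)
  | .v u => .v u
  | .d (.inl e, b) => .d (e, b)
  | .d (.inr u, _) => .v u

noncomputable def ll : Itm C ((K ⊕ C) × Bool) → ℝ
  | .v u => l (.v u)
  | .d (.inl e, b) => l (.d (e, b))
  | .d (.inr u, b) => l (.v u) + (if b then 2 else 6) * ((r (.v u) - l (.v u)) / 10)

noncomputable def lr : Itm C ((K ⊕ C) × Bool) → ℝ
  | .v u => l (.v u) + (r (.v u) - l (.v u)) / 10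
  | .d (.inl e, b) => r (.d (e, b))
  | .d (.inr u, b) => l (.v u) + (if b then 4 else 8) * ((r (.v u) - l (.v u)) / 10)

lemma IL_out {A B p q r s : ℝ} (hp : A ≤ p ∧ p ≤ B) (hq : A ≤ q ∧ q ≤ B)
    (hr : r ≤ A ∨ B < r) (hs : s ≤ A ∨ B < s) : ¬ IL p q r s := by
  rw [IL_iff]; grind

lemma IL_symm {α : Type*} [LinearOrder α] {p q r s : α} (h : ¬ IL p q r s) : ¬ IL r s p q := by
  rw [IL_iff] at *; grind

variable {own side l r} (hl : ∀ x, 0 < l x ∧ l x < r x ∧ r x < 1)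
  (hd : ∀ x y, x ≠ y → r x < l y ∨ r y < l x) (hB : Book2 own side univ univ l)

include hl in
lemma ll_bd (x) : l (lpar x) ≤ ll l r x ∧ ll l r x < lr l r x ∧ lr l r x ≤ r (lpar x) := by
  have h := hl (lpar x)
  rcases x with u | ⟨e | u, b⟩
  · simp only [lpar, ll, lr] at *
    refine ⟨le_rfl, ?_, ?_⟩ <;> linarith
  · simp only [lpar, ll, lr] at *
    exact ⟨le_rfl, h.2.1, le_rfl⟩
  · simp only [lpar, ll, lr] at *
    cases b <;> simp only [if_true, Bool.false_eq_true, if_false] <;>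
    refine ⟨?_, ?_, ?_⟩ <;> linarith

include hl hd in
lemma ll_sep (x y) (hxy : x ≠ y) : lr l r x < ll l r y ∨ lr l r y < ll l r x := by
  by_cases h : lpar x = lpar y
  · rcases x with u | ⟨e | u, b⟩ <;> rcases y with u' | ⟨e' | u', b'⟩ <;> simp only [lpar] at h
    · injection h with h; exact absurd (by rw [h]) hxy
    · cases h
    · injection h with h; subst h
      have := hl (.v u)
      cases b' <;> simp only [lr, ll, if_true, Bool.false_eq_true, if_false]
      · left; linarith
      · left; linarith
    · cases h
    · injection h with h; injection h with h1 h2; exact absurd (by rw [h1, h2]) hxy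
    · cases h
    · injection h with h; subst h
      have := hl (.v u)
      cases b <;> simp only [lr, ll, if_true, Bool.false_eq_true, if_false]
      · right; linarith
      · right; linarith
    · cases h
    · injection h with h; subst h
      have := hl (.v u)
      cases b <;> cases b' <;> simp only [lr, ll, if_true, Bool.false_eq_true, if_false]
      · exact absurd rfl hxy
      · right; linarith
      · left; linarith
      · exact absurd rfl hxy
  · have h1 := ll_bd hl x
    have h2 := ll_bd hl y
    rcases hd _ _ h with k | k
    · left; linarith
    · right; linarith

include hl hd in
lemma ll_out (u : C) (x) (h : lpar x ≠ .v u ∨ x = .v u) : ll l r x ≤ l (.v u) ∨ r (.v u) < ll l r x := by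
  rcases h with h | h
  · have h1 := ll_bd hl x
    rcases hd _ _ h with k | k
    · left; linarith
    · right; linarith
  · left; rw [h]; exact le_rfl

include hl in
lemma ll_in (u : C) (x) (h : lpar x = .v u) : l (.v u) ≤ ll l r x ∧ ll l r x ≤ r (.v u) := by
  have h1 := ll_bd hl x
  rw [h] at h1
  exact ⟨h1.1, by linarith⟩

include hl hd in
lemma ll_no (u : C) {a b c d} (ha : lpar a = .v u) (hb : lpar b = .v u)
    (hc : lpar c ≠ .v u ∨ c = .v u) (hd' : lpar d ≠ .v u ∨ d = .v u) :
    ¬ IL (ll l r a) (ll l r b) (ll l r c) (ll l r d) :=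
  IL_out (ll_in hl u a ha) (ll_in hl u b hb) (ll_out hl hd u c hc) (ll_out hl hd u d hd')

include hl hd hB in
theorem loop_book : Book2 (lown own) (lside side) univ univ (ll l r) := by
  refine ⟨?_, ?_, ?_, ?_⟩
  · intro x y _ _ h
    by_contra hn
    have h1 := ll_bd hl x
    have h2 := ll_bd hl y
    rcases ll_sep hl hd x y hn with k | k <;> linarith
  · rintro ⟨e | u, b⟩ ⟨e' | u', b'⟩ _ _ hs ho
    · exact hB.nn (e, b) (e', b') trivial trivial hs ho
    · refine IL_symm (ll_no hl hd u' rfl rfl (Or.inl ?_) (Or.inl ?_))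
      · intro k; injection k with k; exact ho k
      · simp [lpar]
    · refine (ll_no hl hd u rfl rfl (Or.inl ?_) (Or.inl ?_))
      · intro k; injection k with k; exact ho k.symm
      · simp [lpar]
    · refine (ll_no hl hd u rfl rfl (Or.inl ?_) (Or.inl ?_))
      · intro k; injection k with k; exact ho k.symm
      · intro k; injection k with k; exact ho k.symm
  · rintro ⟨e | u, b⟩ ⟨e' | u', b'⟩ _ _ hs ho
    · exact hB.ff (e, b) (e', b') trivial trivial hs (fun k => ho (by simpa using k))
    · exact IL_symm (ll_no hl hd u' rfl rfl (Or.inl (by simp [lpar, fl])) (Or.inl (by simp [lpar, fl])))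
    · exact (ll_no hl hd u rfl rfl (Or.inl (by simp [lpar, fl])) (Or.inl (by simp [lpar, fl])))
    · have : u' ≠ u := fun k => ho (by simp [k])
      exact (ll_no hl hd u rfl rfl (Or.inl (by simp [lpar, this])) (Or.inl (by simp [lpar, fl, this])))
  · rintro ⟨e | u, b⟩ ⟨e' | u', b'⟩ _ _ hs
    · exact hB.nf (e, b) (e', b') trivial trivial hs
    · refine IL_symm (ll_no hl hd u' rfl rfl ?_ (Or.inl (by simp [lpar])))
      by_cases k : lown own (Sum.inl e, b) = u'
      · right; rw [k]
      · left; intro m; injection m with m; exact k m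
    · exact (ll_no hl hd u rfl rfl (Or.inl (by simp [lpar])) (Or.inl (by simp [lpar, fl])))
    · exact absurd rfl hs

end loops

/-- all curves of the core -/
theorem core_curves {C K : Type} (own : K × Bool → C) (side : K → Bool) (l r : Itm C (K × Bool) → ℝ)
    (hl : ∀ x, 0 < l x ∧ l x < r x ∧ r x < 1)
    (hd : ∀ x y, x ≠ y → r x < l y ∨ r y < l x) (hB : Book2 own side univ univ l) :
    ∃ (X : C → ℝ × ℝ) (c : K ⊕ C → ℝ → ℝ → ℝ × ℝ), Function.Injective X ∧
      (∀ κ t, Continuous (c κ t)) ∧ (∀ κ t, c κ t 0 = X (lown own (κ, false))) ∧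
      (∀ κ t, c κ t 1 = X (lown own (κ, true))) ∧
      (∀ κ κ' t t' s s', t ∈ Ioo (0:ℝ) 1 → t' ∈ Ioo (0:ℝ) 1 → s ∈ Ioo (0:ℝ) 1 → s' ∈ Ioo (0:ℝ) 1 →
        c κ t s = c κ' t' s' → κ = κ' ∧ t = t' ∧ s = s') ∧
      (∀ κ t s u, t ∈ Ioo (0:ℝ) 1 → s ∈ Ioo (0:ℝ) 1 → c κ t s ≠ X u) ∧
      (∀ κ t s, t ∈ Ioo (0:ℝ) 1 → s ∈ Ioo (0:ℝ) 1 → (c κ t s).1 ^ 2 + (c κ t s).2 ^ 2 ≤ 2) ∧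
      (∀ u, (X u).1 ^ 2 + (X u).2 ^ 2 ≤ 2) := by
  have hl' : ∀ x, 0 < ll l r x ∧ ll l r x < lr l r x ∧ lr l r x < 1 := by
    intro x
    have h1 := ll_bd hl x
    have h2 := hl (lpar x)
    exact ⟨by linarith, h1.2.1, by linarith⟩
  have hd' := ll_sep hl hd
  have hB' := loop_book hl hd hB
  refine ⟨fun u => (l (.v u), 0), crv (lown own) (lside side) (ll l r) (lr l r), ?_, ?_, ?_, ?_, ?_, ?_, ?_, ?_⟩
  · intro u w h
    exact lv_inj hl hd (congrArg Prod.fst h)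
  · intro κ t; exact tri_cont _ _ _ _ _
  · intro κ t; exact tri_zero _ _ _ _ _
  · intro κ t; exact tri_one _ _ _ _ _
  · intro κ κ' t t' s s' h1 h2 h3 h4 h
    exact crv_inj hl' hd' hB' h1 h2 h3 h4 h
  · intro κ t s u h1 h2
    exact crv_v hl' hd' h1 h2 u
  · intro κ t s h1 h2
    exact crv_bdd hl' hd' h1 h2
  · intro u
    have := hl (.v u)
    show (l (.v u)) ^ 2 + (0:ℝ) ^ 2 ≤ 2
    nlinarith
end BK

namespace BK
open Set

section strands
variable {V E : Type} (own : E × Bool → V) (B : Set V)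

/-- the next dart of a strand -/
def Nx (d d' : E × Bool) : Prop := own d' = own (fl d) ∧ own d' ∉ B ∧ d' ≠ fl d

/-- the dart at position `k` of the strand which starts with `d0` -/
inductive At (d0 : E × Bool) : ℕ → E × Bool → Prop
  | zero : At d0 0 d0
  | succ (k : ℕ) (d d' : E × Bool) : At d0 k d → Nx own B d d' → At d0 (k + 1) d'

def Deg2 : Prop := ∀ d1 d2 d3 : E × Bool, own d1 ∉ B → own d2 = own d1 → own d3 = own d1 →
  d1 = d2 ∨ d1 = d3 ∨ d2 = d3

/-- two strands which are reverses of each other -/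
def Rev (d0 d1 : E × Bool) : Prop :=
  own d1 ∈ B ∧ ∃ i j d, At own B d0 i d ∧ At own B d1 j (fl d)

/-- the chosen strands -/
def Chosen (d0 : E × Bool) : Prop :=
  own d0 ∈ B ∧ ∀ d1, Rev own B d0 d1 → WellOrderingRel d0 d1

variable {own B}

theorem fl_ne (d : E × Bool) : fl d ≠ d := by
  rcases d with ⟨e, b⟩
  intro h
  have := congrArg Prod.snd h
  cases b <;> simp [fl] at this

theorem fl_pair {e : E} {b b' : Bool} (h : b ≠ b') : fl (e, b) = (e, b') := by
  revert h
  cases b <;> cases b' <;> simp [fl]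

theorem fl_inj {d d' : E × Bool} (h : fl d = fl d') : d = d' := by
  rw [← fl_fl d, h, fl_fl]

theorem Nx.flip {d d' : E × Bool} (h : Nx own B d d') : Nx own B (fl d') (fl d) := by
  obtain ⟨h1, h2, h3⟩ := h
  refine ⟨by rw [fl_fl]; exact h1.symm, by rw [← h1]; exact h2, ?_⟩
  rw [fl_fl]; exact h3.symm

theorem Nx.uniq (h2 : Deg2 own B) {d d' d'' : E × Bool} (h : Nx own B d d') (h' : Nx own B d d'') :
    d' = d'' := by
  rcases h2 d' d'' (fl d) h.2.1 (h'.1.trans h.1.symm) h.1.symm with k | k | k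
  · exact k
  · exact absurd k h.2.2
  · exact absurd k h'.2.2

theorem Nx.uniq_left (h2 : Deg2 own B) {d d' d'' : E × Bool} (h : Nx own B d' d) (h' : Nx own B d'' d) :
    d' = d'' := fl_inj (Nx.uniq h2 h.flip h'.flip)

theorem At.zero_eq {d0 d : E × Bool} (h : At own B d0 0 d) : d = d0 := by
  cases h; rfl

theorem At.pred {d0 d : E × Bool} {k : ℕ} (h : At own B d0 (k + 1) d) :
    ∃ p, At own B d0 k p ∧ Nx own B p d := by
  cases h with
  | succ k p d h1 h2 => exact ⟨p, h1, h2⟩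

theorem At.base {d0 d : E × Bool} {k : ℕ} (h : At own B d0 k d) (hd : own d ∈ B) : k = 0 ∧ d = d0 := by
  cases h with
  | zero => exact ⟨rfl, rfl⟩
  | succ k p d h1 h2 => exact absurd hd h2.2.1

theorem At.pred' {d0 d : E × Bool} {k : ℕ} (h0 : own d0 ∈ B) (h : At own B d0 k d) (hd : own d ∉ B) :
    ∃ m p, k = m + 1 ∧ At own B d0 m p ∧ Nx own B p d := by
  cases h with
  | zero => exact absurd h0 hd
  | succ k p d h1 h2 => exact ⟨k, p, rfl, h1, h2⟩

theorem At.func (h2 : Deg2 own B) {d0 : E × Bool} : ∀ {k : ℕ} {d d' : E × Bool},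
    At own B d0 k d → At own B d0 k d' → d = d' := by
  intro k
  induction k with
  | zero => intro d d' h h'; rw [h.zero_eq, h'.zero_eq]
  | succ k ih =>
    intro d d' h h'
    obtain ⟨p, hp, hn⟩ := h.pred
    obtain ⟨p', hp', hn'⟩ := h'.pred
    have := ih hp hp'
    subst this
    exact hn.uniq h2 hn'

theorem At.le {d0 d : E × Bool} {k : ℕ} (h : At own B d0 k d) : ∀ j ≤ k, ∃ d', At own B d0 j d' := by
  induction h with
  | zero => intro j hj; obtain rfl : j = 0 := by omega
            exact ⟨_, .zero⟩
  | succ k d d' h hn ih =>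
    intro j hj
    by_cases hk : j = k + 1
    · subst hk; exact ⟨_, .succ k d d' h hn⟩
    · exact ih j (by omega)

theorem At.uniq (h2 : Deg2 own B) {d0 d1 : E × Bool} (h0 : own d0 ∈ B) (h1 : own d1 ∈ B) :
    ∀ {i j : ℕ} {d : E × Bool}, At own B d0 i d → At own B d1 j d → d0 = d1 ∧ i = j := by
  intro i
  induction i with
  | zero =>
    intro j d h h'
    have e := h.zero_eq
    subst e
    have := h'.base h0
    exact ⟨this.2, this.1.symm⟩
  | succ i ih =>
    intro j d h h'
    obtain ⟨p, hp, hn⟩ := h.pred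
    obtain ⟨m, p', rfl, hp', hn'⟩ := h'.pred' h1 hn.2.1
    have := hn.uniq_left h2 hn'
    subst this
    have := ih hp hp'
    exact ⟨this.1, by rw [this.2]⟩

theorem At.rev_sum (h2 : Deg2 own B) {d0 d1 : E × Bool} (h1 : own d1 ∈ B) {i j : ℕ} {d : E × Bool}
    (h : At own B d0 i d) (h' : At own B d1 j (fl d)) {k : ℕ} {e : E × Bool} (hk : At own B d0 k e) :
    ∃ m, At own B d1 m (fl e) ∧ m + k = i + j := by
  have hzero : At own B d1 (j + i) (fl d0) := by
    clear hk
    induction i generalizing j d with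
    | zero => have := h.zero_eq; subst this; exact h'
    | succ i ih =>
      obtain ⟨p, hp, hn⟩ := h.pred
      have := ih hp (.succ j _ _ h' hn.flip)
      rwa [show j + (i + 1) = j + 1 + i by omega]
  induction hk with
  | zero => exact ⟨j + i, hzero, by omega⟩
  | succ k p e hp hn ih =>
    obtain ⟨m, hm, hs⟩ := ih
    have hb : own (fl p) ∉ B := by rw [← hn.1]; exact hn.2.1
    obtain ⟨m', q, rfl, hq, hqn⟩ := hm.pred' h1 hb
    have := hqn.uniq_left h2 hn.flip
    subst this
    exact ⟨m', hq, by omega⟩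

theorem Rev.symm {d0 d1 : E × Bool} (h0 : own d0 ∈ B) (h : Rev own B d0 d1) : Rev own B d1 d0 := by
  obtain ⟨h1, i, j, d, h, h'⟩ := h
  exact ⟨h0, j, i, fl d, h', by rwa [fl_fl]⟩

theorem Rev.func (h2 : Deg2 own B) {d0 d1 d2 : E × Bool} (h : Rev own B d0 d1) (h' : Rev own B d0 d2) :
    d1 = d2 := by
  obtain ⟨h1, i, j, d, k, k'⟩ := h
  obtain ⟨h1', i', j', d', l, l'⟩ := h'
  obtain ⟨m, hm, -⟩ := At.rev_sum h2 h1 k k' .zero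
  obtain ⟨m', hm', -⟩ := At.rev_sum h2 h1' l l' .zero
  exact (At.uniq h2 h1 h1' hm hm').1

theorem Rev.irrefl (h2 : Deg2 own B) {d0 : E × Bool} : ¬ Rev own B d0 d0 := by
  rintro ⟨h0, i, j, d, h, h'⟩
  obtain ⟨n, hn, -⟩ := At.rev_sum h2 h0 h h' .zero
  rcases Nat.even_or_odd' n with ⟨m, rfl | rfl⟩
  · obtain ⟨e, he⟩ := hn.le m (by omega)
    obtain ⟨m', hm', hs⟩ := At.rev_sum h2 h0 (At.zero) hn he
    obtain rfl : m' = m := by omega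
    exact fl_ne _ (hm'.func h2 he)
  · obtain ⟨e, he⟩ := hn.le m (by omega)
    obtain ⟨m', hm', hs⟩ := At.rev_sum h2 h0 (At.zero) hn he
    obtain rfl : m' = m + 1 := by omega
    obtain ⟨p, hp, hx⟩ := hm'.pred
    have := hp.func h2 he
    subst this
    exact hx.2.2 rfl

/-- a dart is covered by a strand -/
def Cov (own : E × Bool → V) (B : Set V) (d : E × Bool) : Prop :=
  ∃ d0 i, own d0 ∈ B ∧ (At own B d0 i d ∨ At own B d0 i (fl d))

theorem Cov.flip {d : E × Bool} (h : Cov own B d) : Cov own B (fl d) := by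
  obtain ⟨d0, i, h0, h⟩ := h
  refine ⟨d0, i, h0, ?_⟩
  rw [fl_fl]; exact h.symm

theorem Cov.step (h2 : Deg2 own B) {v : V} (hv : ∀ d, own d = v → Cov own B d) {d d' : E × Bool}
    (hd : own d = v) (hd' : own d' = own (fl d)) : Cov own B d' := by
  by_cases hb : own d' ∈ B
  · exact ⟨d', 0, hb, Or.inl .zero⟩
  by_cases he : d' = fl d
  · rw [he]; exact (hv d hd).flip
  have hn : Nx own B d d' := ⟨hd', hb, he⟩
  obtain ⟨d0, i, h0, h | h⟩ := hv d hd
  · exact ⟨d0, i + 1, h0, Or.inl (.succ i _ _ h hn)⟩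
  · obtain ⟨m, p, rfl, hp, hpn⟩ := h.pred' h0 (by rw [← hd']; exact hb)
    have := hpn.uniq_left h2 hn.flip
    subst this
    exact ⟨d0, m, h0, Or.inr hp⟩

/-- adjacency of vertices -/
def Adj (own : E × Bool → V) (u w : V) : Prop := ∃ d, own d = u ∧ own (fl d) = w

/-- the components -/
abbrev Comp (own : E × Bool → V) := Quot (Adj own)

theorem all_cov (h2 : Deg2 own B) (hr : ∀ v, ∃ b ∈ B, Quot.mk (Adj own) b = Quot.mk (Adj own) v)
    (d : E × Bool) : Cov own B d := by
  let P : V → Prop := fun v => ∀ d, own d = v → Cov own B d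
  have hP : ∀ u w, Adj own u w → P u = P w := by
    rintro u w ⟨d, rfl, rfl⟩
    apply propext
    constructor
    · intro h d' hd'
      exact Cov.step h2 h rfl hd'
    · intro h d' hd'
      exact Cov.step h2 h (d := fl d) rfl (by rw [fl_fl]; exact hd')
  obtain ⟨b, hb, hq⟩ := hr (own d)
  have := congrArg (Quot.lift P hP) hq
  have hPb : P b := fun d hd => ⟨d, 0, by rw [hd]; exact hb, Or.inl .zero⟩
  have hPd : P (own d) := by
    have h3 : P b = P (own d) := this
    rw [← h3]; exact hPb
  exact hPd d rfl

theorem At.comp {d0 d : E × Bool} {k : ℕ} (h : At own B d0 k d) :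
    Quot.mk (Adj own) (own d) = Quot.mk (Adj own) (own d0) := by
  induction h with
  | zero => rfl
  | succ k p d hp hn ih =>
    rw [← ih, hn.1]
    exact (Quot.sound ⟨p, rfl, rfl⟩).symm

theorem Chosen.not_rev (h2 : Deg2 own B) {σ σ' : E × Bool} (h : Chosen own B σ) (h' : Chosen own B σ')
    {i j : ℕ} {d : E × Bool} (k : At own B σ i d) (k' : At own B σ' j (fl d)) : False := by
  have hr : Rev own B σ σ' := ⟨h'.1, i, j, d, k, k'⟩
  have a := h.2 _ hr
  have b := h'.2 _ (hr.symm h.1)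
  exact asymm a b

theorem chosen_cov (h2 : Deg2 own B) (hr : ∀ v, ∃ b ∈ B, Quot.mk (Adj own) b = Quot.mk (Adj own) v)
    (e : E) : ∃ σ k b, Chosen own B σ ∧ At own B σ k (e, b) := by
  have key : ∀ d0 i d, own d0 ∈ B → At own B d0 i d →
      ∃ σ k, Chosen own B σ ∧ (At own B σ k d ∨ At own B σ k (fl d)) := by
    intro d0 i d h0 h
    by_cases hI : Chosen own B d0
    · exact ⟨d0, i, hI, Or.inl h⟩
    have : ∃ d1, Rev own B d0 d1 ∧ ¬ WellOrderingRel d0 d1 := by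
      by_contra hh
      push Not at hh
      exact hI ⟨h0, hh⟩
    obtain ⟨d1, hrv, hw⟩ := this
    have hne : d0 ≠ d1 := by rintro rfl; exact Rev.irrefl h2 hrv
    have hlt : WellOrderingRel d1 d0 := by
      rcases trichotomous_of WellOrderingRel d0 d1 with k | k | k
      · exact absurd k hw
      · exact absurd k hne
      · exact k
    have hI1 : Chosen own B d1 := by
      refine ⟨hrv.1, fun d2 h => ?_⟩
      rw [h.func h2 (hrv.symm h0)]
      exact hlt
    obtain ⟨h1, i', j', d', l, l'⟩ := hrv
    obtain ⟨m, hm, -⟩ := At.rev_sum h2 h1 l l' h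
    exact ⟨d1, m, hI1, Or.inr hm⟩
  obtain ⟨d0, i, h0, h⟩ := all_cov h2 hr (e, true)
  have : ∃ b, At own B d0 i (e, b) := by
    rcases h with h | h
    · exact ⟨_, h⟩
    · exact ⟨_, h⟩
  obtain ⟨b, hb⟩ := this
  obtain ⟨σ, k, hσ, h | h⟩ := key d0 i _ h0 hb
  · exact ⟨σ, k, _, hσ, h⟩
  · exact ⟨σ, k, _, hσ, h⟩

theorem chosen_edge (h2 : Deg2 own B) {σ σ' : E × Bool} (h : Chosen own B σ) (h' : Chosen own B σ')
    {i j : ℕ} {e : E} {b b' : Bool} (k : At own B σ i (e, b)) (k' : At own B σ' j (e, b')) :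
    σ = σ' ∧ i = j ∧ b = b' := by
  by_cases hb : b = b'
  · subst hb
    have := At.uniq h2 h.1 h'.1 k k'
    exact ⟨this.1, this.2, rfl⟩
  · exfalso
    refine Chosen.not_rev h2 h h' k (j := j) ?_
    have : fl (e, b) = (e, b') := fl_pair hb
    rwa [this]

/-- nonbase vertices as inner nodes of strands -/
theorem chosen_node (h2 : Deg2 own B) (hr : ∀ v, ∃ b ∈ B, Quot.mk (Adj own) b = Quot.mk (Adj own) v)
    {d : E × Bool} (hv : own d ∉ B) : ∃ σ k d', Chosen own B σ ∧ At own B σ k d' ∧ own (fl d') = own d := by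
  obtain ⟨σ, k, b, hσ, h⟩ := chosen_cov h2 hr d.1
  by_cases hb : d = (d.1, b)
  · rw [← hb] at h
    obtain ⟨m, p, rfl, hp, hn⟩ := h.pred' hσ.1 hv
    exact ⟨σ, m, p, hσ, hp, hn.1.symm⟩
  · have : fl (d.1, b) = d := by
      rcases d with ⟨e, c⟩
      cases b <;> cases c <;> simp_all [fl]
    exact ⟨σ, k, _, hσ, h, by rw [this]⟩

theorem chosen_node_uniq (h2 : Deg2 own B) {σ σ' : E × Bool} (h : Chosen own B σ) (h' : Chosen own B σ')
    {i j : ℕ} {d d' : E × Bool} (k : At own B σ i d) (k' : At own B σ' j d')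
    (ho : own (fl d) = own (fl d')) (hb : own (fl d) ∉ B) : σ = σ' ∧ i = j ∧ d = d' := by
  by_cases hd : d = d'
  · subst hd
    have := At.uniq h2 h.1 h'.1 k k'
    exact ⟨this.1, this.2, rfl⟩
  · exfalso
    have hn : Nx own B d (fl d') := ⟨ho.symm, by rw [← ho]; exact hb, fun c => hd (fl_inj c).symm⟩
    exact Chosen.not_rev h2 h h' (.succ i _ _ k hn) (j := j) (by rwa [fl_fl])

theorem exists_dart (hr : ∀ v, ∃ b ∈ B, Quot.mk (Adj own) b = Quot.mk (Adj own) v) {v : V} (hv : v ∉ B) :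
    ∃ d, own d = v := by
  by_contra hh
  push Not at hh
  let P : V → Prop := fun w => w = v
  have hP : ∀ u w, Adj own u w → P u = P w := by
    rintro u w ⟨d, rfl, rfl⟩
    apply propext
    exact ⟨fun h => absurd h (hh _), fun h => absurd h (hh _)⟩
  obtain ⟨b, hb, hq⟩ := hr v
  have h3 : P b = P v := congrArg (Quot.lift P hP) hq
  have h4 : b = v := by
    have : P v := rfl
    rw [← h3] at this
    exact this
  exact hv (h4 ▸ hb)

end strands
end BK

namespace BK
open Set

/-- simple arcs -/
def IsArc (a b : ℝ × ℝ) (A : Set (ℝ × ℝ)) : Prop :=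
  ∃ γ : Path a b, Function.Injective γ ∧ range γ = A

theorem IsArc.symm {a b : ℝ × ℝ} {A : Set (ℝ × ℝ)} (h : IsArc a b A) : IsArc b a A := by
  obtain ⟨γ, h1, h2⟩ := h
  refine ⟨γ.symm, ?_, by rw [Path.symm_range, h2]⟩
  intro s t hst
  have := h1 hst
  exact unitInterval.symm_bijective.injective this

theorem isArc_image {c : ℝ → ℝ × ℝ} (hc : Continuous c) {s t : ℝ} (hst : s < t) (hi : InjOn c (Icc s t)) :
    IsArc (c s) (c t) (c '' Icc s t) := by
  have mem : ∀ x : unitInterval, s + x.1 * (t - s) ∈ Icc s t := by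
    intro x
    have h1 := x.2.1; have h2 := x.2.2
    constructor <;> nlinarith
  refine ⟨⟨⟨fun x => c (s + x.1 * (t - s)), by fun_prop⟩, by simp, by simp⟩, ?_, ?_⟩
  · intro x y h
    have h3 : c (s + x.1 * (t - s)) = c (s + y.1 * (t - s)) := h
    have := hi (mem x) (mem y) h3
    have h4 : x.1 * (t - s) = y.1 * (t - s) := by linarith
    exact Subtype.ext (mul_right_cancel₀ (by linarith : t - s ≠ 0) h4)
  · ext y
    constructor
    · rintro ⟨x, rfl⟩
      exact ⟨_, mem x, rfl⟩
    · rintro ⟨z, hz, rfl⟩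
      have hp : 0 < t - s := by linarith
      refine ⟨⟨(z - s) / (t - s), div_nonneg (by linarith [hz.1]) hp.le, (div_le_one hp).2 (by linarith [hz.2])⟩, ?_⟩
      show c (s + (z - s) / (t - s) * (t - s)) = c z
      rw [div_mul_cancel₀ _ hp.ne']
      congr 1; ring

section asm
variable {V E : Type} {own : E × Bool → V} {B : Set V}

/-- the last dart of a strand -/
theorem At.last (h2 : Deg2 own B) {σ d d' : E × Bool} {k n : ℕ} (h : At own B σ k d) (h' : At own B σ n d')
    (hb : own (fl d) ∈ B) : n ≤ k := by
  by_contra hlt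
  obtain ⟨d'', h''⟩ := h'.le (k + 1) (by omega)
  obtain ⟨p, hp, hn⟩ := h''.pred
  have := hp.func h2 h
  subst this
  exact hn.2.1 (by rw [hn.1]; exact hb)

theorem exists_tau (h2 : Deg2 own B) (σ : E × Bool) : ∃ τ : ℕ → ℝ, τ 0 = 0 ∧ StrictMono τ ∧
    (∀ k d, At own B σ k d → own (fl d) ∈ B → τ (k + 1) = 1) ∧
    (∀ k d, At own B σ k d → own (fl d) ∉ B → τ (k + 1) < 1) := by
  by_cases h : ∃ n d, At own B σ n d ∧ own (fl d) ∈ B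
  · obtain ⟨n, d, hn, hd⟩ := h
    have hp : (0:ℝ) < n + 1 := by positivity
    refine ⟨fun k => k / (n + 1), by simp, ?_, ?_, ?_⟩
    · intro i j hij
      have : (i:ℝ) < j := by exact_mod_cast hij
      exact div_lt_div_of_pos_right this hp
    · intro k d' hk hd'
      have e : k = n := le_antisymm (hn.last h2 hk hd) (hk.last h2 hn hd')
      subst e
      show ((k + 1 : ℕ) : ℝ) / (k + 1) = 1
      push_cast
      exact div_self hp.ne'
    · intro k d' hk hd'
      have e1 : k ≤ n := hn.last h2 hk hd
      have e2 : k ≠ n := by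
        rintro rfl
        rw [hk.func h2 hn] at hd'
        exact hd' hd
      show ((k + 1 : ℕ) : ℝ) / (n + 1) < 1
      rw [div_lt_one hp]
      have : k + 1 < n + 1 := by omega
      exact_mod_cast this
  · push Not at h
    refine ⟨fun k => 1 - 1 / (k + 1), by simp, ?_, ?_, ?_⟩
    · intro i j hij
      have : (i:ℝ) < j := by exact_mod_cast hij
      have := one_div_lt_one_div_of_lt (by positivity : (0:ℝ) < i + 1) (by linarith : (i:ℝ) + 1 < j + 1)
      show 1 - 1 / ((i:ℝ) + 1) < 1 - 1 / (j + 1)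
      linarith
    · intro k d hk hd; exact absurd hd (h k d hk)
    · intro k d hk hd
      have : (0:ℝ) < 1 / (((k + 1 : ℕ) : ℝ) + 1) := by positivity
      show 1 - 1 / (((k + 1 : ℕ) : ℝ) + 1) < 1
      linarith

set_option maxHeartbeats 1000000 in
theorem assemble (h2 : Deg2 own B) (hr : ∀ v, ∃ b ∈ B, Quot.mk (Adj own) b = Quot.mk (Adj own) v)
    (own_fl : ∀ d, own (fl d) ≠ own d) (P : V → ℝ × ℝ) (Pinj : InjOn P B) (c : E × Bool → ℝ → ℝ × ℝ)
    (cc : ∀ σ, Chosen own B σ → Continuous (c σ)) (c0 : ∀ σ, Chosen own B σ → c σ 0 = P (own σ))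
    (c1 : ∀ σ k d, Chosen own B σ → At own B σ k d → own (fl d) ∈ B → c σ 1 = P (own (fl d)))
    (ci : ∀ σ σ' s s', Chosen own B σ → Chosen own B σ' → s ∈ Ioo (0:ℝ) 1 → s' ∈ Ioo (0:ℝ) 1 →
      c σ s = c σ' s' → σ = σ' ∧ s = s')
    (cv : ∀ σ s u, Chosen own B σ → s ∈ Ioo (0:ℝ) 1 → u ∈ B → c σ s ≠ P u) :
    ∃ pos : V → ℝ × ℝ, Function.Injective pos ∧ ∃ A : E → Set (ℝ × ℝ),
      (∀ e, IsArc (pos (own (e, false))) (pos (own (e, true))) (A e)) ∧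
      (∀ e e', e ≠ e' → ∀ x ∈ A e, x ∈ A e' → (∃ b, x = pos (own (e, b))) ∧ ∃ b, x = pos (own (e', b))) ∧
      (∀ z e, pos z ∈ A e → ∃ b, z = own (e, b)) := by
  classical
  rcases isEmpty_or_nonempty E with hE0 | hE0
  · have hB : ∀ v, v ∈ B := by
      intro v
      by_contra hv
      obtain ⟨d, -⟩ := exists_dart hr hv
      exact hE0.elim d.1
    exact ⟨P, fun u w h => Pinj (hB u) (hB w) h, fun _ => ∅, fun e => hE0.elim e, fun e => hE0.elim e,
      fun _ e => hE0.elim e⟩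
  choose τ τ0 τm τ1 τlt using exists_tau (own := own) (B := B) h2
  have hnode : ∀ v, v ∉ B → ∃ q : (E × Bool) × ℕ, ∃ d, Chosen own B q.1 ∧ At own B q.1 q.2 d ∧ own (fl d) = v := by
    intro v hv
    obtain ⟨d, rfl⟩ := exists_dart hr hv
    obtain ⟨σ, k, d', h⟩ := chosen_node h2 hr hv
    exact ⟨(σ, k), d', h⟩
  choose! q dq hq using hnode
  let pos : V → ℝ × ℝ := fun v => if v ∈ B then P v else c (q v).1 (τ (q v).1 ((q v).2 + 1))
  have posB : ∀ v ∈ B, pos v = P v := fun v hv => if_pos hv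
  have posN : ∀ v, v ∉ B → pos v = c (q v).1 (τ (q v).1 ((q v).2 + 1)) := fun v hv => if_neg hv
  have τpos : ∀ σ k, 0 < τ σ (k + 1) := by
    intro σ k
    rw [← τ0 σ]; exact τm σ (by omega)
  have hend : ∀ σ k d, Chosen own B σ → At own B σ k d → c σ (τ σ (k + 1)) = pos (own (fl d)) := by
    intro σ k d hσ hk
    by_cases hb : own (fl d) ∈ B
    · rw [posB _ hb, τ1 σ k d hk hb, c1 σ k d hσ hk hb]
    · rw [posN _ hb]
      obtain ⟨h1, h3, h4⟩ := hq _ hb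
      obtain ⟨e1, e2, -⟩ := chosen_node_uniq h2 h1 hσ h3 hk h4 (by rw [h4]; exact hb)
      rw [e1, e2]
  have hstart : ∀ σ k d, Chosen own B σ → At own B σ k d → c σ (τ σ k) = pos (own d) := by
    intro σ k d hσ hk
    cases hk with
    | zero => rw [τ0, c0 σ hσ, posB _ hσ.1]
    | succ m p d hp hn => rw [hend σ m p hσ hp, hn.1]
  have hle : ∀ σ k d, At own B σ k d → τ σ (k + 1) ≤ 1 := by
    intro σ k d hk
    by_cases hb : own (fl d) ∈ B
    · exact (τ1 σ k d hk hb).le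
    · exact (τlt σ k d hk hb).le
  have hin : ∀ v, v ∉ B → τ (q v).1 ((q v).2 + 1) ∈ Ioo (0:ℝ) 1 := by
    intro v hv
    obtain ⟨h1, h3, h4⟩ := hq _ hv
    exact ⟨τpos _ _, τlt _ _ _ h3 (by rw [h4]; exact hv)⟩
  have pinj : Function.Injective pos := by
    intro v w h
    by_cases hv : v ∈ B <;> by_cases hw : w ∈ B
    · rw [posB _ hv, posB _ hw] at h; exact Pinj hv hw h
    · rw [posB _ hv, posN _ hw] at h
      exact absurd h.symm (cv _ _ _ (hq _ hw).1 (hin _ hw) hv)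
    · rw [posN _ hv, posB _ hw] at h
      exact absurd h (cv _ _ _ (hq _ hv).1 (hin _ hv) hw)
    · rw [posN _ hv, posN _ hw] at h
      obtain ⟨e1, e2⟩ := ci _ _ _ _ (hq _ hv).1 (hq _ hw).1 (hin _ hv) (hin _ hw) h
      have a := (hq _ hv).2
      have b := (hq _ hw).2
      rw [e1] at a e2
      have e3 : (q v).2 = (q w).2 := by
        have := (τm _).injective e2
        omega
      rw [e3] at a
      have := a.1.func h2 b.1
      rw [← a.2, ← b.2, this]
  choose sg kk bb hsg using chosen_cov (own := own) (B := B) h2 hr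
  have hlt : ∀ e, τ (sg e) (kk e) < τ (sg e) (kk e + 1) := fun e => τm _ (by omega)
  have h0 : ∀ e, 0 ≤ τ (sg e) (kk e) := fun e => by rw [← τ0 (sg e)]; exact (τm _).monotone (by omega)
  -- every parameter is an end or in the interior
  have tri : ∀ e s, s ∈ Icc (τ (sg e) (kk e)) (τ (sg e) (kk e + 1)) → s ∈ Ioo (0:ℝ) 1 ∨
      (s = τ (sg e) (kk e) ∧ own (e, bb e) ∈ B) ∨ (s = τ (sg e) (kk e + 1) ∧ own (fl (e, bb e)) ∈ B) := by
    intro e s hs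
    have hA := (hsg e).2
    by_cases hs0 : s = 0
    · right; left
      have : τ (sg e) (kk e) = 0 := le_antisymm (hs0 ▸ hs.1) (h0 e)
      refine ⟨by rw [this, hs0], ?_⟩
      have hk : kk e = 0 := by
        rw [← τ0 (sg e)] at this; exact (τm _).injective this
      rw [hk] at hA
      rw [hA.zero_eq]; exact (hsg e).1.1
    by_cases hs1 : s = 1
    · right; right
      have h3 := hle _ _ _ hA
      have : τ (sg e) (kk e + 1) = 1 := le_antisymm h3 (hs1 ▸ hs.2)
      refine ⟨by rw [this, hs1], ?_⟩
      by_contra hb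
      have := τlt _ _ _ hA hb
      linarith
    · left
      refine ⟨lt_of_le_of_ne ((h0 e).trans hs.1) (Ne.symm hs0), lt_of_le_of_ne (hs.2.trans (hle _ _ _ hA)) hs1⟩
  have hS : ∀ e, c (sg e) (τ (sg e) (kk e)) = pos (own (e, bb e)) := fun e => hstart _ _ _ (hsg e).1 (hsg e).2
  have hE : ∀ e, c (sg e) (τ (sg e) (kk e + 1)) = pos (own (fl (e, bb e))) :=
    fun e => hend _ _ _ (hsg e).1 (hsg e).2
  -- a curve point which is a base position is an end
  have tri' : ∀ e s, s ∈ Icc (τ (sg e) (kk e)) (τ (sg e) (kk e + 1)) → (s ∈ Ioo (0:ℝ) 1 ∧ ∀ u ∈ B, c (sg e) s ≠ P u) ∨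
      (∃ b, s = (if b = bb e then τ (sg e) (kk e) else τ (sg e) (kk e + 1)) ∧ c (sg e) s = pos (own (e, b)) ∧ own (e, b) ∈ B) := by
    intro e s hs
    rcases tri e s hs with h | ⟨h, h'⟩ | ⟨h, h'⟩
    · left; exact ⟨h, fun u hu => cv _ _ _ (hsg e).1 h hu⟩
    · right; exact ⟨bb e, by simp [h], by rw [h, hS], h'⟩
    · right; exact ⟨!(bb e), by simp [h], by rw [h, hE, fl], h'⟩
  have inj : ∀ e, InjOn (c (sg e)) (Icc (τ (sg e) (kk e)) (τ (sg e) (kk e + 1))) := by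
    intro e s hs t ht h
    rcases tri' e s hs with ⟨h1, h1'⟩ | ⟨b, h1, h1', h1''⟩ <;> rcases tri' e t ht with ⟨h3, h3'⟩ | ⟨b', h3, h3', h3''⟩
    · exact (ci _ _ _ _ (hsg e).1 (hsg e).1 h1 h3 h).2
    · rw [h3', posB _ h3''] at h; exact absurd h (h1' _ h3'')
    · rw [h1', posB _ h1''] at h; exact absurd h.symm (h3' _ h1'')
    · rw [h1', h3'] at h
      have := pinj h
      have hb : b = b' := by
        by_contra hb
        have hf := own_fl (e, b)
        rw [fl_pair hb] at hf
        exact hf this.symm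
      rw [h1, h3, hb]
  have nodeP : ∀ e k, τ (sg e) k ∈ Icc (τ (sg e) (kk e)) (τ (sg e) (kk e + 1)) →
      ∃ b, c (sg e) (τ (sg e) k) = pos (own (e, b)) := by
    intro e k hk
    have a1 := (τm (sg e)).le_iff_le.1 hk.1
    have a2 := (τm (sg e)).le_iff_le.1 hk.2
    rcases (by omega : k = kk e ∨ k = kk e + 1) with rfl | rfl
    · exact ⟨_, hS e⟩
    · exact ⟨_, hE e⟩
  refine ⟨pos, pinj, fun e => c (sg e) '' Icc (τ (sg e) (kk e)) (τ (sg e) (kk e + 1)), ?_, ?_, ?_⟩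
  · intro e
    have := isArc_image (cc _ (hsg e).1) (hlt e) (inj e)
    rw [hS, hE] at this
    cases hb : bb e
    · simpa [hb, fl] using this
    · rw [hb] at this
      exact this.symm
  · rintro e e' hne x ⟨s, hs, rfl⟩ ⟨s', hs', h⟩
    rcases tri' e s hs with ⟨h1, h1'⟩ | ⟨b, h1, h1', h1''⟩ <;>
      rcases tri' e' s' hs' with ⟨h3, h3'⟩ | ⟨b', h3, h3', h3''⟩
    · obtain ⟨a1, a2⟩ := ci _ _ _ _ (hsg e).1 (hsg e').1 h1 h3 h.symm
      subst a2
      rw [← a1] at hs' h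
      have hA := (hsg e).2
      have hA' := (hsg e').2
      rw [← a1] at hA'
      have hk : kk e ≠ kk e' := by
        intro hk
        rw [← hk] at hA'
        exact hne (congrArg Prod.fst (hA.func h2 hA'))
      have : ∃ k, s = τ (sg e) k := by
        rcases Nat.lt_or_gt_of_ne hk with hk | hk
        · refine ⟨kk e + 1, le_antisymm hs.2 (le_trans ((τm (sg e)).monotone (by omega)) hs'.1)⟩
        · refine ⟨kk e, le_antisymm (le_trans hs'.2 ((τm (sg e)).monotone (by omega))) hs.1⟩
      obtain ⟨k, rfl⟩ := this
      refine ⟨nodeP e k hs, ?_⟩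
      have := nodeP e' k (by rw [← a1]; exact hs')
      rwa [← a1] at this
    · rw [h3', posB _ h3''] at h; exact absurd h.symm (h1' _ h3'')
    · rw [h1', posB _ h1''] at h; exact absurd h (h3' _ h1'')
    · exact ⟨⟨b, h1'⟩, ⟨b', by rw [← h, h3']⟩⟩
  · rintro z e ⟨s, hs, h⟩
    suffices ∃ b, c (sg e) s = pos (own (e, b)) by
      obtain ⟨b, hb⟩ := this
      exact ⟨b, pinj (h.symm.trans hb)⟩
    rcases tri' e s hs with ⟨h1, h1'⟩ | ⟨b, h1, h1', h1''⟩
    · by_cases hz : z ∈ B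
      · rw [posB _ hz] at h; exact absurd h (h1' _ hz)
      · rw [posN _ hz] at h
        obtain ⟨a1, a2⟩ := ci _ _ _ _ (hsg e).1 (hq _ hz).1 h1 (hin _ hz) h
        rw [a2, ← a1] at hs ⊢
        exact nodeP e _ hs
    · exact ⟨b, h1'⟩

end asm
end BK

namespace BK
open Set

theorem IsArc.trans {a b c : ℝ × ℝ} {A A' : Set (ℝ × ℝ)} (h : IsArc a b A) (h' : IsArc b c A')
    (hi : A ∩ A' ⊆ {b}) : IsArc a c (A ∪ A') := by
  obtain ⟨γ, h1, rfl⟩ := h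
  obtain ⟨δ, h3, rfl⟩ := h'
  have key : ∀ s t : unitInterval, γ s = δ t → s = 1 ∧ t = 0 := by
    intro s t h
    have hb : γ s = b := hi ⟨⟨s, rfl⟩, ⟨t, h.symm⟩⟩
    exact ⟨h1 (hb.trans γ.target.symm), h3 ((h.symm.trans hb).trans δ.source.symm)⟩
  refine ⟨γ.trans δ, ?_, Path.trans_range γ δ⟩
  intro s t h
  rw [Path.trans_apply, Path.trans_apply] at h
  split_ifs at h with hs ht ht
  · have := congrArg Subtype.val (h1 h)
    exact Subtype.ext (by simpa using this)
  · obtain ⟨-, k2⟩ := key _ _ h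
    have := congrArg Subtype.val k2
    simp only [Icc.coe_zero] at this
    push Not at ht
    linarith
  · obtain ⟨-, k2⟩ := key _ _ h.symm
    have := congrArg Subtype.val k2
    simp only [Icc.coe_zero] at this
    push Not at hs
    linarith
  · have := congrArg Subtype.val (h3 h)
    simp only at this
    exact Subtype.ext (by linarith)

theorem IsArc.curve {a b : ℝ × ℝ} {A : Set (ℝ × ℝ)} (h : IsArc a b A) :
    ∃ c : ℝ → ℝ × ℝ, Continuous c ∧ InjOn c (Icc 0 1) ∧ c 0 = a ∧ c 1 = b ∧ c '' Icc 0 1 = A := by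
  obtain ⟨γ, h1, rfl⟩ := h
  have ev : ∀ s (hs : s ∈ Icc (0:ℝ) 1), γ.extend s = γ ⟨s, hs⟩ := fun s hs => Path.extend_apply γ hs
  refine ⟨γ.extend, γ.continuous_extend, ?_, by simp, by simp, ?_⟩
  · intro s hs t ht h
    rw [ev s hs, ev t ht] at h
    exact congrArg Subtype.val (h1 h)
  · ext x
    constructor
    · rintro ⟨s, hs, rfl⟩
      rw [ev s hs]; exact ⟨_, rfl⟩
    · rintro ⟨s, rfl⟩
      exact ⟨s.1, s.2, ev s.1 s.2⟩

/-- the two drawings, as drawings of the two sides of the union -/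
structure Two {V E : Type} (own : E × Bool → V) (side : E → Bool) (T : Fin 3 → V) (Sd : Bool → Set V)
    (p : Bool → V → ℝ × ℝ) (γ : E → ℝ → ℝ × ℝ) : Prop where
  own_fl : ∀ d, own (fl d) ≠ own d
  cover : ∀ v, ∃ b, v ∈ Sd b
  inter : ∀ v b b', b ≠ b' → v ∈ Sd b → v ∈ Sd b' → v ∈ range T
  tm : ∀ i b, T i ∈ Sd b
  tinj : Function.Injective T
  own_mem : ∀ d, own d ∈ Sd (side d.1)
  pinj : ∀ b, InjOn (p b) (Sd b)
  gc : ∀ e, Continuous (γ e)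
  gi : ∀ e, InjOn (γ e) (Icc 0 1)
  ge : ∀ d, γ d.1 (endt d.2) = p (side d.1) (own d)
  gx : ∀ e e' s t, e ≠ e' → side e = side e' → s ∈ Icc (0:ℝ) 1 → t ∈ Icc (0:ℝ) 1 → γ e s = γ e' t →
    ∃ b b', own (e, b) = own (e', b') ∧ γ e s = p (side e) (own (e, b))
  gv : ∀ e s a, s ∈ Icc (0:ℝ) 1 → a ∈ Sd (side e) → γ e s = p (side e) a → ∃ b, a = own (e, b)
  face : ∀ b, ∃ x0, x0 ∉ (⋃ e ∈ side ⁻¹' {b}, γ e '' Icc 0 1) ∪ p b '' Sd b ∧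
    ∀ i, p b (T i) ∈ closure (connectedComponentIn ((⋃ e ∈ side ⁻¹' {b}, γ e '' Icc 0 1) ∪ p b '' Sd b)ᶜ x0)

/-- core vertices -/
def core {V E : Type} (own : E × Bool → V) (T : Fin 3 → V) : Set V :=
  range T ∪ {v | ∃ d : Fin 3 → E × Bool, Function.Injective d ∧ ∀ i, own (d i) = v}

section two
variable {V E : Type} {own : E × Bool → V} {side : E → Bool} {T : Fin 3 → V} {Sd : Bool → Set V}
    {p : Bool → V → ℝ × ℝ} {γ : E → ℝ → ℝ × ℝ}

/-- parameters of legs -/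
noncomputable def leg (b : Bool) (s : ℝ) : ℝ := if b then 1 - s / 3 else s / 3

theorem leg_mem (b : Bool) {s : ℝ} (hs : s ∈ Icc (0:ℝ) 1) : leg b s ∈ Icc (0:ℝ) 1 := by
  obtain ⟨h1, h2⟩ := hs
  cases b <;> simp only [leg] <;> constructor <;> norm_num <;> linarith

theorem leg_inj {b b' : Bool} {s s' : ℝ} (hs : s ∈ Icc (0:ℝ) 1) (hs' : s' ∈ Icc (0:ℝ) 1)
    (h : leg b s = leg b' s') : b = b' := by
  obtain ⟨h1, h2⟩ := hs
  obtain ⟨h1', h2'⟩ := hs'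
  cases b <;> cases b' <;> simp [leg] at h ⊢ <;> linarith

theorem leg_end {b b' : Bool} {s : ℝ} (hs : s ∈ Icc (0:ℝ) 1)
    (h : leg b s = endt b') : b' = b ∧ s = 0 := by
  obtain ⟨h1, h2⟩ := hs
  cases b <;> cases b' <;> simp [leg, endt] at h ⊢ <;> linarith

theorem leg_cont (b : Bool) : Continuous (leg b) := by
  cases b
  · have : leg false = fun s => s / 3 := by ext s; simp [leg]
    rw [this]; fun_prop
  · have : leg true = fun s => 1 - s / 3 := by ext s; simp [leg]
    rw [this]; fun_prop

theorem Two.side_eq (h : Two own side T Sd p γ) {b : Bool} {d : E × Bool} (hv : own d ∈ Sd b)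
    (hT : own d ∉ range T) : side d.1 = b := by
  by_contra hb
  exact hT (h.inter _ _ _ hb (h.own_mem d) hv)

theorem Two.leg_meet (h : Two own side T Sd p γ) {d d' : E × Bool} {s t : ℝ} (hs : s ∈ Icc (0:ℝ) 1)
    (ht : t ∈ Icc (0:ℝ) 1) (hd : side d.1 = side d'.1) (he : γ d.1 (leg d.2 s) = γ d'.1 (leg d'.2 t)) :
    d = d' ∨ (own d = own d' ∧ s = 0) := by
  by_cases hE : d.1 = d'.1
  · left
    rw [← hE] at he
    have := h.gi _ (leg_mem _ hs) (leg_mem _ ht) he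
    exact Prod.ext hE (leg_inj hs ht this)
  · right
    obtain ⟨b, b', h1, h2⟩ := h.gx _ _ _ _ hE hd (leg_mem _ hs) (leg_mem _ ht) he
    have e1 := h.ge (d.1, b)
    have e2 := h.ge (d'.1, b')
    simp only at e1 e2
    have k1 := leg_end hs (h.gi _ (leg_mem _ hs) (endt_mem b) (h2.trans e1.symm))
    have k2 := leg_end ht (h.gi _ (leg_mem _ ht) (endt_mem b') (by rw [← he, h2, e2, ← h1, hd]))
    rw [k1.1, k2.1] at h1
    exact ⟨h1, k1.2⟩

theorem Two.core_countable (h : Two own side T Sd p γ) : (core own T).Countable := by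
  have key : ∀ b, {v | v ∈ Sd b ∧ v ∉ range T ∧ ∃ d : Fin 3 → E × Bool, Function.Injective d ∧
      ∀ i, own (d i) = v}.Countable := by
    intro b
    set Z := {v | v ∈ Sd b ∧ v ∉ range T ∧ ∃ d : Fin 3 → E × Bool, Function.Injective d ∧
      ∀ i, own (d i) = v} with hZ
    have hz : ∀ z : Z, ∃ d : Fin 3 → E × Bool, Function.Injective d ∧ ∀ i, own (d i) = z := fun z => z.2.2.2
    choose d di dz using hz
    have hs : ∀ z i, side (d z i).1 = b := by
      intro z i
      apply h.side_eq
      · rw [dz]; exact z.2.1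
      · rw [dz]; exact z.2.2.1
    have : Countable Z := by
      refine moore (fun z i s => γ (d z i).1 (leg (d z i).2 s)) ?_ ?_ ?_ ?_
      · intro z i
        exact (h.gc _).comp (leg_cont _)
      · intro z i j
        have : ∀ i, γ (d z i).1 (leg (d z i).2 0) = p b z := by
          intro i
          have e1 := h.ge (d z i)
          rw [dz, hs] at e1
          rw [← e1]
          congr 1
          cases (d z i).2 <;> simp [leg, endt]
        rw [this, this]
      · intro z i j s t h1 h2 hij he
        rcases h.leg_meet h1 h2 (by rw [hs, hs]) he with k | k
        · exact absurd (di z k) hij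
        · exact k.2
      · intro z z' i j s t h1 h2 he
        apply Subtype.ext
        rcases h.leg_meet h1 h2 (by rw [hs, hs]) he with k | k
        · rw [← dz z i, ← dz z' j, k]
        · rw [← dz z i, ← dz z' j, k.1]
    exact this
  refine Countable.mono ?_ (((finite_range T).countable).union (countable_iUnion key))
  rintro v (hv | hv)
  · left; exact hv
  · by_cases hT : v ∈ range T
    · left; exact hT
    · right
      obtain ⟨b, hb⟩ := h.cover v
      exact mem_iUnion.2 ⟨b, hb, hT, hv⟩

/-- representatives of components without core vertices -/
noncomputable def reps (own : E × Bool → V) (T : Fin 3 → V) : Set V :=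
  {v | (∀ c ∈ core own T, Quot.mk (Adj own) c ≠ Quot.mk (Adj own) v) ∧ (Quot.mk (Adj own) v).out = v}

/-- base vertices -/
noncomputable def bas (own : E × Bool → V) (T : Fin 3 → V) : Set V := core own T ∪ reps own T

theorem bas_deg2 : Deg2 own (bas own T) := by
  intro d1 d2 d3 h1 h2 h3
  by_contra hh
  push Not at hh
  apply h1
  left; right
  refine ⟨![d1, d2, d3], ?_, ?_⟩
  · intro i j hij
    obtain ⟨a, b, c⟩ := hh
    fin_cases i <;> fin_cases j <;> simp_all
  · intro i
    fin_cases i <;> simp [h2, h3]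

theorem bas_reach (v : V) : ∃ b ∈ bas own T, Quot.mk (Adj own) b = Quot.mk (Adj own) v := by
  by_cases h : ∃ c ∈ core own T, Quot.mk (Adj own) c = Quot.mk (Adj own) v
  · obtain ⟨c, hc, hq⟩ := h
    exact ⟨c, Or.inl hc, hq⟩
  · push Not at h
    have e : Quot.mk (Adj own) (Quot.mk (Adj own) v).out = Quot.mk (Adj own) v := Quot.out_eq _
    refine ⟨(Quot.mk (Adj own) v).out, Or.inr ⟨?_, ?_⟩, e⟩
    · rw [e]; exact h
    · rw [e]

theorem At.comp' {B : Set V} {d0 d : E × Bool} {k : ℕ} (h : At own B d0 k d) :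
    Quot.mk (Adj own) (own (fl d)) = Quot.mk (Adj own) (own d0) := by
  rw [← h.comp]
  exact (Quot.sound ⟨d, rfl, rfl⟩).symm

theorem end_core {σ d : E × Bool} {k : ℕ} (h : At own (bas own T) σ k d) (h0 : own σ ∈ core own T)
    (h1 : own (fl d) ∈ bas own T) : own (fl d) ∈ core own T := by
  rcases h1 with h1 | h1
  · exact h1
  · exact absurd h.comp'.symm (h1.1 _ h0)

theorem end_reps {σ d : E × Bool} {k : ℕ} (h : At own (bas own T) σ k d) (h0 : own σ ∈ reps own T)
    (h1 : own (fl d) ∈ bas own T) : own (fl d) = own σ := by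
  rcases h1 with h1 | h1
  · exact absurd h.comp' (h0.1 _ h1)
  · rw [← h1.2, ← h0.2, h.comp']

theorem Two.side_const (h : Two own side T Sd p γ) {σ d : E × Bool} {k : ℕ} (ha : At own (bas own T) σ k d) :
    side d.1 = side σ.1 := by
  induction ha with
  | zero => rfl
  | succ k p d hp hn ih =>
    rw [← ih]
    apply h.side_eq
    · rw [hn.1]; exact h.own_mem (fl p)
    · intro k; exact hn.2.1 (Or.inl (Or.inl k))

end two
end BK

namespace BK
open Set

section strandarcs
variable {V E : Type} {own : E × Bool → V} {side : E → Bool} {T : Fin 3 → V} {Sd : Bool → Set V}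
    {p : Bool → V → ℝ × ℝ} {γ : E → ℝ → ℝ × ℝ}

theorem dart_cases (d : E × Bool) (c : Bool) : (d.1, c) = d ∨ (d.1, c) = fl d := by
  rcases d with ⟨e, b⟩
  by_cases h : b = c
  · left; rw [h]
  · right; rw [fl_pair h]

/-- the point set of an initial piece of a strand -/
def strandSet (own : E × Bool → V) (T : Fin 3 → V) (γ : E → ℝ → ℝ × ℝ) (σ : E × Bool) (n : ℕ) : Set (ℝ × ℝ) :=
  {x | ∃ k ≤ n, ∃ d, At own (bas own T) σ k d ∧ x ∈ γ d.1 '' Icc 0 1}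

theorem Two.edge_arc (h : Two own side T Sd p γ) (d : E × Bool) :
    IsArc (p (side d.1) (own d)) (p (side d.1) (own (fl d))) (γ d.1 '' Icc 0 1) := by
  have a := isArc_image (h.gc d.1) zero_lt_one (h.gi d.1)
  have e1 := h.ge (d.1, false)
  have e2 := h.ge (d.1, true)
  simp only [endt] at e1 e2
  norm_num at e1 e2
  rw [e1, e2] at a
  rcases d with ⟨e, b⟩
  cases b
  · exact a
  · exact a.symm

theorem Two.common (h : Two own side T Sd p γ) {d d' : E × Bool} (hs : side d.1 = side d'.1) (hne : d.1 ≠ d'.1)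
    {x : ℝ × ℝ} (hx : x ∈ γ d.1 '' Icc 0 1) (hx' : x ∈ γ d'.1 '' Icc 0 1) :
    ∃ c c', own (d.1, c) = own (d'.1, c') ∧ x = p (side d.1) (own (d.1, c)) := by
  obtain ⟨s, hs', rfl⟩ := hx
  obtain ⟨t, ht, he⟩ := hx'
  exact h.gx _ _ _ _ hne hs hs' ht he.symm

theorem node_of {B : Set V} {σ d : E × Bool} {k : ℕ} (hσ : Chosen own B σ) (ha : At own B σ k d) {c : Bool}
    (hv : own (d.1, c) ∉ B) : ∃ m d', m ≤ k ∧ At own B σ m d' ∧ own (fl d') = own (d.1, c) := by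
  rcases dart_cases d c with e | e
  · rw [e] at hv ⊢
    obtain ⟨m, q, rfl, hq, hn⟩ := ha.pred' hσ.1 hv
    exact ⟨m, q, by omega, hq, hn.1.symm⟩
  · exact ⟨k, d, le_rfl, ha, by rw [e]⟩

theorem Two.strand_arc (h : Two own side T Sd p γ) {σ : E × Bool} (hσ : Chosen own (bas own T) σ) :
    ∀ n d, At own (bas own T) σ n d → own (fl d) ≠ own σ →
      IsArc (p (side σ.1) (own σ)) (p (side σ.1) (own (fl d))) (strandSet own T γ σ n) := by
  have h2 : Deg2 own (bas own T) := bas_deg2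
  intro n
  induction n with
  | zero =>
    intro d hd _
    have e := hd.zero_eq
    subst e
    have : strandSet own T γ d 0 = γ d.1 '' Icc 0 1 := by
      ext x
      constructor
      · rintro ⟨k, hk, d', hd', hx⟩
        obtain rfl : k = 0 := by omega
        rw [hd'.zero_eq] at hx; exact hx
      · intro hx; exact ⟨0, le_rfl, d, .zero, hx⟩
    rw [this]
    exact h.edge_arc d
  | succ n ih =>
    intro d' hd' hne
    obtain ⟨d, hd, hn⟩ := hd'.pred
    have a1 := ih d hd (fun k => hn.2.1 (by rw [hn.1, k]; exact hσ.1))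
    have a2 := h.edge_arc d'
    rw [h.side_const hd', hn.1] at a2
    have hs : strandSet own T γ σ (n + 1) = strandSet own T γ σ n ∪ γ d'.1 '' Icc 0 1 := by
      ext x
      constructor
      · rintro ⟨k, hk, e, he, hx⟩
        by_cases hk' : k = n + 1
        · subst hk'
          right; rw [hd'.func h2 he]; exact hx
        · left; exact ⟨k, by omega, e, he, hx⟩
      · rintro (⟨k, hk, e, he, hx⟩ | hx)
        · exact ⟨k, by omega, e, he, hx⟩
        · exact ⟨n + 1, le_rfl, d', hd', hx⟩
    rw [hs]
    refine a1.trans a2 ?_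
    rintro x ⟨⟨k, hk, e, he, hx⟩, hx'⟩
    have hE : e.1 ≠ d'.1 := by
      intro hE
      have := chosen_edge h2 hσ hσ (e := e.1) (b := e.2) (b' := d'.2) he (by rw [hE]; exact hd')
      omega
    obtain ⟨c, c', hv, hxv⟩ := h.common ((h.side_const he).trans (h.side_const hd').symm) hE hx hx'
    rw [h.side_const he] at hxv
    rw [mem_singleton_iff, hxv, hv, ← hn.1]
    rcases dart_cases d' c' with k' | k'
    · rw [k']
    · exfalso
      rw [k'] at hv
      by_cases hb : own (e.1, c) ∈ bas own T
      · rcases dart_cases e c with l | l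
        · rw [l] at hb hv
          have := (he.base hb).2
          rw [this] at hv
          exact hne hv.symm
        · rw [l] at hb
          have := he.last h2 hd' hb
          omega
      · obtain ⟨m, d'', hm, hmd, hmo⟩ := node_of hσ he hb
        have := (chosen_node_uniq h2 hσ hσ hmd hd' (hmo.trans hv) (by rw [hmo]; exact hb)).2.1
        omega

theorem Two.strand_meet (h : Two own side T Sd p γ) {σ σ' : E × Bool} (hσ : Chosen own (bas own T) σ)
    (hσ' : Chosen own (bas own T) σ') (hs : side σ.1 = side σ'.1) (hne : σ ≠ σ') (hc : own σ ∈ core own T)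
    {n n' : ℕ} {x : ℝ × ℝ} (hx : x ∈ strandSet own T γ σ n) (hx' : x ∈ strandSet own T γ σ' n') :
    ∃ v ∈ core own T, v ∈ Sd (side σ.1) ∧ x = p (side σ.1) v := by
  have h2 : Deg2 own (bas own T) := bas_deg2
  obtain ⟨k, hk, d, hd, hx⟩ := hx
  obtain ⟨k', hk', d', hd', hx'⟩ := hx'
  have hE : d.1 ≠ d'.1 := by
    intro hE
    exact hne (chosen_edge h2 hσ hσ' (e := d.1) (b := d.2) (b' := d'.2) hd (by rw [hE]; exact hd')).1
  obtain ⟨c, c', hv, hxv⟩ := h.common (((h.side_const hd).trans hs).trans (h.side_const hd').symm) hE hx hx'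
  rw [h.side_const hd] at hxv
  refine ⟨own (d.1, c), ?_, ?_, hxv⟩
  · by_cases hb : own (d.1, c) ∈ bas own T
    · rcases dart_cases d c with l | l
      · rw [l] at hb ⊢
        rw [(hd.base hb).2]; exact hc
      · rw [l] at hb ⊢
        exact end_core hd hc hb
    · exfalso
      obtain ⟨m, q, hm, hmd, hmo⟩ := node_of hσ hd hb
      obtain ⟨m', q', hm', hmd', hmo'⟩ := node_of hσ' hd' (c := c') (by rw [← hv]; exact hb)
      exact hne (chosen_node_uniq h2 hσ hσ' hmd hmd' (by rw [hmo, hmo', hv]) (by rw [hmo]; exact hb)).1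
  · rw [← h.side_const hd]
    exact h.own_mem (d.1, c)

theorem Two.strand_vertex (h : Two own side T Sd p γ) {σ d : E × Bool} {n : ℕ} (hd : At own (bas own T) σ n d)
    (he : own (fl d) ∈ bas own T) {a : V} (ha : a ∈ bas own T) (hS : a ∈ Sd (side σ.1))
    (hx : p (side σ.1) a ∈ strandSet own T γ σ n) : a = own σ ∨ a = own (fl d) := by
  have h2 : Deg2 own (bas own T) := bas_deg2
  obtain ⟨k, hk, d', hd', s, hs, hx⟩ := hx
  rw [← h.side_const hd'] at hx hS
  obtain ⟨b, rfl⟩ := h.gv _ _ _ hs hS hx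
  rcases dart_cases d' b with l | l
  · rw [l] at ha ⊢
    left; rw [(hd'.base ha).2]
  · rw [l] at ha ⊢
    right
    have := hd'.last h2 hd ha
    obtain rfl : k = n := by omega
    rw [hd'.func h2 hd]

end strandarcs
end BK

namespace BK
open Set

section coredrawing
variable {V E : Type} (own : E × Bool → V) (side : E → Bool) (T : Fin 3 → V) (Sd : Bool → Set V)

/-- core vertices of a side -/
abbrev CW (b : Bool) : Type := {v : V // v ∈ core own T ∧ v ∈ Sd b}

/-- types of core strands of a side -/
abbrev CK (b : Bool) : Type := {q : CW own T Sd b × CW own T Sd b // q.1.1 ≠ q.2.1 ∧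
  ∃ σ n d, Chosen own (bas own T) σ ∧ side σ.1 = b ∧ own σ = q.1.1 ∧ At own (bas own T) σ n d ∧ own (fl d) = q.2.1}

/-- endpoints of types -/
def kend (b : Bool) (d : CK own side T Sd b × Bool) : CW own T Sd b := if d.2 then d.1.1.2 else d.1.1.1

variable {own side T Sd} {p : Bool → V → ℝ × ℝ} {γ : E → ℝ → ℝ × ℝ}

theorem Two.core_drawn (h : Two own side T Sd p γ) (b : Bool) :
    ∃ g : CK own side T Sd b → ℝ → ℝ × ℝ, Drawn (kend own side T Sd b) (fun v => p b v.1) g ∧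
      occ (fun v : CW own T Sd b => p b v.1) g ⊆ (⋃ e ∈ side ⁻¹' {b}, γ e '' Icc 0 1) ∪ p b '' Sd b := by
  have h2 : Deg2 own (bas own T) := bas_deg2
  have hq : ∀ q : CK own side T Sd b, ∃ σ n d, Chosen own (bas own T) σ ∧ side σ.1 = b ∧ own σ = q.1.1.1 ∧
    At own (bas own T) σ n d ∧ own (fl d) = q.1.2.1 := fun q => q.2.2
  choose σ n d hσ hs h0 hd h1 using hq
  have hcv : ∀ q, ∃ c : ℝ → ℝ × ℝ, Continuous c ∧ InjOn c (Icc 0 1) ∧ c 0 = p b q.1.1.1 ∧ c 1 = p b q.1.2.1 ∧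
      c '' Icc 0 1 = strandSet own T γ (σ q) (n q) := by
    intro q
    have := (h.strand_arc (hσ q) (n q) (d q) (hd q) (by rw [h0, h1]; exact q.2.1.symm)).curve
    rw [hs, h0, h1] at this
    exact this
  choose c cc cinj c0 c1 cim using hcv
  have hb : ∀ q, own (fl (d q)) ∈ bas own T := fun q => by rw [h1]; exact Or.inl q.1.2.2.1
  have hne : ∀ q q', q ≠ q' → σ q ≠ σ q' := by
    intro q q' hq e
    apply hq
    have e1 : q.1.1 = q'.1.1 := Subtype.ext (by rw [← h0, ← h0, e])
    have a := hd q
    have a' := hd q'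
    rw [← e] at a'
    have en : n q = n q' := le_antisymm (a'.last h2 a (hb q')) (a.last h2 a' (hb q))
    rw [← en] at a'
    have e2 : q.1.2 = q'.1.2 := Subtype.ext (by rw [← h1, ← h1, a.func h2 a'])
    exact Subtype.ext (Prod.ext e1 e2)
  refine ⟨c, ⟨?_, ?_, cc, cinj, ?_, ?_, ?_⟩, ?_⟩
  · rintro ⟨q, b'⟩ e
    cases b'
    · exact q.2.1 (congrArg Subtype.val e).symm
    · exact q.2.1 (congrArg Subtype.val e)
  · intro v w e
    exact Subtype.ext (h.pinj b v.2.2 w.2.2 e)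
  · rintro ⟨q, b'⟩
    cases b'
    · simpa [endt, kend] using c0 q
    · simpa [endt, kend] using c1 q
  · intro q q' hqq s hs' t ht he
    have m1 : c q s ∈ strandSet own T γ (σ q) (n q) := by rw [← cim]; exact ⟨s, hs', rfl⟩
    have m2 : c q s ∈ strandSet own T γ (σ q') (n q') := by rw [← cim, he]; exact ⟨t, ht, rfl⟩
    obtain ⟨v, hv, hv', hx⟩ := h.strand_meet (hσ q) (hσ q') (by rw [hs, hs]) (hne _ _ hqq)
      (by rw [h0]; exact q.1.1.2.1) m1 m2
    rw [hs] at hv' hx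
    exact ⟨⟨v, hv, hv'⟩, hx⟩
  · intro q s hs' a he
    have m1 : c q s ∈ strandSet own T γ (σ q) (n q) := by rw [← cim]; exact ⟨s, hs', rfl⟩
    rw [he] at m1
    rcases h.strand_vertex (hd q) (hb q) (Or.inl a.2.1) (by rw [hs]; exact a.2.2) (by rw [hs]; exact m1) with k | k
    · exact ⟨false, Subtype.ext (k.trans (h0 q))⟩
    · exact ⟨true, Subtype.ext (k.trans (h1 q))⟩
  · rintro x (hx | ⟨v, rfl⟩)
    · left
      obtain ⟨q, hq⟩ := mem_iUnion.1 hx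
      rw [cim] at hq
      obtain ⟨k, hk, e, he, hx⟩ := hq
      exact mem_iUnion₂.2 ⟨e.1, (h.side_const he).trans (hs q), hx⟩
    · right; exact ⟨v.1, v.2.2, rfl⟩

theorem Two.core_curves (h : Two own side T Sd p γ) :
    ∃ (X : V → ℝ × ℝ) (c : E × Bool → ℝ → ℝ → ℝ × ℝ), InjOn X (core own T) ∧
      (∀ σ t, Chosen own (bas own T) σ → own σ ∈ core own T → Continuous (c σ t)) ∧
      (∀ σ t, Chosen own (bas own T) σ → own σ ∈ core own T → c σ t 0 = X (own σ)) ∧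
      (∀ σ t k d, Chosen own (bas own T) σ → own σ ∈ core own T → At own (bas own T) σ k d →
        own (fl d) ∈ bas own T → c σ t 1 = X (own (fl d))) ∧
      (∀ σ σ' t t' s s', t ∈ Ioo (0:ℝ) 1 → t' ∈ Ioo (0:ℝ) 1 → s ∈ Ioo (0:ℝ) 1 → s' ∈ Ioo (0:ℝ) 1 →
        own σ ∈ core own T → own σ' ∈ core own T → c σ t s = c σ' t' s' → t = t' ∧ s = s') ∧
      (∀ σ t s u, t ∈ Ioo (0:ℝ) 1 → s ∈ Ioo (0:ℝ) 1 → own σ ∈ core own T → u ∈ core own T → c σ t s ≠ X u) ∧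
      (∀ σ t s, t ∈ Ioo (0:ℝ) 1 → s ∈ Ioo (0:ℝ) 1 → own σ ∈ core own T →
        (c σ t s).1 ^ 2 + (c σ t s).2 ^ 2 ≤ 2) ∧
      (∀ u ∈ core own T, (X u).1 ^ 2 + (X u).2 ^ 2 ≤ 2) := by
  classical
  have h2 : Deg2 own (bas own T) := bas_deg2
  have hcount : Countable (core own T) := h.core_countable
  let j : ∀ b, CW own T Sd b → core own T := fun b w => ⟨w.1, w.2.1⟩
  let TT : ∀ b, Fin 3 → CW own T Sd b := fun b i => ⟨T i, Or.inl ⟨i, rfl⟩, h.tm i b⟩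
  have jinj : ∀ b, Function.Injective (j b) := fun b v w e => Subtype.ext (Subtype.mk.inj e)
  have cW : ∀ b, Countable (CW own T Sd b) := fun b => (jinj b).countable
  have H : ∀ b (A : Set (CW own T Sd b)) (es : Set (CK own side T Sd b)), A.Finite → es.Finite →
      (∀ i, TT b i ∈ A) → (∀ d : CK own side T Sd b × Bool, d.1 ∈ es → kend own side T Sd b d ∈ A) →
      ∃ g lab, SideOn (kend own side T Sd b) (TT b) A es g lab := by
    intro b A es hA hes hT hown
    obtain ⟨g, hg, hocc⟩ := h.core_drawn b
    obtain ⟨x0, hx0, hcl⟩ := h.face b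
    refine side_fin hg (TT b) (fun i i' e => h.tinj (congrArg Subtype.val e)) x0 (fun k => hx0 (hocc k)) ?_
      A es hA hes hT hown
    intro i
    exact closure_mono (connectedComponentIn_mono x0 (compl_subset_compl.2 hocc)) (hcl i)
  have M := merge (own := kend own side T Sd) (j := j) (T := TT) jinj (fun i => rfl)
    (by
      intro v w e
      have e' : v.1 = w.1 := congrArg Subtype.val e
      obtain ⟨i, hi⟩ := h.inter v.1 false true (by decide) v.2.2 (by rw [e']; exact w.2.2)
      exact ⟨i, Subtype.ext hi.symm⟩)
    (by
      intro v
      obtain ⟨b, hb⟩ := h.cover v.1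
      exact ⟨b, ⟨v.1, v.2, hb⟩, rfl⟩)
    (fun b i i' e => h.tinj (congrArg Subtype.val e)) H
  obtain ⟨l, r, hl, hd, hB⟩ := compact_book _ _ M
  obtain ⟨X, c, X1, X2, X3, X4, X5, X6, X7, X8⟩ := BK.core_curves _ _ l r hl hd hB
  -- the type of a strand
  have hκ : ∀ σ, ∃ κ : (Σ b, CK own side T Sd b) ⊕ core own T, Chosen own (bas own T) σ → own σ ∈ core own T →
      (lown (mown (kend own side T Sd) j) (κ, false)).1 = own σ ∧
      ∀ k d, At own (bas own T) σ k d → own (fl d) ∈ bas own T →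
        (lown (mown (kend own side T Sd) j) (κ, true)).1 = own (fl d) := by
    intro σ
    by_cases hc : Chosen own (bas own T) σ ∧ own σ ∈ core own T
    swap
    · exact ⟨Sum.inr (j false (TT false 0)), fun a b => absurd ⟨a, b⟩ hc⟩
    obtain ⟨hσ, hc⟩ := hc
    by_cases hf : ∃ k d, At own (bas own T) σ k d ∧ own (fl d) ∈ bas own T ∧ own (fl d) ≠ own σ
    · obtain ⟨k, d, hk, hdb, hdn⟩ := hf
      refine ⟨Sum.inl ⟨side σ.1, ⟨(⟨own σ, hc, h.own_mem σ⟩, ⟨own (fl d), end_core hk hc hdb, ?_⟩), ?_, ?_⟩⟩, ?_⟩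
      · rw [← h.side_const hk]; exact h.own_mem (fl d)
      · exact hdn.symm
      · exact ⟨σ, k, d, hσ, rfl, rfl, hk, rfl⟩
      · intro _ _
        refine ⟨rfl, ?_⟩
        intro k' d' hk' hdb'
        have en : k = k' := le_antisymm (hk'.last h2 hk hdb') (hk.last h2 hk' hdb)
        subst en
        rw [← hk.func h2 hk']
        rfl
    · push Not at hf
      refine ⟨Sum.inr ⟨own σ, hc⟩, fun _ _ => ⟨rfl, ?_⟩⟩
      intro k d hk hdb
      exact (hf k d hk hdb).symm
  choose κ hκ using hκ
  let X' : V → ℝ × ℝ := fun v => if hv : v ∈ core own T then X ⟨v, hv⟩ else 0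
  have hX' : ∀ v (hv : v ∈ core own T), X' v = X ⟨v, hv⟩ := fun v hv => dif_pos hv
  refine ⟨X', fun σ => c (κ σ), ?_, ?_, ?_, ?_, ?_, ?_, ?_, ?_⟩
  · intro u hu w hw e
    rw [hX' u hu, hX' w hw] at e
    exact congrArg Subtype.val (X1 e)
  · intro σ t _ _; exact X2 _ _
  · intro σ t hσ hc
    show c (κ σ) t 0 = _
    rw [X3, hX' _ hc]
    congr 1
    exact Subtype.ext (hκ σ hσ hc).1
  · intro σ t k d hσ hc hk hdb
    show c (κ σ) t 1 = _
    rw [X4, hX' _ (end_core hk hc hdb)]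
    congr 1
    exact Subtype.ext ((hκ σ hσ hc).2 k d hk hdb)
  · intro σ σ' t t' s s' a1 a2 a3 a4 _ _ e
    exact (X5 _ _ _ _ _ _ a1 a2 a3 a4 e).2
  · intro σ t s u a1 a2 _ hu
    rw [hX' u hu]
    exact X6 _ _ _ _ a1 a2
  · intro σ t s a1 a2 _
    exact X7 _ _ _ a1 a2
  · intro u hu
    rw [hX' u hu]
    exact X8 _

end coredrawing
end BK

namespace BK
open Set

theorem exists_inj : ∃ f : Bool × Bool × (ℝ × ℝ) → ℝ, Function.Injective f ∧ ∀ x, f x ∈ Ioo (0:ℝ) 1 := by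
  have h : Cardinal.mk (Bool × Bool × (ℝ × ℝ)) ≤ Cardinal.mk (Ioo (0:ℝ) 1) := by
    rw [Cardinal.mk_Ioo_real zero_lt_one]
    simp [Cardinal.mk_real]
  obtain ⟨f⟩ := h
  exact ⟨fun x => (f x).1, fun x y e => f.injective (Subtype.ext e), fun x => (f x).2⟩

/-- circles -/
noncomputable def circ (R g : ℝ) : ℝ × ℝ := (R * Real.cos (2 * Real.pi * g), R * Real.sin (2 * Real.pi * g))

theorem circ_norm (R g : ℝ) : (circ R g).1 ^ 2 + (circ R g).2 ^ 2 = R ^ 2 := by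
  have := Real.sin_sq_add_cos_sq (2 * Real.pi * g)
  simp only [circ]
  linear_combination R ^ 2 * this

theorem circ_inj {R R' g g' : ℝ} (hR : 0 < R) (hR' : 0 < R') (hg : g ∈ Ico (0:ℝ) 1) (hg' : g' ∈ Ico (0:ℝ) 1)
    (h : circ R g = circ R' g') : R = R' ∧ g = g' := by
  have hn := circ_norm R g
  rw [h, circ_norm] at hn
  have hRR : R = R' := by
    have := (pow_left_inj₀ hR'.le hR.le two_ne_zero).1 hn
    exact this.symm
  subst hRR
  refine ⟨rfl, ?_⟩
  have hc : Real.cos (2 * Real.pi * g) = Real.cos (2 * Real.pi * g') :=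
    mul_left_cancel₀ hR.ne' (congrArg Prod.fst h)
  have hs : Real.sin (2 * Real.pi * g) = Real.sin (2 * Real.pi * g') :=
    mul_left_cancel₀ hR.ne' (congrArg Prod.snd h)
  have := Real.Angle.cos_sin_inj hc hs
  rw [Real.Angle.angle_eq_iff_two_pi_dvd_sub] at this
  obtain ⟨k, hk⟩ := this
  have hk' : g - g' = k := by
    have : 2 * Real.pi * (g - g') = 2 * Real.pi * k := by linarith
    exact mul_left_cancel₀ (by positivity) this
  obtain ⟨a, b⟩ := hg
  obtain ⟨a', b'⟩ := hg'
  have k1 : (k:ℝ) < 1 := by linarith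
  have k2 : (-1:ℝ) < k := by linarith
  have k1' : k < 1 := by exact_mod_cast k1
  have k2' : -1 < k := by exact_mod_cast k2
  have : k = 0 := by omega
  rw [this] at hk'
  simp at hk'
  linarith

section final
variable {V E : Type} {own : E × Bool → V} {side : E → Bool} {T : Fin 3 → V} {Sd : Bool → Set V}
    {p : Bool → V → ℝ × ℝ} {γ : E → ℝ → ℝ × ℝ}

theorem reps_two {d1 d2 d3 : E × Bool} (h1 : own d1 ∈ reps own T) (h2 : own d2 = own d1)
    (h3 : own d3 = own d1) : d1 = d2 ∨ d1 = d3 ∨ d2 = d3 := by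
  by_contra hh
  push Not at hh
  refine h1.1 (own d1) ?_ rfl
  right
  refine ⟨![d1, d2, d3], ?_, ?_⟩
  · intro i j hij
    obtain ⟨a, b, c⟩ := hh
    fin_cases i <;> fin_cases j <;> simp_all
  · intro i
    fin_cases i <;> simp [h2, h3]

/-- a strand returns to the base -/
def Fini (own : E × Bool → V) (T : Fin 3 → V) (σ : E × Bool) : Prop :=
  ∃ k d, At own (bas own T) σ k d ∧ own (fl d) ∈ bas own T

/-- tag of a strand at a representative -/
def tagg (own : E × Bool → V) (σ : E × Bool) : Prop := ∃ σ', own σ' = own σ ∧ WellOrderingRel σ' σ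

theorem tagg_inj {σ σ' : E × Bool} (h : own σ ∈ reps own T) (ho : own σ' = own σ)
    (ht : tagg own σ ↔ tagg own σ') : σ = σ' := by
  by_contra hne
  rcases trichotomous_of WellOrderingRel σ σ' with k | k | k
  · obtain ⟨τ, h1, h2⟩ := ht.2 ⟨σ, ho.symm, k⟩
    rcases reps_two h ho h1 with l | l | l
    · exact hne l
    · rw [← l] at h2; exact irrefl _ h2
    · rw [← l] at h2; exact asymm k h2
  · exact hne k
  · obtain ⟨τ, h1, h2⟩ := ht.1 ⟨σ', ho, k⟩
    rcases reps_two h ho (h1.trans ho) with l | l | l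
    · exact hne l
    · rw [← l] at h2; exact asymm k h2
    · rw [← l] at h2; exact irrefl _ h2

open Classical in
/-- circle parameter of a strand at a representative -/
noncomputable def gg (own : E × Bool → V) (T : Fin 3 → V) (σ : E × Bool) (s : ℝ) : ℝ :=
  if Fini own T σ then s else if tagg own σ then s / 2 else 1 - s / 2

theorem gg_mem (σ : E × Bool) {s : ℝ} (hs : s ∈ Ioo (0:ℝ) 1) : gg own T σ s ∈ Ioo (0:ℝ) 1 := by
  obtain ⟨h1, h2⟩ := hs
  unfold gg
  split_ifs <;> constructor <;> linarith

theorem gg_cont (σ : E × Bool) : Continuous (gg own T σ) := by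
  unfold gg
  split_ifs <;> fun_prop

theorem fini_uniq {σ σ' : E × Bool} (hσ : Chosen own (bas own T) σ) (hσ' : Chosen own (bas own T) σ')
    (h : own σ ∈ reps own T) (ho : own σ' = own σ) (hf : Fini own T σ) : σ = σ' := by
  obtain ⟨k, d, hk, hd⟩ := hf
  have he := end_reps hk h hd
  rcases reps_two h ho he with l | l | l
  · exact l
  · exfalso
    exact Chosen.not_rev bas_deg2 hσ hσ hk (j := 0) (by rw [← l]; exact .zero)
  · exfalso
    exact Chosen.not_rev bas_deg2 hσ hσ' hk (j := 0) (by rw [← l]; exact .zero)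

theorem gg_inj {σ σ' : E × Bool} (hσ : Chosen own (bas own T) σ) (hσ' : Chosen own (bas own T) σ')
    (h : own σ ∈ reps own T) (ho : own σ' = own σ) {s s' : ℝ} (hs : s ∈ Ioo (0:ℝ) 1) (hs' : s' ∈ Ioo (0:ℝ) 1)
    (he : gg own T σ s = gg own T σ' s') : σ = σ' ∧ s = s' := by
  have key : σ = σ' := by
    by_cases hf : Fini own T σ
    · exact fini_uniq hσ hσ' h ho hf
    by_cases hf' : Fini own T σ'
    · exact (fini_uniq hσ' hσ (by rw [ho]; exact h) ho.symm hf').symm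
    apply tagg_inj h ho
    obtain ⟨h1, h2⟩ := hs
    obtain ⟨h1', h2'⟩ := hs'
    by_cases t : tagg own σ <;> by_cases t' : tagg own σ' <;> simp only [gg, hf, hf', t, t', if_true, if_false] at he ⊢
    · exfalso; linarith
    · exfalso; linarith
  subst key
  refine ⟨rfl, ?_⟩
  unfold gg at he
  split_ifs at he <;> linarith

theorem Two.final (h : Two own side T Sd p γ) :
    ∃ pos : V → ℝ × ℝ, Function.Injective pos ∧ ∃ A : E → Set (ℝ × ℝ),
      (∀ e, IsArc (pos (own (e, false))) (pos (own (e, true))) (A e)) ∧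
      (∀ e e', e ≠ e' → ∀ x ∈ A e, x ∈ A e' → (∃ b, x = pos (own (e, b))) ∧ ∃ b, x = pos (own (e', b))) ∧
      (∀ z e, pos z ∈ A e → ∃ b, z = own (e, b)) := by
  classical
  obtain ⟨f, finj, fmem⟩ := exists_inj
  choose bv hbv using h.cover
  let ιz : V → ℝ := fun v => f (true, bv v, p (bv v) v)
  have ιz_inj : Function.Injective ιz := by
    intro v w e
    have e' := finj e
    simp only [Prod.mk.injEq, true_and] at e'
    obtain ⟨e1, e2⟩ := e'
    rw [← e1] at e2
    exact h.pinj _ (hbv v) (by rw [e1]; exact hbv w) e2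
  let ιs : E × Bool → ℝ := fun σ => f (σ.2, side σ.1, γ σ.1 (1 / 2))
  have ιs_inj : Function.Injective ιs := by
    intro σ σ' e
    have e' := finj e
    simp only [Prod.mk.injEq] at e'
    obtain ⟨e1, e2, e3⟩ := e'
    refine Prod.ext ?_ e1
    by_contra hne
    have m : (1 / 2 : ℝ) ∈ Icc (0:ℝ) 1 := by constructor <;> norm_num
    obtain ⟨b, b', -, hx⟩ := h.gx _ _ _ _ hne e2 m m e3
    have e4 := h.ge (σ.1, b)
    simp only at e4
    have := h.gi _ m (endt_mem b) (hx.trans e4.symm)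
    cases b <;> norm_num [endt] at this
  obtain ⟨X, c, X1, X2, X3, X4, X5, X6, X7, X8⟩ := h.core_curves
  have hRR : ∀ z, 0 < 10 + ιz z := fun z => by
    have : ιz z ∈ Ioo (0:ℝ) 1 := fmem _
    linarith [this.1]
  have hR2 : ∀ z, 2 < (10 + ιz z) ^ 2 := fun z => by
    have : ιz z ∈ Ioo (0:ℝ) 1 := fmem _
    nlinarith [this.1]
  have hιs : ∀ σ, ιs σ ∈ Ioo (0:ℝ) 1 := fun σ => fmem _
  have dis : ∀ v, v ∈ core own T → v ∉ reps own T := fun v hv hv' => hv'.1 v hv rfl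
  have dis' : ∀ v, v ∈ bas own T → v ∉ core own T → v ∈ reps own T := fun v hv hv' => hv.resolve_left hv'
  let P : V → ℝ × ℝ := fun v => if v ∈ core own T then X v else circ (10 + ιz v) 0
  let cur : E × Bool → ℝ → ℝ × ℝ := fun σ s => if own σ ∈ core own T then c σ (ιs σ) s
    else circ (10 + ιz (own σ)) (gg own T σ s)
  have Pc : ∀ v, v ∈ core own T → P v = X v := fun v hv => if_pos hv
  have Pz : ∀ v, v ∉ core own T → P v = circ (10 + ιz v) 0 := fun v hv => if_neg hv
  have cc : ∀ σ s, own σ ∈ core own T → cur σ s = c σ (ιs σ) s := fun σ s hv => if_pos hv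
  have cz : ∀ σ s, own σ ∉ core own T → cur σ s = circ (10 + ιz (own σ)) (gg own T σ s) := fun σ s hv => if_neg hv
  have clash : ∀ (x : ℝ × ℝ) z g, x.1 ^ 2 + x.2 ^ 2 ≤ 2 → x ≠ circ (10 + ιz z) g := by
    rintro x z g hx rfl
    rw [circ_norm] at hx
    linarith [hR2 z]
  have m0 : (0:ℝ) ∈ Ico (0:ℝ) 1 := ⟨le_rfl, zero_lt_one⟩
  refine assemble (B := bas own T) bas_deg2 bas_reach h.own_fl P ?_ cur ?_ ?_ ?_ ?_ ?_
  · intro v hv w hw e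
    by_cases kv : v ∈ core own T <;> by_cases kw : w ∈ core own T
    · rw [Pc v kv, Pc w kw] at e; exact X1 kv kw e
    · rw [Pc v kv, Pz w kw] at e; exact absurd e (clash _ _ _ (X8 v kv))
    · rw [Pz v kv, Pc w kw] at e; exact absurd e.symm (clash _ _ _ (X8 w kw))
    · rw [Pz v kv, Pz w kw] at e
      have := (circ_inj (hRR v) (hRR w) m0 m0 e).1
      exact ιz_inj (by linarith)
  · intro σ hσ
    by_cases k : own σ ∈ core own T
    · have : cur σ = c σ (ιs σ) := funext fun s => cc σ s k
      rw [this]; exact X2 _ _ hσ k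
    · have : cur σ = fun s => circ (10 + ιz (own σ)) (gg own T σ s) := funext fun s => cz σ s k
      rw [this]
      have := gg_cont (own := own) (T := T) σ
      unfold circ
      fun_prop
  · intro σ hσ
    by_cases k : own σ ∈ core own T
    · rw [cc _ _ k, X3 _ _ hσ k, Pc _ k]
    · rw [cz _ _ k, Pz _ k]
      unfold gg
      split_ifs <;> simp [circ]
  · intro σ k d hσ hk hd
    by_cases kc : own σ ∈ core own T
    · rw [cc _ _ kc, X4 _ _ k d hσ kc hk hd, Pc _ (end_core hk kc hd)]
    · rw [cz _ _ kc, end_reps hk (dis' _ hσ.1 kc) hd, Pz _ kc]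
      have hf : Fini own T σ := ⟨k, d, hk, hd⟩
      simp [gg, hf, circ]
  · intro σ σ' s s' hσ hσ' hs hs' e
    by_cases kv : own σ ∈ core own T <;> by_cases kw : own σ' ∈ core own T
    · rw [cc _ _ kv, cc _ _ kw] at e
      obtain ⟨e1, e2⟩ := X5 _ _ _ _ _ _ (hιs σ) (hιs σ') hs hs' kv kw e
      exact ⟨ιs_inj e1, e2⟩
    · rw [cc _ _ kv, cz _ _ kw] at e; exact absurd e (clash _ _ _ (X7 _ _ _ (hιs σ) hs kv))
    · rw [cz _ _ kv, cc _ _ kw] at e; exact absurd e.symm (clash _ _ _ (X7 _ _ _ (hιs σ') hs' kw))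
    · rw [cz _ _ kv, cz _ _ kw] at e
      obtain ⟨e1, e2⟩ := circ_inj (hRR _) (hRR _) (Ioo_subset_Ico_self (gg_mem σ hs))
        (Ioo_subset_Ico_self (gg_mem σ' hs')) e
      have ho : own σ = own σ' := ιz_inj (by linarith)
      exact gg_inj hσ hσ' (dis' _ hσ.1 kv) ho.symm hs hs' e2
  · intro σ s u hσ hs hu e
    by_cases kv : own σ ∈ core own T <;> by_cases kw : u ∈ core own T
    · rw [cc _ _ kv, Pc _ kw] at e
      exact X6 _ _ _ _ (hιs σ) hs kv kw e
    · rw [cc _ _ kv, Pz _ kw] at e; exact absurd e (clash _ _ _ (X7 _ _ _ (hιs σ) hs kv))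
    · rw [cz _ _ kv, Pc _ kw] at e; exact absurd e.symm (clash _ _ _ (X8 _ kw))
    · rw [cz _ _ kv, Pz _ kw] at e
      have := (circ_inj (hRR _) (hRR _) (Ioo_subset_Ico_self (gg_mem σ hs)) m0 e).2
      have h3 := (gg_mem (own := own) (T := T) σ hs).1
      linarith

end final
end BK

namespace BK
open Set

theorem plane_no_loop {V : Type} {Er : V → V → Prop} {S : Set V} (D : PlaneDrawing Er S) {u w : V}
    (h : Er u w) : u ≠ w := by
  rintro rfl
  obtain ⟨γ, hi, -⟩ := D.arc_isArc u u h
  have := hi (γ.source.trans γ.target.symm)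
  exact zero_ne_one this

theorem gen {V : Type} (EE : Bool → V → V → Prop) (SS : Bool → Set V) (DD : ∀ b, PlaneDrawing (EE b) (SS b))
    (T : Fin 3 → V) (tinj : Function.Injective T)
    (inter : ∀ v b b', b ≠ b' → v ∈ SS b → v ∈ SS b' → v ∈ range T) (tm : ∀ i b, T i ∈ SS b)
    (face : ∀ b, OnCommonFace (DD b) (range T)) :
    Nonempty (PlaneDrawing (fun u w => ∃ b, EE b u w) {v | ∃ b, v ∈ SS b}) := by
  classical
  let Vt : Type := {v : V // ∃ b, v ∈ SS b}
  let E : Type := {q : V × V // ∃ b, EE b q.1 q.2}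
  have hside : ∀ e : E, ∃ b, EE b e.1.1 e.1.2 := fun e => e.2
  choose side hs using hside
  let own : E × Bool → Vt := fun d => if d.2 then ⟨d.1.1.2, side d.1, ((DD _).edge_in _ _ (hs d.1)).2⟩
    else ⟨d.1.1.1, side d.1, ((DD _).edge_in _ _ (hs d.1)).1⟩
  have own0 : ∀ e, (own (e, false)).1 = e.1.1 := fun e => rfl
  have own1 : ∀ e, (own (e, true)).1 = e.1.2 := fun e => rfl
  let p : Bool → Vt → ℝ × ℝ := fun b v => (DD b).pos v.1
  have hcv : ∀ e : E, ∃ c : ℝ → ℝ × ℝ, Continuous c ∧ InjOn c (Icc 0 1) ∧ c 0 = (DD (side e)).pos e.1.1 ∧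
      c 1 = (DD (side e)).pos e.1.2 ∧ c '' Icc 0 1 = (DD (side e)).arc e.1.1 e.1.2 (hs e) :=
    fun e => IsArc.curve ((DD (side e)).arc_isArc e.1.1 e.1.2 (hs e))
  choose γ gc gi g0 g1 gim using hcv
  have gm : ∀ e s, s ∈ Icc (0:ℝ) 1 → γ e s ∈ (DD (side e)).arc e.1.1 e.1.2 (hs e) := by
    intro e s hs'; rw [← gim]; exact ⟨s, hs', rfl⟩
  have two : Two own side (fun i => (⟨T i, false, tm i false⟩ : Vt)) (fun b => {v : Vt | v.1 ∈ SS b}) p γ := by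
    refine ⟨?_, ?_, ?_, ?_, ?_, ?_, ?_, gc, gi, ?_, ?_, ?_, ?_⟩
    · rintro ⟨e, b⟩ k
      have k' := congrArg Subtype.val k
      cases b
      · exact plane_no_loop (DD (side e)) (hs e) k'.symm
      · exact plane_no_loop (DD (side e)) (hs e) k'
    · intro v; exact v.2
    · intro v b b' hb h1 h2
      obtain ⟨i, hi⟩ := inter v.1 b b' hb h1 h2
      exact ⟨i, Subtype.ext hi⟩
    · intro i b; exact tm i b
    · intro i j k; exact tinj (congrArg Subtype.val k)
    · rintro ⟨e, b⟩
      cases b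
      · exact ((DD _).edge_in _ _ (hs e)).1
      · exact ((DD _).edge_in _ _ (hs e)).2
    · intro b v hv w hw k
      exact Subtype.ext ((DD b).posInj hv hw k)
    · rintro ⟨e, b⟩
      cases b
      · show γ e (endt false) = (DD (side e)).pos e.1.1
        rw [← g0 e]; simp [endt]
      · show γ e (endt true) = (DD (side e)).pos e.1.2
        rw [← g1 e]; simp [endt]
    · intro e e' s t hne hss hs' ht he
      have m1 := gm e s hs'
      have m2 := gm e' t ht
      rw [← he] at m2
      have hne' : (e.1.1, e.1.2) ≠ (e'.1.1, e'.1.2) := fun k => hne (Subtype.ext k)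
      have key : ∀ b (he : EE b e.1.1 e.1.2) (he' : EE b e'.1.1 e'.1.2) (x : ℝ × ℝ),
          x ∈ (DD b).arc _ _ he → x ∈ (DD b).arc _ _ he' →
          ∃ c c', own (e, c) = own (e', c') ∧ x = p b (own (e, c)) := by
        intro b he he' x h1 h2
        obtain ⟨h3, h4⟩ := (DD b).arc_inter _ _ _ _ he he' hne' ⟨h1, h2⟩
        have a1 := (DD b).edge_in _ _ he
        have a2 := (DD b).edge_in _ _ he'
        have h3' : ∃ c, x = (DD b).pos (own (e, c)).1 ∧ (own (e, c)).1 ∈ SS b := by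
          rcases h3 with h3 | h3
          · exact ⟨false, h3, a1.1⟩
          · exact ⟨true, h3, a1.2⟩
        have h4' : ∃ c, x = (DD b).pos (own (e', c)).1 ∧ (own (e', c)).1 ∈ SS b := by
          rcases h4 with h4 | h4
          · exact ⟨false, h4, a2.1⟩
          · exact ⟨true, h4, a2.2⟩
        obtain ⟨c, hc, hcm⟩ := h3'
        obtain ⟨c', hc', hcm'⟩ := h4'
        exact ⟨c, c', Subtype.ext ((DD b).posInj hcm hcm' (hc.symm.trans hc')), hc⟩
      have hs2 := hs e'
      have aux : ∀ b (hb : side e' = b), γ e s ∈ (DD b).arc e'.1.1 e'.1.2 (hb ▸ hs e') := by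
        rintro b rfl
        exact m2
      exact key (side e) (hs e) _ _ m1 (aux _ hss.symm)
    · intro e s a hs' ha he
      have m1 := gm e s hs'
      rw [he] at m1
      rcases (DD (side e)).vertex_arc a.1 ha _ _ (hs e) m1 with k | k
      · exact ⟨false, Subtype.ext k⟩
      · exact ⟨true, Subtype.ext k⟩
    · intro b
      obtain ⟨x, hx, hcl⟩ := face b
      have hsub : (⋃ e ∈ side ⁻¹' {b}, γ e '' Icc 0 1) ∪ p b '' {v : Vt | v.1 ∈ SS b} ⊆ drawingSet (DD b) := by
        rintro y (hy | ⟨v, hv, rfl⟩)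
        · left
          obtain ⟨e, he, hy'⟩ := mem_iUnion₂.1 hy
          have he' : side e = b := he
          subst he'
          rw [gim] at hy'
          exact mem_iUnion.2 ⟨e.1.1, mem_iUnion.2 ⟨e.1.2, mem_iUnion.2 ⟨hs e, hy'⟩⟩⟩
        · right; exact ⟨v.1, hv, rfl⟩
      refine ⟨x, fun k => hx (hsub k), fun i => ?_⟩
      exact closure_mono (connectedComponentIn_mono x (compl_subset_compl.2 hsub)) (hcl (T i) ⟨i, rfl⟩)
  obtain ⟨pos, pinj, A, hA, hAA, hAv⟩ := two.final
  let pos' : V → ℝ × ℝ := fun v => if hv : ∃ b, v ∈ SS b then pos ⟨v, hv⟩ else 0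
  have hpos : ∀ v : Vt, pos' v.1 = pos v := fun v => dif_pos v.2
  have hoo : ∀ (e : E) b, pos (own (e, b)) = pos' e.1.1 ∨ pos (own (e, b)) = pos' e.1.2 := by
    intro e b
    cases b
    · left; exact (hpos (own (e, false))).symm
    · right; exact (hpos (own (e, true))).symm
  refine ⟨⟨pos', ?_, ?_, fun u w h => A ⟨(u, w), h⟩, ?_, ?_, ?_⟩⟩
  · intro v hv w hw k
    have e1 := hpos ⟨v, hv⟩
    have e2 := hpos ⟨w, hw⟩
    simp only at e1 e2
    rw [e1, e2] at k
    exact congrArg Subtype.val (pinj k)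
  · rintro u w ⟨b, h⟩
    exact ⟨⟨b, ((DD b).edge_in _ _ h).1⟩, ⟨b, ((DD b).edge_in _ _ h).2⟩⟩
  · intro u w h
    have := hA ⟨(u, w), h⟩
    rw [← hpos, ← hpos] at this
    exact this
  · rintro u w u' w' h h' hne x ⟨h1, h2⟩
    obtain ⟨⟨b, hb⟩, ⟨b', hb'⟩⟩ := hAA ⟨(u, w), h⟩ ⟨(u', w'), h'⟩ (fun k => hne (congrArg Subtype.val k)) x h1 h2
    constructor
    · rw [hb]; exact hoo ⟨(u, w), h⟩ b
    · rw [hb']; exact hoo ⟨(u', w'), h'⟩ b'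
  · intro z hz u w h hx
    have e1 := hpos ⟨z, hz⟩
    simp only at e1
    rw [e1] at hx
    obtain ⟨b, hb⟩ := hAv _ _ hx
    have := congrArg Subtype.val hb
    cases b
    · left; exact this
    · right; exact this

end BK
/-- If `G₁` is planar with `v₁, v₂, v₃` on a common face of some embedding, and `L'` is
planar with the same terminals on a common face of some embedding, and `G₁`, `L'` are
disjoint except for `{v₁, v₂, v₃}`, then the union `G₁ ∪ L'` is planar. -/
theorem stmt_6 {V : Type} (E₁ E' : V → V → Prop) (S₁ S' : Set V) (v₁ v₂ v₃ : V)
    (hne : v₁ ≠ v₂ ∧ v₂ ≠ v₃ ∧ v₁ ≠ v₃)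
    (hInter : S₁ ∩ S' = {v₁, v₂, v₃})
    (hD₁ : ∃ D : PlaneDrawing E₁ S₁, OnCommonFace D {v₁, v₂, v₃})
    (hD' : ∃ D : PlaneDrawing E' S', OnCommonFace D {v₁, v₂, v₃}) :
    Nonempty (PlaneDrawing (fun u w => E₁ u w ∨ E' u w) (S₁ ∪ S')) := by
  obtain ⟨D₁, h₁⟩ := hD₁
  obtain ⟨D', h'⟩ := hD'
  obtain ⟨n1, n2, n3⟩ := hne
  have hT : Set.range ![v₁, v₂, v₃] = {v₁, v₂, v₃} := by
    ext x
    simp [eq_comm]; tauto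
  have hmem : ∀ i, ![v₁, v₂, v₃] i ∈ S₁ ∩ S' := by
    intro i
    rw [hInter, ← hT]; exact ⟨i, rfl⟩
  let EE : Bool → V → V → Prop := fun b => Bool.rec E₁ E' b
  let SS : Bool → Set V := fun b => Bool.rec S₁ S' b
  let DD : ∀ b, PlaneDrawing (EE b) (SS b) := fun b => Bool.rec D₁ D' b
  have key := BK.gen EE SS DD ![v₁, v₂, v₃] ?_ ?_ ?_ ?_
  · have e1 : (fun u w => ∃ b, EE b u w) = fun u w => E₁ u w ∨ E' u w := by
      funext u w
      apply propext
      constructor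
      · rintro ⟨b, hb⟩
        cases b
        · exact Or.inl hb
        · exact Or.inr hb
      · rintro (h | h)
        · exact ⟨false, h⟩
        · exact ⟨true, h⟩
    have e2 : {v | ∃ b, v ∈ SS b} = S₁ ∪ S' := by
      ext v
      constructor
      · rintro ⟨b, hb⟩
        cases b
        · exact Or.inl hb
        · exact Or.inr hb
      · rintro (h | h)
        · exact ⟨false, h⟩
        · exact ⟨true, h⟩
    rwa [e1, e2] at key
  · intro i j hij
    fin_cases i <;> fin_cases j <;> simp_all
  · intro v b b' hb h1 h2
    rw [hT, ← hInter]
    cases b <;> cases b'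
    · exact absurd rfl hb
    · exact ⟨h1, h2⟩
    · exact ⟨h2, h1⟩
    · exact absurd rfl hb
  · intro i b
    cases b
    · exact (hmem i).1
    · exact (hmem i).2
  · intro b
    rw [hT]
    cases b
    · exact h₁
    · exact h'
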